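/- arXiv:2011.01366 — 6 statements merged into one kernel-verified Lean document; each statement's English description precedes it below -/
import Mathlib

section
/- There is a constant c such that for every k ≥ 1 there exist non-isomorphic 3-regular graphs G_k and H_k with |V(G_k)| = |V(H_k)| ≤ c·k that are k-indistinguishable, i.e., that the k-dimensional Weisfeiler-Leman algorithm does not distinguish. -/
/-- The (value space for the) atomic type of an `m`-tuple of vertices: a pair of binary
relations on `[m]`, recording equalities among the entries and adjacencies among the
entries. This space is independent of the graph, so that atomic types of tuples in
different graphs can be compared. -/
abbrev AtomicType (m : ℕ) : Type :=
  (Fin m → Fin m → Prop) × (Fin m → Fin m → Prop)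

/-- The atomic type of the tuple `v` in the graph `G`. -/
def atp {V : Type*} (G : SimpleGraph V) {m : ℕ} (v : Fin m → V) : AtomicType m :=
  (fun i j => v i = v j, fun i j => G.Adj (v i) (v j))

/-- The space of colors produced by round `i` of the `k`-dimensional Weisfeiler-Leman
algorithm. -/
def WLColor (k : ℕ) : ℕ → Type
  | 0 => AtomicType k
  | i + 1 => WLColor k i × Multiset (AtomicType (k + 1) × (Fin k → WLColor k i))

/-- The coloring of `k`-tuples computed by the `k`-dimensional Weisfeiler-Leman algorithm
after `i` rounds: initially every tuple is colored by its atomic type, and in each round the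
color of `v̄` is refined by the multiset, over all vertices `u`, of the atomic type of `v̄u`
together with the previous colors of the tuples obtained from `v̄` by substituting `u` in
each position. -/
def wlColoring {V : Type*} [Fintype V] (G : SimpleGraph V) (k : ℕ) :
    (i : ℕ) → (Fin k → V) → WLColor k i
  | 0, v => atp G v
  | i + 1, v =>
    (wlColoring G k i v,
      Finset.univ.val.map fun u : V =>
        (atp G (Fin.snoc v u), fun j : Fin k => wlColoring G k i (Function.update v j u)))

/-- Two finite graphs are `k`-indistinguishable: the `k`-dimensional Weisfeiler-Leman
algorithm does not distinguish them, i.e., in every refinement round every color is attained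
by the same number of `k`-tuples in both graphs (in particular this holds for the stable
colorings). -/
def WLIndistinguishable (k : ℕ) {V W : Type*} [Fintype V] [Fintype W]
    (G : SimpleGraph V) (H : SimpleGraph W) : Prop :=
  ∀ (i : ℕ) (c : WLColor k i),
    Nat.card {v : Fin k → V // wlColoring G k i v = c} =
      Nat.card {w : Fin k → W // wlColoring H k i w = c}

/-! ### The bijective pebble game -/

theorem atp_congr {V W : Type*} {G : SimpleGraph V} {H : SimpleGraph W} {m : ℕ}
    {v : Fin m → V} {w : Fin m → W}
    (heq : ∀ i j, v i = v j ↔ w i = w j) (hadj : ∀ i j, G.Adj (v i) (v j) ↔ H.Adj (w i) (w j)) :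
    atp G v = atp H w :=
  Prod.ext (funext₂ fun i j => propext (heq i j)) (funext₂ fun i j => propext (hadj i j))

section Game

variable {V W : Type*} [Fintype V] [Fintype W] {G : SimpleGraph V} {H : SimpleGraph W} {k : ℕ}

/-- A relation between `k`-tuples is a winning strategy for Duplicator in the bijective game. -/
def IsBijectiveStrategy (G : SimpleGraph V) (H : SimpleGraph W) (k : ℕ)
    (R : (Fin k → V) → (Fin k → W) → Prop) : Prop :=
  ∀ v w, R v w → atp G v = atp H w ∧
    ∃ f : V ≃ W, ∀ u, atp G (Fin.snoc v u : Fin (k + 1) → V) = atp H (Fin.snoc w (f u)) ∧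
      ∀ j, R (Function.update v j u) (Function.update w j (f u))

theorem IsBijectiveStrategy.wlColoring_eq {R : (Fin k → V) → (Fin k → W) → Prop}
    (hR : IsBijectiveStrategy G H k R) (i : ℕ) (v : Fin k → V) (w : Fin k → W) (h : R v w) :
    wlColoring G k i v = wlColoring H k i w := by
  induction i generalizing v w with
  | zero => exact (hR v w h).1
  | succ i ih =>
    obtain ⟨-, f, hf⟩ := hR v w h
    refine Prod.ext (ih v w h) ?_
    change Multiset.map _ _ = Multiset.map _ _
    have huniv : (Finset.univ : Finset W).val = (Finset.univ : Finset V).val.map f := by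
      rw [← Finset.map_univ_equiv f]; rfl
    rw [huniv, Multiset.map_map]
    refine Multiset.map_congr rfl fun u _ => ?_
    exact Prod.ext (hf u).1 (funext fun j => ih _ _ ((hf u).2 j))

theorem IsBijectiveStrategy.wlIndistinguishable {R : (Fin k → V) → (Fin k → W) → Prop}
    (hR : IsBijectiveStrategy G H k R) (F : (Fin k → V) ≃ (Fin k → W)) (hF : ∀ v, R v (F v)) :
    WLIndistinguishable k G H := by
  intro i c
  refine Nat.card_congr (F.subtypeEquiv fun v => ?_)
  rw [hR.wlColoring_eq i v (F v) (hF v)]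

theorem wlIndistinguishable_of_iso (e : G ≃g H) : WLIndistinguishable k G H := by
  have key : ∀ {m : ℕ} (v : Fin m → V), atp G v = atp H (e ∘ v) := fun v =>
    atp_congr (fun i j => e.injective.eq_iff.symm) (fun i j => e.map_adj_iff.symm)
  refine IsBijectiveStrategy.wlIndistinguishable (R := fun v w => w = e ∘ v) ?_
    (Equiv.arrowCongr (Equiv.refl _) e.toEquiv) (fun v => rfl)
  rintro v w rfl
  refine ⟨key v, e.toEquiv, fun u => ⟨?_, fun j => ?_⟩⟩
  · rw [key, Fin.comp_snoc]; rfl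
  · exact (Function.comp_update (e : V → W) v j u).symm

theorem WLIndistinguishable.trans {U : Type*} [Fintype U] {K : SimpleGraph U}
    (h₁ : WLIndistinguishable k G H) (h₂ : WLIndistinguishable k H K) :
    WLIndistinguishable k G K :=
  fun i c => (h₁ i c).trans (h₂ i c)

end Game

/-! ### Random functions: a sparse graph in which large sets are joined -/

open Finset in
/-- Some twenty functions on `4 * m` points join any two sets of `m` points. -/
theorem exists_functions_joining (m : ℕ) (hm : 0 < m) :
    ∃ f : Fin 20 → Fin (4 * m) → Fin (4 * m), ∀ A C : Finset (Fin (4 * m)),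
      m ≤ #A → m ≤ #C → ∃ i, ∃ v ∈ A, f i v ∈ C := by
  classical
  suffices h : ∃ f : Fin 20 × Fin (4 * m) → Fin (4 * m), ∀ A C : Finset (Fin (4 * m)),
      #A = m → #C = m → ∃ i, ∃ v ∈ A, f (i, v) ∈ C by
    obtain ⟨f, hf⟩ := h
    refine ⟨fun i v => f (i, v), fun A C hA hC => ?_⟩
    obtain ⟨A', hA', hA''⟩ := exists_subset_card_eq hA
    obtain ⟨C', hC', hC''⟩ := exists_subset_card_eq hC
    obtain ⟨i, v, hv, hi⟩ := hf A' C' hA'' hC''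
    exact ⟨i, v, hA' hv, hC' hi⟩
  by_contra! hbad
  let bad (p : Finset (Fin (4 * m)) × Finset (Fin (4 * m))) :
      Finset (Fin 20 × Fin (4 * m) → Fin (4 * m)) :=
    Fintype.piFinset fun q => if q.2 ∈ p.1 then p.2ᶜ else univ
  let pairs := powersetCard m (univ : Finset (Fin (4 * m))) ×ˢ
    powersetCard m (univ : Finset (Fin (4 * m)))
  have hcover : (univ : Finset (Fin 20 × Fin (4 * m) → Fin (4 * m))) ⊆ pairs.biUnion bad := by
    intro f _
    obtain ⟨A, C, hA, hC, h⟩ := hbad f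
    refine mem_biUnion.2 ⟨(A, C), by simp [pairs, mem_powersetCard, hA, hC], ?_⟩
    refine Fintype.mem_piFinset.2 fun q => ?_
    split_ifs with hq
    · exact mem_compl.2 (h q.1 q.2 hq)
    · exact mem_univ _
  have hcard : ∀ p ∈ pairs, #(bad p) = ((3 * m) ^ m * (4 * m) ^ (3 * m)) ^ 20 := by
    intro p hp
    simp only [pairs, mem_product, mem_powersetCard, subset_univ, true_and] at hp
    have hcompl : #p.1ᶜ = 3 * m := by rw [card_compl, hp.1, Fintype.card_fin]; omega
    have hcompl' : #p.2ᶜ = 3 * m := by rw [card_compl, hp.2, Fintype.card_fin]; omega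
    have hrow : ∏ v, #(if v ∈ p.1 then p.2ᶜ else univ) = (3 * m) ^ m * (4 * m) ^ (3 * m) := by
      rw [← prod_mul_prod_compl p.1]
      congr 1
      · rw [prod_congr rfl (g := fun _ => 3 * m), prod_const, hp.1]
        intro v hv
        rw [if_pos hv, hcompl']
      · rw [prod_congr rfl (g := fun _ => 4 * m), prod_const, hcompl]
        intro v hv
        rw [if_neg (mem_compl.1 hv), card_univ, Fintype.card_fin]
    rw [Fintype.card_piFinset, Fintype.prod_prod_type]
    exact (prod_congr rfl fun _ _ => hrow).trans (Fin.prod_const _ _)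
  have hpairs : #pairs ≤ 2 ^ (4 * m) * 2 ^ (4 * m) := by
    have h : #(powersetCard m (univ : Finset (Fin (4 * m)))) ≤ 2 ^ (4 * m) := by
      refine (card_le_univ _).trans ?_
      simp
    rw [card_product]
    exact Nat.mul_le_mul h h
  have hle := (card_le_card hcover).trans (card_biUnion_le_card_mul pairs bad _
    fun p hp => (hcard p hp).le)
  rw [card_univ, Fintype.card_fun, Fintype.card_prod, Fintype.card_fin, Fintype.card_fin] at hle
  have hle' := hle.trans (Nat.mul_le_mul_right _ hpairs)
  have e₁ : (4 * m) ^ (20 * (4 * m)) = (4 ^ 20) ^ m * (m ^ m * (4 * m) ^ (3 * m)) ^ 20 := by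
    rw [← pow_mul]; ring
  have e₂ : 2 ^ (4 * m) * 2 ^ (4 * m) * ((3 * m) ^ m * (4 * m) ^ (3 * m)) ^ 20 =
      (2 ^ 8 * 3 ^ 20) ^ m * (m ^ m * (4 * m) ^ (3 * m)) ^ 20 := by
    rw [mul_pow (2 ^ 8), ← pow_mul, ← pow_mul]; ring
  rw [e₁, e₂] at hle'
  have := Nat.le_of_mul_le_mul_right hle' (by positivity)
  exact absurd this (not_le.2 (Nat.pow_lt_pow_left (by norm_num) hm.ne.symm))

/-- One step along one of the functions `f i`, in either direction, avoiding `Z`. -/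
def JoinedOff {N : ℕ} (f : Fin 20 → Fin N → Fin N) (Z : Finset (Fin N)) (u v : Fin N) : Prop :=
  u ∉ Z ∧ v ∉ Z ∧ ∃ i, f i u = v ∨ f i v = u

open Finset Relation in
/-- If large sets are joined, then deleting few points leaves a component with more than half
of the points. -/
theorem exists_large_component {m : ℕ} {f : Fin 20 → Fin (4 * m) → Fin (4 * m)}
    (hf : ∀ A C : Finset (Fin (4 * m)), m ≤ #A → m ≤ #C → ∃ i, ∃ v ∈ A, f i v ∈ C)
    (Z : Finset (Fin (4 * m))) (hZ : #Z ≤ m) :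
    ∃ v, v ∉ Z ∧ ∃ S : Finset (Fin (4 * m)), 2 * m < #S ∧
      ∀ w ∈ S, ReflTransGen (JoinedOff f Z) v w := by
  classical
  let closed : Finset (Finset (Fin (4 * m))) := {S | S ⊆ Zᶜ ∧ m ≤ #S ∧
    ∀ u ∈ S, ∀ v, JoinedOff f Z u v → v ∈ S}
  have hZc : 3 * m ≤ #Zᶜ := by rw [card_compl, Fintype.card_fin]; omega
  have hne : closed.Nonempty := ⟨Zᶜ, by
    simp only [closed, mem_filter, mem_univ, true_and]
    exact ⟨subset_rfl, by omega, fun u _ v h => mem_compl.2 h.2.1⟩⟩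
  obtain ⟨S, hS, hmin⟩ := exists_min_image closed card hne
  simp only [closed, mem_filter, mem_univ, true_and] at hS hmin
  obtain ⟨hSZ, hSm, hSc⟩ := hS
  have hrest : #(Zᶜ \ S) < m := by
    by_contra! h
    obtain ⟨i, v, hv, hi⟩ := hf S _ hSm h
    rw [mem_sdiff] at hi
    exact hi.2 (hSc v hv _ ⟨mem_compl.1 (hSZ hv), mem_compl.1 hi.1, i, Or.inl rfl⟩)
  have hSlarge : 2 * m < #S := by
    have := card_sdiff_add_card_eq_card hSZ
    omega
  obtain ⟨v, hv⟩ : S.Nonempty := card_pos.1 (by omega)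
  refine ⟨v, mem_compl.1 (hSZ hv), S, hSlarge, ?_⟩
  let C : Finset (Fin (4 * m)) := {w ∈ S | ReflTransGen (JoinedOff f Z) v w}
  have hCS : C ⊆ S := filter_subset _ _
  suffices hC : C = S from fun w hw => by
    rw [← hC] at hw
    exact (mem_filter.1 hw).2
  by_contra hCne
  have hvC : v ∈ C := mem_filter.2 ⟨hv, .refl⟩
  have h₁ : #C < m := by
    by_contra! h
    refine absurd (hmin C ⟨hCS.trans hSZ, h, fun u hu w hw => ?_⟩)
      (not_le.2 (card_lt_card (hCS.ssubset_of_ne hCne)))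
    exact mem_filter.2 ⟨hSc u (hCS hu) w hw, (mem_filter.1 hu).2.tail hw⟩
  have h₂ : #(S \ C) < m := by
    by_contra! h
    refine absurd (hmin (S \ C) ⟨sdiff_subset.trans hSZ, h, fun u hu w hw => ?_⟩)
      (not_le.2 (card_lt_card (sdiff_ssubset hCS ⟨v, hvC⟩)))
    rw [mem_sdiff] at hu ⊢
    refine ⟨hSc u hu.1 w hw, fun hwC => hu.2 (mem_filter.2 ⟨hu.1, ?_⟩)⟩
    exact (mem_filter.1 hwC).2.tail ⟨hw.2.1, hw.1, hw.2.2.imp fun i => Or.symm⟩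
  have := card_sdiff_add_card_eq_card hCS
  omega

/-! ### The Cai–Fürer–Immerman construction over a bipartite cubic multigraph -/

/-- A bipartite cubic multigraph with vertex set `B`, whose darts are the elements of `B × Fin 3`
and whose edges are the orbits of the dart reversal `flip`. -/
structure BipartiteCubic (B : Type*) where
  /-- Reversal of darts. -/
  flip : B × Fin 3 → B × Fin 3
  flip_flip : ∀ d, flip (flip d) = d
  /-- The bipartition. -/
  side : B → Bool
  side_flip : ∀ d, side (flip d).1 = !side d.1

/-- Triples over `ZMod 2` with sum zero. -/
abbrev EvenTriple : Type := {x : Fin 3 → ZMod 2 // ∑ i, x i = 0}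

/-- Vertices of the CFI graph: inner vertices `(v, x)` and outer vertices `(d, b)`. -/
abbrev CFIVertex (B : Type*) : Type _ := (B × EvenTriple) ⊕ ((B × Fin 3) × ZMod 2)

namespace BipartiteCubic

variable {B : Type*} (M : BipartiteCubic B)

theorem flip_ne (d : B × Fin 3) : M.flip d ≠ d := fun h => by
  have := M.side_flip d
  rw [h] at this
  simp at this

theorem flip_eq_iff {d d' : B × Fin 3} : M.flip d = d' ↔ d = M.flip d' :=
  ⟨fun h => by rw [← h, M.flip_flip], fun h => by rw [h, M.flip_flip]⟩

/-- The adjacency relation of the CFI graph with twist `t`. -/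
def cfiAdj (t : B × Fin 3 → ZMod 2) : CFIVertex B → CFIVertex B → Prop
  | .inl _, .inl _ => False
  | .inl p, .inr q => q.1.1 = p.1 ∧ p.2.1 q.1.2 = q.2
  | .inr q, .inl p => q.1.1 = p.1 ∧ p.2.1 q.1.2 = q.2
  | .inr q, .inr q' => q'.1 = M.flip q.1 ∧ q'.2 = q.2 + t q.1

/-- The CFI graph over `M`, where the edges `d` with `t d = 1` are twisted. -/
def cfi (t : B × Fin 3 → ZMod 2) (ht : ∀ d, t (M.flip d) = t d) : SimpleGraph (CFIVertex B) where
  Adj := M.cfiAdj t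
  symm := ⟨by
    rintro (p | q) (p' | q') h
    · exact h
    · exact h
    · exact h
    · obtain ⟨h₁, h₂⟩ := h
      refine ⟨by rw [h₁, M.flip_flip], ?_⟩
      rw [h₁, ht, h₂, add_assoc, CharTwo.add_self_eq_zero, add_zero]⟩
  loopless := ⟨by
    rintro (p | q) h
    · exact h
    · exact M.flip_ne q.1 h.1.symm⟩

/-! #### Neighborhoods -/

section Neighbors

variable [DecidableEq B] (t : B × Fin 3 → ZMod 2) (ht : ∀ d, t (M.flip d) = t d)

theorem neighborSet_inl (p : B × EvenTriple) :
    (M.cfi t ht).neighborSet (.inl p) =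
      ((Finset.univ.image fun i => .inr ((p.1, i), p.2.1 i) : Finset (CFIVertex B)) : Set _) := by
  ext (p' | ⟨⟨v, i⟩, b⟩)
  · simp [cfi, cfiAdj]
  · simp only [SimpleGraph.mem_neighborSet, cfi, cfiAdj, Finset.coe_image, Finset.coe_univ,
      Set.image_univ, Set.mem_range, Sum.inr.injEq, Prod.mk.injEq]
    constructor
    · rintro ⟨rfl, rfl⟩
      exact ⟨i, ⟨rfl, rfl⟩, rfl⟩
    · rintro ⟨j, ⟨rfl, rfl⟩, rfl⟩
      exact ⟨rfl, rfl⟩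

theorem neighborSet_inr (q : (B × Fin 3) × ZMod 2) :
    (M.cfi t ht).neighborSet (.inr q) =
      ((insert (.inr (M.flip q.1, q.2 + t q.1))
        ((Finset.univ.filter fun x : EvenTriple => x.1 q.1.2 = q.2).image
          fun x => .inl (q.1.1, x)) : Finset (CFIVertex B)) : Set _) := by
  ext (⟨v, x⟩ | q')
  · simp only [SimpleGraph.mem_neighborSet, cfi, cfiAdj, Finset.coe_insert, Finset.coe_image,
      Finset.coe_filter, Finset.mem_univ, true_and, Set.mem_insert_iff, reduceCtorEq, false_or,
      Set.mem_image, Set.mem_ofPred_eq, Sum.inl.injEq, Prod.mk.injEq]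
    constructor
    · rintro ⟨rfl, h⟩
      exact ⟨x, h, rfl, rfl⟩
    · rintro ⟨y, h, rfl, rfl⟩
      exact ⟨rfl, h⟩
  · simp [cfi, cfiAdj, Prod.ext_iff]

theorem ncard_neighborSet (u : CFIVertex B) : ((M.cfi t ht).neighborSet u).ncard = 3 := by
  rcases u with p | q
  · rw [neighborSet_inl, Set.ncard_coe_finset, Finset.card_image_of_injective]
    · simp
    · intro i j h
      simpa using congrArg (Sum.elim (fun _ => 0) fun q => q.1.2) h
  · rw [neighborSet_inr, Set.ncard_coe_finset, Finset.card_insert_of_notMem (by simp),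
      Finset.card_image_of_injective]
    · have h : ∀ (i : Fin 3) (b : ZMod 2),
          (Finset.univ.filter fun x : EvenTriple => x.1 i = b).card = 2 := by decide
      rw [h]
    · intro x y h
      simpa using h

theorem finsum_neighborSet_inl {A : Type*} [AddCommMonoid A] (f : CFIVertex B → A)
    (p : B × EvenTriple) :
    ∑ᶠ u ∈ (M.cfi t ht).neighborSet (.inl p), f u = ∑ i, f (.inr ((p.1, i), p.2.1 i)) := by
  rw [neighborSet_inl, finsum_mem_coe_finset, Finset.sum_image]
  intro i _ j _ h
  simpa using congrArg (Sum.elim (fun _ => 0) fun q => q.1.2) h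

theorem finsum_neighborSet_inr {A : Type*} [AddCommMonoid A] (f : CFIVertex B → A)
    (q : (B × Fin 3) × ZMod 2) :
    ∑ᶠ u ∈ (M.cfi t ht).neighborSet (.inr q), f u = f (.inr (M.flip q.1, q.2 + t q.1)) +
      ∑ x : EvenTriple with x.1 q.1.2 = q.2, f (.inl (q.1.1, x)) := by
  rw [neighborSet_inr, finsum_mem_coe_finset, Finset.sum_insert (by simp), Finset.sum_image]
  intro x _ y _ h
  simpa using h

end Neighbors

/-! #### The kernel of the adjacency matrix over `ZMod 2` -/

/-- The kernel of the adjacency matrix over `ZMod 2`. -/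
def _root_.SimpleGraph.adjKernel {V : Type*} (G : SimpleGraph V) : Set (V → ZMod 2) :=
  {f | ∀ u, ∑ᶠ w ∈ G.neighborSet u, f w = 0}

theorem _root_.SimpleGraph.Iso.comp_mem_adjKernel {V W : Type*} {G : SimpleGraph V}
    {H : SimpleGraph W} (e : G ≃g H) {f : W → ZMod 2} (hf : f ∈ H.adjKernel) :
    f ∘ e ∈ G.adjKernel := by
  intro u
  rw [← hf (e u)]
  refine finsum_mem_eq_of_bijOn e ⟨fun w hw => ?_, e.injective.injOn, fun w hw => ?_⟩
    fun w _ => rfl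
  · exact e.map_adj_iff.2 hw
  · refine ⟨e.symm w, ?_, e.apply_symm_apply w⟩
    rw [SimpleGraph.mem_neighborSet, ← e.map_adj_iff, e.apply_symm_apply]
    exact hw

theorem _root_.SimpleGraph.Iso.ncard_adjKernel_eq {V W : Type*} {G : SimpleGraph V}
    {H : SimpleGraph W} (e : G ≃g H) : G.adjKernel.ncard = H.adjKernel.ncard := by
  refine (Set.ncard_congr (fun f _ => f ∘ e) (fun f hf => e.comp_mem_adjKernel hf)
    (fun f g _ _ h => e.surjective.injective_comp_right h) fun f hf => ?_).symm
  refine ⟨f ∘ e.symm, e.symm.comp_mem_adjKernel hf, ?_⟩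
  funext u
  exact congrArg f (e.symm_apply_apply u)

/-- The indicator function of one side of the bipartition. -/
def sideIndicator (c : Bool) (v : B) : ZMod 2 := if M.side v = c then 1 else 0

theorem sideIndicator_flip (c : Bool) (d : B × Fin 3) :
    M.sideIndicator (!c) (M.flip d).1 = M.sideIndicator c d.1 := by
  simp only [sideIndicator, M.side_flip, Bool.not_inj_iff]

section Kernel

variable [DecidableEq B] {t : B × Fin 3 → ZMod 2} {ht : ∀ d, t (M.flip d) = t d}
  {f : CFIVertex B → ZMod 2}

/-- The total value of `f` on the inner vertices over `v`. -/
def innerSum (f : CFIVertex B → ZMod 2) (v : B) : ZMod 2 := ∑ x : EvenTriple, f (.inl (v, x))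

/-- The total value of `f` on the two outer vertices over the dart `d`. -/
def outerSum (f : CFIVertex B → ZMod 2) (d : B × Fin 3) : ZMod 2 :=
  f (.inr (d, 0)) + f (.inr (d, 1))

theorem inner_eq (hf : f ∈ (M.cfi t ht).adjKernel) (v : B) (x : EvenTriple) :
    ∑ i, f (.inr ((v, i), x.1 i)) = 0 := by
  rw [← M.finsum_neighborSet_inl t ht f (v, x)]
  exact hf _

theorem outer_eq (hf : f ∈ (M.cfi t ht).adjKernel) (d : B × Fin 3) (b : ZMod 2) :
    f (.inr (M.flip d, b + t d)) = ∑ x : EvenTriple, (1 + b + x.1 d.2) * f (.inl (d.1, x)) := by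
  have h := hf (.inr (d, b))
  rw [M.finsum_neighborSet_inr t ht f, CharTwo.add_eq_zero, Finset.sum_filter] at h
  rw [h]
  refine Finset.sum_congr rfl fun x _ => ?_
  have : ∀ a b c : ZMod 2, (if a = b then c else 0) = (1 + b + a) * c := by decide
  exact this _ _ _

theorem outerSum_eq (hf : f ∈ (M.cfi t ht).adjKernel) (v : B) (i : Fin 3) :
    outerSum f (v, i) = outerSum f (v, 0) := by
  have h₀ := M.inner_eq hf v ⟨![0, 0, 0], by decide⟩
  have h₁ := M.inner_eq hf v ⟨![1, 1, 0], by decide⟩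
  have h₂ := M.inner_eq hf v ⟨![1, 0, 1], by decide⟩
  simp only [Fin.sum_univ_three, Matrix.cons_val] at h₀ h₁ h₂
  unfold outerSum
  fin_cases i
  · rfl
  · dsimp
    grind
  · dsimp
    grind

theorem outerSum_flip (hf : f ∈ (M.cfi t ht).adjKernel) (d : B × Fin 3) :
    outerSum f (M.flip d) = innerSum f d.1 := by
  have h₀ := M.outer_eq hf d 0
  have h₁ := M.outer_eq hf d 1
  have h : outerSum f (M.flip d) = f (.inr (M.flip d, 0 + t d)) + f (.inr (M.flip d, 1 + t d)) := by
    have : ∀ b : ZMod 2, b = 0 ∨ b = 1 := by decide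
    rcases this (t d) with h | h
    · rw [h]; rfl
    · rw [h, add_comm]; rfl
  rw [h, h₀, h₁, ← Finset.sum_add_distrib]
  refine Finset.sum_congr rfl fun x _ => ?_
  have : ∀ a c : ZMod 2, (1 + 0 + a) * c + (1 + 1 + a) * c = c := by decide
  exact this _ _

theorem sum_twist_mul_innerSum [Fintype B] (hf : f ∈ (M.cfi t ht).adjKernel) (c : Bool) :
    ∑ d : B × Fin 3, M.sideIndicator c d.1 * ((1 + t d) * innerSum f d.1) = 0 := by
  have hsq : ∀ a : ZMod 2, a * a = a := by decide
  have hflip : ∀ d, f (.inr (M.flip d, 0)) =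
      (1 + t d) * innerSum f d.1 + ∑ x : EvenTriple, x.1 d.2 * f (.inl (d.1, x)) := by
    intro d
    have h := M.outer_eq hf d (t d)
    rw [CharTwo.add_self_eq_zero] at h
    rw [h, innerSum, Finset.mul_sum, ← Finset.sum_add_distrib]
    exact Finset.sum_congr rfl fun x _ => by ring
  have h₁ : ∑ d : B × Fin 3, M.sideIndicator (!c) d.1 *
      (outerSum f (d.1, 0) * f (.inr (d, 0))) = 0 := by
    rw [Fintype.sum_prod_type]
    refine Finset.sum_eq_zero fun v _ => ?_
    dsimp only
    rw [← Finset.mul_sum, ← Finset.mul_sum, M.inner_eq hf v ⟨fun _ => 0, by simp⟩, mul_zero,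
      mul_zero]
  have h₂ : ∑ d : B × Fin 3, M.sideIndicator c d.1 *
      (innerSum f d.1 * ∑ x : EvenTriple, x.1 d.2 * f (.inl (d.1, x))) = 0 := by
    rw [Fintype.sum_prod_type]
    refine Finset.sum_eq_zero fun v _ => ?_
    dsimp only
    rw [← Finset.mul_sum, ← Finset.mul_sum, Finset.sum_comm]
    simp_rw [← Finset.sum_mul]
    rw [Finset.sum_eq_zero fun x _ => by rw [x.2, zero_mul], mul_zero, mul_zero]
  let e : B × Fin 3 ≃ B × Fin 3 := ⟨M.flip, M.flip, M.flip_flip, M.flip_flip⟩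
  have h₃ : ∑ d : B × Fin 3, M.sideIndicator (!c) (M.flip d).1 *
      (outerSum f ((M.flip d).1, 0) * f (.inr (M.flip d, 0))) = 0 :=
    (e.sum_comp fun d => M.sideIndicator (!c) d.1 *
      (outerSum f (d.1, 0) * f (.inr (d, 0)))).trans h₁
  rw [← sub_eq_zero.2 (h₃.trans h₂.symm), ← Finset.sum_sub_distrib]
  refine Finset.sum_congr rfl fun d _ => ?_
  rw [← M.outerSum_eq hf (M.flip d).1 (M.flip d).2, Prod.mk.eta, M.outerSum_flip hf, hflip,
    M.sideIndicator_flip, mul_add, mul_left_comm (innerSum f d.1), hsq]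
  ring

end Kernel

/-- The twist which is `1` on every edge. -/
def fullTwist : B × Fin 3 → ZMod 2 := fun _ => 1

theorem fullTwist_flip (d : B × Fin 3) : fullTwist (M.flip d) = fullTwist d := rfl

/-- The twist which is `1` on every edge but the edge of the dart `d₀`. -/
def punctured [DecidableEq B] (d₀ d : B × Fin 3) : ZMod 2 :=
  if d = d₀ ∨ d = M.flip d₀ then 0 else 1

theorem punctured_flip [DecidableEq B] (d₀ d : B × Fin 3) :
    M.punctured d₀ (M.flip d) = M.punctured d₀ d := by
  unfold punctured
  refine if_congr ?_ rfl rfl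
  rw [M.flip_eq_iff, M.flip_eq_iff, M.flip_flip, or_comm]

theorem not_nonempty_iso [Fintype B] [DecidableEq B] (d₀ : B × Fin 3) :
    ¬ Nonempty (M.cfi fullTwist M.fullTwist_flip ≃g
      M.cfi (M.punctured d₀) (M.punctured_flip d₀)) := by
  rintro ⟨e⟩
  have hside : M.side (M.flip d₀).1 ≠ M.side d₀.1 := by rw [M.side_flip]; simp
  have hvanish : ∀ f ∈ (M.cfi (M.punctured d₀) (M.punctured_flip d₀)).adjKernel,
      ∀ d, d = d₀ ∨ d = M.flip d₀ → innerSum f d.1 = 0 := by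
    intro f hf d hd
    rw [← M.sum_twist_mul_innerSum hf (M.side d.1), Finset.sum_eq_single d]
    · simp [sideIndicator, punctured, hd]
    · intro d' _ hd'
      by_cases h : d' = d₀ ∨ d' = M.flip d₀
      · rw [sideIndicator, if_neg, zero_mul]
        rcases hd with rfl | rfl <;> rcases h with rfl | rfl
        · exact absurd rfl hd'
        · exact hside
        · exact hside.symm
        · exact absurd rfl hd'
      · simp [punctured, h, CharTwo.add_self_eq_zero]
    · simp
  have hsub : (M.cfi (M.punctured d₀) (M.punctured_flip d₀)).adjKernel ⊆
      (M.cfi fullTwist M.fullTwist_flip).adjKernel := by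
    rintro f hf (p | ⟨d, b⟩)
    · rw [finsum_neighborSet_inl, M.inner_eq hf]
    · rw [← hf (.inr (d, b)), finsum_neighborSet_inr, finsum_neighborSet_inr]
      congr 1
      by_cases h : d = d₀ ∨ d = M.flip d₀
      · have hs := (M.outerSum_flip hf d).trans (hvanish f hf d h)
        rw [outerSum, CharTwo.add_eq_zero] at hs
        have : ∀ b : ZMod 2, b = 0 ∨ b = 1 := by decide
        simp only [punctured, h, if_true, fullTwist, add_zero]
        rcases this b with rfl | rfl
        · rw [hs]; rfl
        · rw [← hs]; rfl
      · simp [punctured, h, fullTwist]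
  let f₀ : CFIVertex B → ZMod 2
    | .inl (v, x) => if M.side v = M.side d₀.1 ∧ x.1 = 0 then 1 else 0
    | .inr (d, b) => if M.side d.1 = M.side d₀.1 then 0 else b
  have hf₀ : f₀ ∈ (M.cfi fullTwist M.fullTwist_flip).adjKernel := by
    rintro (p | ⟨d, b⟩)
    · rw [finsum_neighborSet_inl]
      dsimp only [f₀]
      split_ifs
      · simp
      · exact p.2.2
    · rw [finsum_neighborSet_inr]
      have key : ∀ (i : Fin 3) (b : ZMod 2),
          b + 1 + ∑ x : EvenTriple with x.1 i = b, (if x.1 = 0 then 1 else 0) = 0 := by decide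
      dsimp only [f₀]
      rw [M.side_flip, fullTwist]
      by_cases h : M.side d.1 = M.side d₀.1
      · simpa [h] using key d.2 b
      · simp [Bool.eq_not.2 h]
  have hf₀' : innerSum f₀ d₀.1 = 1 := by
    simp only [innerSum, f₀, true_and]
    decide
  have hlt := Set.ncard_lt_ncard (Set.ssubset_iff_subset_ne.2 ⟨hsub, fun h => ?_⟩)
    (Set.toFinite (M.cfi fullTwist M.fullTwist_flip).adjKernel)
  · rw [e.ncard_adjKernel_eq] at hlt
    exact hlt.false
  · rw [← h] at hf₀
    exact one_ne_zero (hf₀'.symm.trans (hvanish f₀ hf₀ d₀ (.inl rfl)))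

/-! #### Shifting vertices of the CFI graph -/

/-- The base vertex below a vertex of the CFI graph. -/
def base : CFIVertex B → B
  | .inl p => p.1
  | .inr q => q.1.1

/-- Translation along `a : B × Fin 3 → ZMod 2`; it moves an inner vertex only if the values of `a`
at its base vertex sum to zero. -/
def shift (a : B × Fin 3 → ZMod 2) : CFIVertex B → CFIVertex B
  | .inl p => .inl (p.1, if h : ∑ i, a (p.1, i) = 0 then
      ⟨fun i => p.2.1 i + a (p.1, i), by rw [Finset.sum_add_distrib, p.2.2, h, add_zero]⟩ else p.2)
  | .inr q => .inr (q.1, q.2 + a q.1)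

@[simp]
theorem base_shift (a : B × Fin 3 → ZMod 2) (u : CFIVertex B) : base (shift a u) = base u := by
  rcases u with p | q <;> rfl

theorem shift_involutive (a : B × Fin 3 → ZMod 2) : Function.Involutive (shift a) := by
  rintro (⟨v, x⟩ | ⟨d, b⟩)
  · by_cases h : ∑ i, a (v, i) = 0
    · simp [shift, h, add_assoc, CharTwo.add_self_eq_zero]
    · simp [shift, h]
  · simp [shift, add_assoc, CharTwo.add_self_eq_zero]

theorem shift_congr {a a' : B × Fin 3 → ZMod 2} {u : CFIVertex B}
    (h : ∀ i, a (base u, i) = a' (base u, i)) : shift a u = shift a' u := by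
  rcases u with ⟨v, x⟩ | ⟨⟨v, i⟩, b⟩
  · replace h : ∀ i, a (v, i) = a' (v, i) := h
    simp only [shift, h]
  · replace h : a (v, i) = a' (v, i) := h i
    simp only [shift, h]

theorem shift_family_involutive (α : B → B × Fin 3 → ZMod 2) :
    Function.Involutive fun u => shift (α (base u)) u := fun u => by
  simp only [base_shift, shift_involutive (α (base u)) u]

variable {t t' : B × Fin 3 → ZMod 2} {ht : ∀ d, t (M.flip d) = t d}
  {ht' : ∀ d, t' (M.flip d) = t' d}

theorem adj_shift_iff {a : B × Fin 3 → ZMod 2} (ha : ∀ d, a d + a (M.flip d) = t d + t' d)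
    {u u' : CFIVertex B} (hu : ∑ i, a (base u, i) = 0) (hu' : ∑ i, a (base u', i) = 0) :
    (M.cfi t' ht').Adj (shift a u) (shift a u') ↔ (M.cfi t ht).Adj u u' := by
  rcases u with ⟨v, x⟩ | ⟨d, b⟩ <;> rcases u' with ⟨v', x'⟩ | ⟨d', b'⟩
  · rfl
  · replace hu : ∑ i, a (v, i) = 0 := hu
    simp only [shift, cfi, cfiAdj, hu, dif_pos]
    refine and_congr_right fun h => ?_
    subst h
    rw [Prod.mk.eta, add_left_inj]
  · replace hu' : ∑ i, a (v', i) = 0 := hu'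
    simp only [shift, cfi, cfiAdj, hu', dif_pos]
    refine and_congr_right fun h => ?_
    subst h
    rw [Prod.mk.eta, add_left_inj]
  · simp only [shift, cfi, cfiAdj]
    refine and_congr_right fun h => ?_
    subst h
    have : ∀ x y z w b b' : ZMod 2, x + y = z + w → (b' + y = b + x + w ↔ b' = b + z) := by decide
    exact this _ _ _ _ _ _ (ha d)

/-! #### Paths avoiding a set of vertices -/

/-- Adjacency in the multigraph after deleting the vertices in `P`. -/
def StepOff (P : Finset B) (u v : B) : Prop :=
  u ∉ P ∧ v ∉ P ∧ ∃ i, (M.flip (u, i)).1 = v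

variable {M}

theorem StepOff.symm {P : Finset B} {u v : B} (h : M.StepOff P u v) : M.StepOff P v u := by
  obtain ⟨hu, hv, i, rfl⟩ := h
  exact ⟨hv, hu, (M.flip (u, i)).2, by rw [Prod.mk.eta, M.flip_flip]⟩

theorem reach_symm {P : Finset B} {u v : B} (h : Relation.ReflTransGen (M.StepOff P) u v) :
    Relation.ReflTransGen (M.StepOff P) v u := by
  induction h with
  | refl => exact .refl
  | tail _ h ih => exact .head h.symm ih

theorem reach_mono {P Q : Finset B} (hPQ : P ⊆ Q) {u v : B}
    (h : Relation.ReflTransGen (M.StepOff Q) u v) : Relation.ReflTransGen (M.StepOff P) u v :=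
  Relation.ReflTransGen.mono
    (fun _ _ h => ⟨fun hu => h.1 (hPQ hu), fun hv => h.2.1 (hPQ hv), h.2.2⟩) _ _ h

/-- After deleting `P`, the vertex `z` remains and reaches more than half of the vertices `r i`. -/
def IsBig (M : BipartiteCubic B) {ι : Type*} [Fintype ι] (r : ι → B) (P : Finset B) (z : B) :
    Prop :=
  z ∉ P ∧ ∃ S : Finset ι, Fintype.card ι < 2 * S.card ∧
    ∀ i ∈ S, Relation.ReflTransGen (M.StepOff P) z (r i)

section Big

variable {ι : Type*} [Fintype ι] {r : ι → B}

theorem IsBig.mono {P Q : Finset B} {z : B} (h : M.IsBig r Q z) (hPQ : P ⊆ Q) : M.IsBig r P z := by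
  obtain ⟨hz, S, hS, hr⟩ := h
  exact ⟨fun hzP => hz (hPQ hzP), S, hS, fun i hi => reach_mono hPQ (hr i hi)⟩

theorem IsBig.reach {P : Finset B} {z z' : B} (h : M.IsBig r P z) (h' : M.IsBig r P z') :
    Relation.ReflTransGen (M.StepOff P) z z' := by
  classical
  obtain ⟨-, S, hS, hr⟩ := h
  obtain ⟨-, S', hS', hr'⟩ := h'
  obtain ⟨i, hi⟩ : (S ∩ S').Nonempty := by
    rw [← Finset.card_pos]
    have h₁ := Finset.card_union_add_card_inter S S'
    have h₂ := Finset.card_le_univ (S ∪ S')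
    omega
  rw [Finset.mem_inter] at hi
  exact (hr i hi.1).trans (reach_symm (hr' i hi.2))

end Big

section Strategy

variable [DecidableEq B]

theorem sum_single_dart (d : B × Fin 3) (v : B) :
    ∑ i, (Pi.single d 1 : B × Fin 3 → ZMod 2) (v, i) = (Pi.single d.1 1 : B → ZMod 2) v := by
  obtain ⟨w, j⟩ := d
  by_cases h : v = w
  · subst h
    rw [Finset.sum_eq_single j] <;> simp +contextual
  · simp [h]

/-- Along a path avoiding `P` one can move a parity defect without changing anything over `P`. -/
theorem exists_transport {P : Finset B} {z z' : B} (h : Relation.ReflTransGen (M.StepOff P) z z') :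
    ∃ c : B × Fin 3 → ZMod 2, (∀ d, c d + c (M.flip d) = 0) ∧ (∀ v ∈ P, ∀ i, c (v, i) = 0) ∧
      ∀ v, ∑ i, c (v, i) = (Pi.single z 1 : B → ZMod 2) v + (Pi.single z' 1 : B → ZMod 2) v := by
  induction h with
  | refl => exact ⟨0, by simp, by simp, fun v => by simp [CharTwo.add_self_eq_zero]⟩
  | @tail y y' _ hstep ih =>
    obtain ⟨c, hc, hcP, hcz⟩ := ih
    obtain ⟨hy, hy', i, rfl⟩ := hstep
    refine ⟨c + (Pi.single (y, i) 1 + Pi.single (M.flip (y, i)) 1), fun d => ?_, fun v hv j => ?_,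
      fun v => ?_⟩
    · have h₁ : (Pi.single (y, i) 1 : B × Fin 3 → ZMod 2) (M.flip d) =
          (Pi.single (M.flip (y, i)) 1 : B × Fin 3 → ZMod 2) d := by
        simp only [Pi.single_apply, M.flip_eq_iff]
      have h₂ : (Pi.single (M.flip (y, i)) 1 : B × Fin 3 → ZMod 2) (M.flip d) =
          (Pi.single (y, i) 1 : B × Fin 3 → ZMod 2) d := by
        simp only [Pi.single_apply, M.flip_eq_iff, M.flip_flip]
      simp only [Pi.add_apply, h₁, h₂]
      rw [add_add_add_comm, hc, zero_add, add_comm (Pi.single _ _ _), CharTwo.add_self_eq_zero]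
    · have h₁ : (v, j) ≠ (y, i) := fun h =>
        hy (by have e : v = y := congrArg Prod.fst h; rwa [e] at hv)
      have h₂ : (v, j) ≠ M.flip (y, i) := fun h =>
        hy' (by have e : v = (M.flip (y, i)).1 := congrArg Prod.fst h; rwa [e] at hv)
      simp [hcP v hv j, h₁, h₂]
    · simp only [Pi.add_apply, Finset.sum_add_distrib, hcz, sum_single_dart]
      rw [add_assoc, ← add_assoc (Pi.single y 1 v), CharTwo.add_self_eq_zero, zero_add]

variable {ι : Type*} [Fintype ι] {r : ι → B} {k : ℕ}

/-- The shift along `a` turns the twist `t` into `t'` except for a parity defect at a single base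
vertex, which is big after deleting `P`. -/
def IsGood (M : BipartiteCubic B) (r : ι → B) (t t' : B × Fin 3 → ZMod 2) (P : Finset B)
    (a : B × Fin 3 → ZMod 2) : Prop :=
  (∀ d, a d + a (M.flip d) = t d + t' d) ∧
    ∃ z, M.IsBig r P z ∧ ∀ v, ∑ i, a (v, i) = (Pi.single z 1 : B → ZMod 2) v

theorem IsGood.mono {P Q : Finset B} {a : B × Fin 3 → ZMod 2} (h : M.IsGood r t t' Q a)
    (hPQ : P ⊆ Q) : M.IsGood r t t' P a :=
  let ⟨h, z, hz, hza⟩ := h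
  ⟨h, z, hz.mono hPQ, hza⟩

theorem IsGood.sum_eq_zero {P : Finset B} {a : B × Fin 3 → ZMod 2} (h : M.IsGood r t t' P a)
    {v : B} (hv : v ∈ P) : ∑ i, a (v, i) = 0 := by
  obtain ⟨-, z, hz, hza⟩ := h
  rw [hza, Pi.single_eq_of_ne]
  rintro rfl
  exact hz.1 hv

theorem IsGood.exists_extend (hbig : ∀ P : Finset B, P.card ≤ k + 1 → ∃ z, M.IsBig r P z)
    {P Q : Finset B} {a : B × Fin 3 → ZMod 2} (h : M.IsGood r t t' P a) (hPQ : P ⊆ Q)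
    (hQ : Q.card ≤ k + 1) :
    ∃ a', M.IsGood r t t' Q a' ∧ ∀ v ∈ P, ∀ i, a' (v, i) = a (v, i) := by
  obtain ⟨he, z, hz, hza⟩ := h
  obtain ⟨z', hz'⟩ := hbig Q hQ
  obtain ⟨c, hc, hcP, hcz⟩ := exists_transport (hz.reach (hz'.mono hPQ))
  refine ⟨a + c, ⟨fun d => ?_, z', hz', fun v => ?_⟩, fun v hv i => ?_⟩
  · rw [Pi.add_apply, Pi.add_apply, add_add_add_comm, he, hc, add_zero]
  · simp only [Pi.add_apply, Finset.sum_add_distrib, hza, hcz]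
    rw [← add_assoc, CharTwo.add_self_eq_zero, zero_add]
  · rw [Pi.add_apply, hcP v hv i, add_zero]

theorem IsGood.atp_eq {P : Finset B} {a : B × Fin 3 → ZMod 2} (h : M.IsGood r t t' P a) {m : ℕ}
    {v : Fin m → CFIVertex B} (hv : ∀ i, base (v i) ∈ P) :
    atp (M.cfi t ht) v = atp (M.cfi t' ht') (shift a ∘ v) :=
  atp_congr (fun _ _ => (shift_involutive a).injective.eq_iff.symm) fun i j =>
    (M.adj_shift_iff h.1 (h.sum_eq_zero (hv i)) (h.sum_eq_zero (hv j))).symm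

/-- The base vertices below a tuple. -/
def tupleBase (v : Fin k → CFIVertex B) : Finset B := Finset.univ.image (base ∘ v)

theorem base_mem_tupleBase (v : Fin k → CFIVertex B) (i : Fin k) : base (v i) ∈ tupleBase v :=
  Finset.mem_image_of_mem (base ∘ v) (Finset.mem_univ i)

theorem card_tupleBase_le (v : Fin k → CFIVertex B) : (tupleBase v).card ≤ k :=
  Finset.card_image_le.trans (by simp)

theorem isBijectiveStrategy [Fintype B]
    (hbig : ∀ P : Finset B, P.card ≤ k + 1 → ∃ z, M.IsBig r P z) :
    IsBijectiveStrategy (M.cfi t ht) (M.cfi t' ht') k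
      fun v w => ∃ a, M.IsGood r t t' (tupleBase v) a ∧ w = shift a ∘ v := by
  rintro v w ⟨a, ha, rfl⟩
  refine ⟨ha.atp_eq (base_mem_tupleBase v), ?_⟩
  have hext := fun y => ha.exists_extend hbig (Finset.subset_insert y (tupleBase v))
    ((Finset.card_insert_le _ _).trans (Nat.succ_le_succ (card_tupleBase_le v)))
  choose α hα hαa using hext
  have hw : ∀ y, shift a ∘ v = shift (α y) ∘ v := fun y => funext fun i =>
    shift_congr fun j => (hαa y _ (base_mem_tupleBase v i) j).symm
  refine ⟨(shift_family_involutive α).toPerm, fun u => ⟨?_, fun j => ⟨α (base u), ?_, ?_⟩⟩⟩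
  · change _ = atp _ (Fin.snoc (shift a ∘ v) (shift (α (base u)) u) : Fin (k + 1) → CFIVertex B)
    rw [hw (base u), ← Fin.comp_snoc]
    refine (hα (base u)).atp_eq fun i => ?_
    refine Fin.lastCases ?_ (fun i => ?_) i
    · rw [Fin.snoc_last]
      exact Finset.mem_insert_self _ _
    · rw [Fin.snoc_castSucc]
      exact Finset.mem_insert_of_mem (base_mem_tupleBase v i)
  · refine (hα (base u)).mono fun y hy => ?_
    obtain ⟨i, -, rfl⟩ := Finset.mem_image.1 hy
    rw [Function.comp_apply]
    by_cases hij : i = j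
    · subst hij
      rw [Function.update_self]
      exact Finset.mem_insert_self _ _
    · rw [Function.update_of_ne hij]
      exact Finset.mem_insert_of_mem (base_mem_tupleBase v i)
  · rw [hw (base u), Function.comp_update]
    rfl

/-- If deleting `k + 1` vertices from the base always leaves a big component, then twisting an edge
in the big component is invisible to the `k`-dimensional Weisfeiler–Leman algorithm. -/
theorem wlIndistinguishable_cfi [Fintype B]
    (hbig : ∀ P : Finset B, P.card ≤ k + 1 → ∃ z, M.IsBig r P z)
    {d₀ : B × Fin 3} (hd₀ : M.IsBig r ∅ d₀.1) :
    WLIndistinguishable k (M.cfi fullTwist M.fullTwist_flip)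
      (M.cfi (M.punctured d₀) (M.punctured_flip d₀)) := by
  have hstart : M.IsGood r fullTwist (M.punctured d₀) ∅ (Pi.single d₀ 1) := by
    refine ⟨fun d => ?_, d₀.1, hd₀, sum_single_dart d₀⟩
    have hne := M.flip_ne d₀
    simp only [Pi.single_apply, M.flip_eq_iff, fullTwist, punctured]
    by_cases h₁ : d = d₀
    · subst h₁
      simp [hne.symm]
    · by_cases h₂ : d = M.flip d₀
      · simp [h₂, hne]
      · simp [h₁, h₂, CharTwo.add_self_eq_zero]
  have hex : ∀ P : Finset B, ∃ a, P.card ≤ k + 1 → M.IsGood r fullTwist (M.punctured d₀) P a := by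
    intro P
    by_cases hP : P.card ≤ k + 1
    · obtain ⟨a, ha, -⟩ := hstart.exists_extend hbig (Finset.empty_subset P) hP
      exact ⟨a, fun _ => ha⟩
    · exact ⟨0, fun h => absurd h hP⟩
  choose α hα using hex
  have hinv : Function.Involutive fun v : Fin k → CFIVertex B => shift (α (tupleBase v)) ∘ v := by
    intro v
    have hb : tupleBase (shift (α (tupleBase v)) ∘ v) = tupleBase v :=
      congrArg (Finset.image · _) (funext fun i => base_shift _ _)
    simp only [hb]
    exact funext fun i => shift_involutive _ _
  exact (isBijectiveStrategy hbig).wlIndistinguishable hinv.toPerm fun v =>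
    ⟨_, hα _ ((card_tupleBase_le v).trans (Nat.le_succ k)), rfl⟩

end Strategy

end BipartiteCubic

/-! ### The base multigraph -/

/-- The bipartite cubic multigraph on `D × Bool` whose three classes of parallel edges are the
graphs of three permutations of `D`. -/
def BipartiteCubic.ofPerms {D : Type*} (τ : Fin 3 → Equiv.Perm D) : BipartiteCubic (D × Bool) where
  flip d := ((if d.1.2 then (τ d.2).symm d.1.1 else τ d.2 d.1.1, !d.1.2), d.2)
  flip_flip := by rintro ⟨⟨x, c⟩, i⟩; cases c <;> simp
  side p := p.2
  side_flip _ := rfl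

/-- The fibers of a map on a finite type are contained in the orbits of a permutation preserving
them. -/
theorem exists_perm_cyclic_on_fibers {D N : Type*} [Fintype D] (h : D → N) :
    ∃ ρ : Equiv.Perm D, (∀ x, h (ρ x) = h x) ∧ ∀ x y, h x = h y → ∃ n : ℕ, (ρ ^ n) x = y := by
  classical
  have hcyc := fun v => (Finset.univ.filter fun x => h x = v).exists_cycleOn
  choose g hg using hcyc
  have hfib : ∀ v x, h x = v ↔ h (g v x) = v := fun v x => by
    have := (hg v).1.apply_mem_iff (x := x)
    simpa using this.symm
  have hfib' : ∀ v x, h x = v → h ((g v).symm x) = v := fun v x hx =>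
    (hfib v _).2 (by rwa [Equiv.apply_symm_apply])
  let ρ : Equiv.Perm D :=
    { toFun := fun x => g (h x) x
      invFun := fun x => (g (h x)).symm x
      left_inv := fun x => by simp only [(hfib (h x) x).1 rfl, Equiv.symm_apply_apply]
      right_inv := fun x => by simp only [hfib' (h x) x rfl, Equiv.apply_symm_apply] }
  have hρ : ∀ x, h (ρ x) = h x := fun x => (hfib (h x) x).1 rfl
  refine ⟨ρ, hρ, fun x y hxy => ?_⟩
  obtain ⟨n, -, hn⟩ := (hg (h x)).1.exists_pow_eq (a := x) (b := y) (by simp) (by simp [hxy])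
  refine ⟨n, hn ▸ ?_⟩
  have hpow : ∀ n : ℕ, (ρ ^ n) x = (g (h x) ^ n) x ∧ h ((ρ ^ n) x) = h x := by
    intro n
    induction n with
    | zero => exact ⟨rfl, rfl⟩
    | succ n ih =>
      rw [pow_succ', pow_succ', Equiv.Perm.mul_apply, Equiv.Perm.mul_apply, ← ih.1]
      refine ⟨?_, (hρ _).trans ih.2⟩
      change g (h ((ρ ^ n) x)) _ = _
      rw [ih.2]
  exact (hpow n).1

/-- Bipartite cubic multigraphs of linear size in which deleting few vertices leaves a big
component. -/
theorem exists_bipartiteCubic_isBig (m : ℕ) (hm : 0 < m) :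
    ∃ (M : BipartiteCubic ((Fin (4 * m) × Fin 20 × Bool) × Bool))
      (r : Fin (4 * m) → (Fin (4 * m) × Fin 20 × Bool) × Bool),
      ∀ P : Finset ((Fin (4 * m) × Fin 20 × Bool) × Bool), P.card ≤ m → ∃ z, M.IsBig r P z := by
  classical
  obtain ⟨f, hf⟩ := exists_functions_joining m hm
  let h : Fin (4 * m) × Fin 20 × Bool → Fin (4 * m) := fun x => if x.2.2 then f x.2.1 x.1 else x.1
  obtain ⟨ρ, hρ, hρ'⟩ := exists_perm_cyclic_on_fibers h
  let σ : Equiv.Perm (Fin (4 * m) × Fin 20 × Bool) :=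
    (Equiv.refl _).prodCongr ((Equiv.refl _).prodCongr Equiv.boolNot)
  let τ : Fin 3 → Equiv.Perm (Fin (4 * m) × Fin 20 × Bool) := ![1, ρ, σ]
  let M := BipartiteCubic.ofPerms τ
  refine ⟨M, fun v => ((v, 0, false), false), fun P hP => ?_⟩
  let Z := P.image fun p => h p.1
  have halive : ∀ {x}, h x ∉ Z → ∀ c, (x, c) ∉ P := fun hx c hc =>
    hx (Finset.mem_image_of_mem (fun p => h p.1) hc)
  have hstep : ∀ (i : Fin 3) x, h x ∉ Z → h (τ i x) ∉ Z →
      Relation.ReflTransGen (M.StepOff P) (x, false) (τ i x, true) := fun i x hx hx' =>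
    .single ⟨halive hx _, halive hx' _, i, rfl⟩
  have hside : ∀ x, h x ∉ Z → ∀ c, Relation.ReflTransGen (M.StepOff P) (x, false) (x, c) := by
    rintro x hx (_ | _)
    · exact .refl
    · exact hstep 0 x hx hx
  have hcluster : ∀ x y c c', h x = h y → h x ∉ Z →
      Relation.ReflTransGen (M.StepOff P) (x, c) (y, c') := by
    intro x y c c' hxy hx
    obtain ⟨n, rfl⟩ := hρ' x y hxy
    refine (BipartiteCubic.reach_symm (hside x hx c)).trans (.trans ?_ (hside _ (hxy ▸ hx) c'))
    clear hxy
    induction n with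
    | zero => exact .refl
    | succ n ih =>
      have hn : h ((ρ ^ n) x) = h x := by
        clear ih
        induction n with
        | zero => rfl
        | succ n ih => rw [pow_succ', Equiv.Perm.mul_apply, hρ, ih]
      rw [pow_succ', Equiv.Perm.mul_apply]
      have hnZ : h ((ρ ^ n) x) ∉ Z := by rwa [hn]
      have hnZ' : h (ρ ((ρ ^ n) x)) ∉ Z := by rwa [hρ]
      exact ih.trans ((hstep 1 _ hnZ hnZ').trans (BipartiteCubic.reach_symm (hside _ hnZ' true)))
  have hedge : ∀ v i, v ∉ Z → f i v ∉ Z →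
      Relation.ReflTransGen (M.StepOff P) ((v, 0, false), false) ((f i v, 0, false), false) := by
    intro v i hv hfv
    exact (hcluster (v, 0, false) (v, i, false) _ _ rfl hv).trans
      ((hstep 2 (v, i, false) hv hfv).trans (hcluster (v, i, true) _ _ _ rfl hfv))
  obtain ⟨v, hvZ, S, hS, hreach⟩ := exists_large_component hf Z (Finset.card_image_le.trans hP)
  refine ⟨((v, 0, false), false), halive (x := (v, 0, false)) hvZ _, S,
    by rw [Fintype.card_fin]; omega, fun w hw => ?_⟩
  have hvw := hreach w hw
  clear hw
  induction hvw with
  | refl => exact .refl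
  | tail _ hstep' ih =>
    refine ih.trans ?_
    obtain ⟨hu, hw, i, rfl | rfl⟩ := hstep'
    · exact hedge _ i hu hw
    · exact BipartiteCubic.reach_symm (hedge _ i hw hu)

theorem SimpleGraph.Iso.ncard_neighborSet {V W : Type*} {G : SimpleGraph V} {H : SimpleGraph W}
    (e : G ≃g H) (v : V) : (H.neighborSet (e v)).ncard = (G.neighborSet v).ncard :=
  (Nat.card_congr (e.mapNeighborSet v)).symm

/-- **Cai–Fürer–Immerman.** There is a constant `c` such that for every `k ≥ 1`
there are non-isomorphic 3-regular graphs `G_k`, `H_k` of the same order at most `c·k` that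
are `k`-indistinguishable. -/
theorem cai_furer_immerman :
    ∃ c : ℕ, ∀ k : ℕ, 1 ≤ k →
      ∃ (n : ℕ) (G H : SimpleGraph (Fin n)),
        n ≤ c * k ∧
        (∀ v, (G.neighborSet v).ncard = 3) ∧
        (∀ v, (H.neighborSet v).ncard = 3) ∧
        ¬ Nonempty (G ≃g H) ∧
        WLIndistinguishable k G H := by
  refine ⟨6400, fun k hk => ?_⟩
  obtain ⟨M, r, hbig⟩ := exists_bipartiteCubic_isBig (k + 1) (Nat.succ_pos k)
  obtain ⟨z, hz⟩ := hbig ∅ (by simp)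
  have hEven : Fintype.card EvenTriple = 4 := by decide
  have hcard : Fintype.card (CFIVertex ((Fin (4 * (k + 1)) × Fin 20 × Bool) × Bool)) =
      3200 * (k + 1) := by
    simp only [Fintype.card_sum, Fintype.card_prod, Fintype.card_fin, Fintype.card_bool, hEven,
      ZMod.card]
    ring
  let G := M.cfi BipartiteCubic.fullTwist M.fullTwist_flip
  let H := M.cfi (M.punctured (z, 0)) (M.punctured_flip (z, 0))
  let e := G.overFinIso hcard
  let e' := H.overFinIso hcard
  refine ⟨3200 * (k + 1), G.overFin hcard, H.overFin hcard, by omega, fun v => ?_, fun v => ?_,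
    fun ⟨φ⟩ => M.not_nonempty_iso (z, 0) ⟨(e.trans φ).trans e'.symm⟩, ?_⟩
  · rw [← e.apply_symm_apply v, e.ncard_neighborSet]
    exact M.ncard_neighborSet _ _ _
  · rw [← e'.apply_symm_apply v, e'.ncard_neighborSet]
    exact M.ncard_neighborSet _ _ _
  · exact (wlIndistinguishable_of_iso e.symm).trans
      ((BipartiteCubic.wlIndistinguishable_cfi hbig hz).trans (wlIndistinguishable_of_iso e'))
end

section
/- Let k ≥ 1. Two finite graphs G and H are k-indistinguishable (i.e., not distinguished by the k-dimensional Weisfeiler-Leman algorithm) if and only if for every finite graph F of tree width at most k, the number of graph homomorphisms from F to G equals the number of graph homomorphisms from F to H. -/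
/-- `(T, β)` is a tree decomposition of `G`: `T` is a tree, every edge of `G` is contained
in some bag, and for every vertex `v` the set of tree nodes whose bag contains `v` is
nonempty and connected in `T`. -/
def IsTreeDecomposition {V ι : Type*} (G : SimpleGraph V) (T : SimpleGraph ι)
    (β : ι → Set V) : Prop :=
  T.IsTree ∧
    (∀ v w, G.Adj v w → ∃ t, v ∈ β t ∧ w ∈ β t) ∧
    (∀ v : V, {t | v ∈ β t}.Nonempty ∧ (T.induce {t | v ∈ β t}).Connected)

/-- `G` has tree width at most `k`: it has a tree decomposition all of whose bags have
size at most `k + 1`. -/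
def TreewidthAtMost {V : Type*} (G : SimpleGraph V) (k : ℕ) : Prop :=
  ∃ (ι : Type) (T : SimpleGraph ι) (β : ι → Set V),
    IsTreeDecomposition G T β ∧ ∀ t, (β t).ncard ≤ k + 1

namespace WLHom

section Bijections

variable {X Y C : Type*} [Fintype X] [Fintype Y]

/-- Two families attaining every value equally often are matched by a bijection. -/
theorem exists_equiv_of_card_fiber_eq {f : X → C} {g : Y → C}
    (h : ∀ c, Nat.card {x // f x = c} = Nat.card {y // g y = c}) :
    ∃ σ : X ≃ Y, ∀ x, f x = g (σ x) := by
  have e : ∀ c, {x // f x = c} ≃ {y // g y = c} := fun c => (Finite.card_eq.mp (h c)).some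
  exact ⟨Equiv.ofFiberEquiv e, fun x => (Equiv.ofFiberEquiv_map e x).symm⟩

theorem exists_equiv_of_map_univ_eq {f : X → C} {g : Y → C}
    (h : Finset.univ.val.map f = Finset.univ.val.map g) :
    ∃ σ : X ≃ Y, ∀ x, f x = g (σ x) := by
  classical
  refine exists_equiv_of_card_fiber_eq fun c => ?_
  have hc := congrArg (Multiset.count c) h
  rw [Multiset.count_map, Multiset.count_map] at hc
  rw [Nat.card_eq_fintype_card, Nat.card_eq_fintype_card, Fintype.card_subtype,
    Fintype.card_subtype]
  simpa [Finset.card_def, Finset.filter_val, eq_comm] using hc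

theorem map_univ_eq_of_equiv {f : X → C} {g : Y → C} (σ : X ≃ Y) (h : ∀ x, f x = g (σ x)) :
    Finset.univ.val.map f = Finset.univ.val.map g := by
  have hf : f = g ∘ σ := funext h
  rw [hf, ← Multiset.map_map]
  congr 1
  simp

/-- Families of characters with the same sum agree up to a bijection of their index types. -/
theorem exists_equiv_of_sum_monoidHom_eq {M : Type*} [MulOneClass M]
    (χ : X → M →* ℤ) (ψ : Y → M →* ℤ) (h : ∀ m, ∑ x, χ x m = ∑ y, ψ y m) :
    ∃ σ : X ≃ Y, ∀ x, χ x = ψ (σ x) := by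
  classical
  have hli := linearIndependent_monoidHom M ℤ
  have key : ∑ x, Finsupp.single (χ x) (1 : ℤ) = ∑ y, Finsupp.single (ψ y) (1 : ℤ) := by
    apply hli
    ext m
    simpa [map_sum, Finset.sum_apply, Finsupp.linearCombination_single] using h m
  refine exists_equiv_of_card_fiber_eq fun c => ?_
  have hc := DFunLike.congr_fun key c
  simp only [Finsupp.coe_finsetSum, Finset.sum_apply, Finsupp.single_apply,
    Finset.sum_boole] at hc
  rw [Nat.card_eq_fintype_card, Nat.card_eq_fintype_card, Fintype.card_subtype,
    Fintype.card_subtype]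
  exact_mod_cast hc

end Bijections

section Coloring

variable {k : ℕ} {V W : Type} {G : SimpleGraph V} {H : SimpleGraph W}

theorem atp_snoc_eq_iff {v : Fin k → V} {w : Fin k → W} {u : V} {x : W} :
    atp G (Fin.snoc v u : Fin (k + 1) → V) = atp H (Fin.snoc w x : Fin (k + 1) → W) ↔
      atp G v = atp H w ∧ ∀ i, (v i = u ↔ w i = x) ∧ (G.Adj (v i) u ↔ H.Adj (w i) x) := by
  simp only [atp, Prod.mk.injEq, funext_iff, eq_iff_iff]
  constructor
  · rintro ⟨h₁, h₂⟩
    refine ⟨⟨fun i j => ?_, fun i j => ?_⟩, fun i => ⟨?_, ?_⟩⟩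
    · simpa using h₁ i.castSucc j.castSucc
    · simpa using h₂ i.castSucc j.castSucc
    · simpa using h₁ i.castSucc (Fin.last k)
    · simpa using h₂ i.castSucc (Fin.last k)
  · rintro ⟨⟨h₁, h₂⟩, h₃⟩
    constructor
    · intro i j
      induction i using Fin.lastCases <;> induction j using Fin.lastCases <;>
        simp [h₁, h₃, eq_comm (a := u), eq_comm (a := x)]
    · intro i j
      induction i using Fin.lastCases <;> induction j using Fin.lastCases <;>
        simp [h₂, h₃, G.adj_comm u, H.adj_comm x]

theorem exists_update_comp {α : Type*} [DecidableEq α] {x : α} {e e₀ : Fin k → α}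
    (hx : x ∈ Set.range e) (he : ∀ i, e i ≠ x → e i ∈ Set.range e₀) :
    ∃ (j : Fin k) (ρ : Fin k → Fin k), ∀ i, (e i = x → ρ i = j) ∧
      (e i ≠ x → ρ i ≠ j ∧ e₀ (ρ i) = e i) := by
  classical
  obtain ⟨i₀, hi₀⟩ := hx
  choose! g hg using he
  have hcard : ((Finset.univ.filter fun i => e i ≠ x).image g).card < k := by
    refine Finset.card_image_le.trans_lt ?_
    have : (Finset.univ.filter fun i => e i ≠ x) ⊂ Finset.univ := by
      rw [Finset.filter_ssubset]
      exact ⟨i₀, Finset.mem_univ _, by simpa using hi₀⟩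
    simpa using Finset.card_lt_card this
  obtain ⟨j, hj⟩ : ∃ j, j ∉ (Finset.univ.filter fun i => e i ≠ x).image g := by
    by_contra! hall
    rw [Finset.eq_univ_of_forall hall] at hcard
    simp at hcard
  refine ⟨j, fun i => if e i = x then j else g i, fun i => ⟨fun h => if_pos h, fun h => ?_⟩⟩
  simp only [if_neg h]
  refine ⟨fun hji => hj ?_, hg i h⟩
  rw [← hji]
  exact Finset.mem_image_of_mem _ (by simpa using h)

theorem atp_comp {m n : ℕ} {v : Fin m → V} {w : Fin m → W} (h : atp G v = atp H w)
    (ρ : Fin n → Fin m) : atp G (v ∘ ρ) = atp H (w ∘ ρ) := by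
  simp only [atp, Prod.mk.injEq, funext_iff, eq_iff_iff] at h ⊢
  exact ⟨fun i j => h.1 _ _, fun i j => h.2 _ _⟩

theorem exists_update_comp_update (ρ : Fin k → Fin k) (i : Fin k) :
    ∃ (j : Fin k) (ρ' : Fin k → Fin k), ∀ {U : Type} (v : Fin k → U) (u : U),
      Function.update (v ∘ ρ) i u = Function.update v j u ∘ ρ' := by
  obtain ⟨j, ρ', h⟩ := exists_update_comp (x := none) (e₀ := fun i => some i)
    (e := Function.update (fun i => some (ρ i)) i none) ⟨i, by simp⟩ (by
      intro i' hi'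
      rcases eq_or_ne i' i with rfl | hne
      · simp at hi'
      · exact ⟨ρ i', by simp [hne]⟩)
  refine ⟨j, ρ', fun v u => funext fun i' => ?_⟩
  rcases eq_or_ne i' i with rfl | hne
  · simp [(h i').1 (by simp)]
  · have h' := (h i').2 (by simp [hne])
    simp only [Function.update_of_ne hne, Option.some.injEq] at h'
    rw [Function.update_of_ne hne, Function.comp_apply, Function.comp_apply,
      Function.update_of_ne h'.1, h'.2]

theorem eq_const_of_atp_eq [NeZero k] {v : Fin k → V} {u : W}
    (h : atp G v = atp H (fun _ => u)) : v = fun _ => v 0 := by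
  have := congrArg Prod.fst h
  simp only [atp, funext_iff, eq_iff_iff, iff_true] at this
  exact funext fun i => this i 0

variable [Fintype V] [Fintype W]

theorem atp_eq_of_wlColoring_eq {r : ℕ} {v : Fin k → V} {w : Fin k → W}
    (h : wlColoring G k r v = wlColoring H k r w) : atp G v = atp H w := by
  induction r with
  | zero => exact h
  | succ r ih => exact ih (congrArg Prod.fst h)

theorem wlColoring_eq_of_le {r s : ℕ} (hrs : r ≤ s) {v : Fin k → V} {w : Fin k → W}
    (h : wlColoring G k s v = wlColoring H k s w) :
    wlColoring G k r v = wlColoring H k r w := by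
  induction s, hrs using Nat.le_induction with
  | base => exact h
  | succ s _ ih => exact ih (congrArg Prod.fst h)

theorem exists_equiv_of_wlColoring_succ_eq {r : ℕ} {v : Fin k → V} {w : Fin k → W}
    (h : wlColoring G k (r + 1) v = wlColoring H k (r + 1) w) :
    ∃ σ : V ≃ W, ∀ u, atp G (Fin.snoc v u : Fin (k + 1) → V) =
        atp H (Fin.snoc w (σ u) : Fin (k + 1) → W) ∧
      ∀ j, wlColoring G k r (Function.update v j u) =
        wlColoring H k r (Function.update w j (σ u)) := by
  obtain ⟨σ, hσ⟩ := exists_equiv_of_map_univ_eq (congrArg Prod.snd h)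
  exact ⟨σ, fun u => ⟨congrArg Prod.fst (hσ u), congrFun (congrArg Prod.snd (hσ u))⟩⟩

theorem wlColoring_comp {r : ℕ} {v : Fin k → V} {w : Fin k → W}
    (h : wlColoring G k r v = wlColoring H k r w) (ρ : Fin k → Fin k) :
    wlColoring G k r (v ∘ ρ) = wlColoring H k r (w ∘ ρ) := by
  induction r generalizing v w ρ with
  | zero => exact atp_comp h ρ
  | succ r ih =>
    obtain ⟨σ, hσ⟩ := exists_equiv_of_wlColoring_succ_eq h
    refine Prod.ext (ih (congrArg Prod.fst h) ρ) (map_univ_eq_of_equiv σ fun u => ?_)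
    refine Prod.ext ?_ (funext fun i => ?_)
    · have := atp_snoc_eq_iff.mp (hσ u).1
      exact atp_snoc_eq_iff.mpr ⟨atp_comp this.1 ρ, fun i => this.2 (ρ i)⟩
    · obtain ⟨j, ρ', hj⟩ := exists_update_comp_update ρ i
      change wlColoring G k r (Function.update (v ∘ ρ) i u) =
        wlColoring H k r (Function.update (w ∘ ρ) i (σ u))
      rw [hj, hj]
      exact ih ((hσ u).2 j) ρ'

theorem card_const_wlColoring [NeZero k] (G : SimpleGraph V) {r : ℕ} {c : WLColor k r}
    (hc : ∀ v : Fin k → V, wlColoring G k r v = c → v = fun _ => v 0) :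
    Nat.card {u // wlColoring G k r (fun _ => u) = c} =
      Nat.card {v // wlColoring G k r v = c} :=
  Nat.card_congr
    { toFun := fun u => ⟨fun _ => u.1, u.2⟩
      invFun := fun v => ⟨v.1 0, hc v.1 v.2 ▸ v.2⟩
      left_inv := fun _ => rfl
      right_inv := fun v => Subtype.ext (hc v.1 v.2).symm }

theorem exists_equiv_const_of_indistinguishable [NeZero k] (h : WLIndistinguishable k G H)
    (r : ℕ) : ∃ σ : V ≃ W, ∀ u, wlColoring G k r (fun _ => u) =
      wlColoring H k r (fun _ => σ u) := by
  refine exists_equiv_of_card_fiber_eq (f := fun u => wlColoring G k r fun _ => u)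
    (g := fun u => wlColoring H k r fun _ => u) fun c => ?_
  by_cases hV : ∃ u, wlColoring G k r (fun _ => u) = c
  · obtain ⟨u, rfl⟩ := hV
    rw [card_const_wlColoring _ fun v hv => eq_const_of_atp_eq (atp_eq_of_wlColoring_eq hv),
      card_const_wlColoring _ fun v hv => eq_const_of_atp_eq (atp_eq_of_wlColoring_eq hv), h]
  by_cases hW : ∃ u, wlColoring H k r (fun _ => u) = c
  · obtain ⟨u, rfl⟩ := hW
    rw [card_const_wlColoring _ fun v hv => eq_const_of_atp_eq (atp_eq_of_wlColoring_eq hv),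
      card_const_wlColoring _ fun v hv => eq_const_of_atp_eq (atp_eq_of_wlColoring_eq hv), h]
  have : IsEmpty {u // wlColoring G k r (fun _ => u) = c} := ⟨fun u => hV ⟨u.1, u.2⟩⟩
  have : IsEmpty {u // wlColoring H k r (fun _ => u) = c} := ⟨fun u => hW ⟨u.1, u.2⟩⟩
  simp

end Coloring

section Elimination

variable {k : ℕ} {V W α ι : Type} [Fintype V] [Fintype W] (G : SimpleGraph V) (H : SimpleGraph W)

/-- Two assignments agree on `S` after `r` rounds: they induce the same atomic type on `S`, and
all `k`-tuples from `S` receive the same color in round `r`. -/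
def AgreeOn (k r : ℕ) (S : Set α) (h : α → V) (h' : α → W) : Prop :=
  (∀ a ∈ S, ∀ b ∈ S, (h a = h b ↔ h' a = h' b) ∧ (G.Adj (h a) (h b) ↔ H.Adj (h' a) (h' b))) ∧
    ∀ e : Fin k → α, (∀ i, e i ∈ S) → wlColoring G k r (h ∘ e) = wlColoring H k r (h' ∘ e)

variable {G H}

theorem AgreeOn.mono {r s : ℕ} (hrs : r ≤ s) {S T : Set α} (hST : S ⊆ T) {h : α → V} {h' : α → W}
    (hT : AgreeOn G H k s T h h') : AgreeOn G H k r S h h' :=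
  ⟨fun a ha b hb => hT.1 a (hST ha) b (hST hb),
    fun e he => wlColoring_eq_of_le hrs (hT.2 e fun i => hST (he i))⟩

theorem exists_range_eq {S : Set α} (hS : S.Nonempty) (hfin : S.Finite) (hcard : S.ncard ≤ k) :
    ∃ e : Fin k → α, Set.range e = S := by
  have := hfin.to_subtype
  have := hS.to_subtype
  have := Fintype.ofFinite S
  obtain ⟨f⟩ : Nonempty (S ↪ Fin k) := by
    refine Function.Embedding.nonempty_of_card_le ?_
    rwa [← Nat.card_eq_fintype_card, Nat.card_coe_set_eq, Fintype.card_fin]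
  refine ⟨Subtype.val ∘ Function.invFun f, ?_⟩
  rw [Set.range_comp, (Function.invFun_surjective f.injective).range_eq]
  simp

theorem AgreeOn.exists_equiv [DecidableEq α] [Finite α]
    (hconst : ∀ r, ∃ σ : V ≃ W, ∀ u, wlColoring G k r (fun _ => u) =
      wlColoring H k r (fun _ => σ u))
    {r : ℕ} {S : Set α} {x : α} (hS : S.ncard ≤ k + 1) (hx : x ∈ S) {h : α → V} {h' : α → W}
    (hh : AgreeOn G H k (r + 1) (S \ {x}) h h') :
    ∃ σ : V ≃ W, ∀ u,
      AgreeOn G H k r S (Function.update h x u) (Function.update h' x (σ u)) := by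
  rcases (S \ {x}).eq_empty_or_nonempty with hemp | hne
  · obtain rfl : S = {x} :=
      Set.Subset.antisymm (Set.sdiff_eq_empty.mp hemp) (Set.singleton_subset_iff.mpr hx)
    obtain ⟨σ, hσ⟩ := hconst r
    refine ⟨σ, fun u => ⟨?_, fun e he => ?_⟩⟩
    · rintro a rfl b rfl
      simp
    · obtain rfl : e = fun _ => x := funext he
      have h₁ : Function.update h x u ∘ (fun _ : Fin k => x) = fun _ => u := by ext; simp
      have h₂ : Function.update h' x (σ u) ∘ (fun _ : Fin k => x) = fun _ => σ u := by ext; simp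
      rw [h₁, h₂, hσ]
  · obtain ⟨e₀, he₀⟩ := exists_range_eq (k := k) hne (Set.toFinite _) (by
      rw [Set.ncard_sdiff_singleton_of_mem hx]
      omega)
    have he₀S : ∀ i, e₀ i ∈ S \ {x} := fun i => he₀ ▸ Set.mem_range_self i
    obtain ⟨σ, hσ⟩ := exists_equiv_of_wlColoring_succ_eq (hh.2 e₀ he₀S)
    have hadj : ∀ u, ∀ a ∈ S \ {x}, (h a = u ↔ h' a = σ u) ∧
        (G.Adj (h a) u ↔ H.Adj (h' a) (σ u)) := by
      intro u a ha
      rw [← he₀] at ha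
      obtain ⟨i, rfl⟩ := ha
      exact (atp_snoc_eq_iff.mp (hσ u).1).2 i
    refine ⟨σ, fun u => ⟨fun a ha b hb => ?_, fun e he => ?_⟩⟩
    · by_cases hax : a = x <;> by_cases hbx : b = x
      · simp [hax, hbx]
      · have := hadj u b ⟨hb, hbx⟩
        simpa [hax, hbx, eq_comm (a := u), eq_comm (a := σ u), G.adj_comm u, H.adj_comm (σ u)]
          using this
      · simpa [hax, hbx] using hadj u a ⟨ha, hax⟩
      · simpa [hax, hbx] using hh.1 a ⟨ha, hax⟩ b ⟨hb, hbx⟩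
    · by_cases hxe : x ∈ Set.range e
      · obtain ⟨j, ρ, hρ⟩ := exists_update_comp (e₀ := e₀) hxe fun i hi => by
          rw [he₀]
          exact ⟨he i, hi⟩
        have comp_eq : ∀ {U : Type} (g : α → U) (z : U),
            Function.update g x z ∘ e = Function.update (g ∘ e₀) j z ∘ ρ := by
          intro U g z
          funext i
          by_cases hi : e i = x
          · simp [hi, (hρ i).1 hi]
          · have := (hρ i).2 hi
            simp [hi, this.1, this.2]
        rw [comp_eq, comp_eq]
        exact wlColoring_comp ((hσ u).2 j) ρ
      · have comp_eq : ∀ {U : Type} (g : α → U) (z : U), Function.update g x z ∘ e = g ∘ e := by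
          intro U g z
          funext i
          exact Function.update_of_ne (fun hi => hxe ⟨i, hi⟩) _ _
        rw [comp_eq, comp_eq]
        exact wlColoring_eq_of_le r.le_succ
          (hh.2 e fun i => ⟨he i, fun hi => hxe ⟨i, hi⟩⟩)

variable (G H)

/-- A pair of functions of assignments that only look at the values on `S` and take equal values
on assignments which agree on `S` after `r` rounds. -/
structure IsFactor (k r : ℕ) (S : Set α) (f : (α → V) → ℤ) (f' : (α → W) → ℤ) : Prop where
  left : DependsOn f S
  right : DependsOn f' S
  eq : ∀ h g, AgreeOn G H k r S h g → f h = f' g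

/-- A product of factors whose scopes are contained in `X` and in one of the bags `β t`. -/
inductive IsFactorProduct (k r : ℕ) (β : ι → Set α) (X : Set α) :
    ((α → V) → ℤ) → ((α → W) → ℤ) → Prop
  | one : IsFactorProduct k r β X 1 1
  | mul (S : Set α) (t : ι) {f f' g g'} (hX : S ⊆ X) (ht : S ⊆ β t)
      (hf : IsFactor G H k r S f f') (hg : IsFactorProduct k r β X g g') :
      IsFactorProduct k r β X (f * g) (f' * g')

variable {G H} {β : ι → Set α} {r : ℕ} {X : Set α}

theorem IsFactor.mono {s : ℕ} (hrs : r ≤ s) {S T : Set α} (hST : S ⊆ T) {f : (α → V) → ℤ}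
    {f' : (α → W) → ℤ} (hf : IsFactor G H k r S f f') : IsFactor G H k s T f f' where
  left := fun _ _ h => hf.left fun i hi => h i (hST hi)
  right := fun _ _ h => hf.right fun i hi => h i (hST hi)
  eq h h' hh := hf.eq h h' (hh.mono hrs hST)

theorem IsFactor.one (S : Set α) :
    IsFactor G H k r S (1 : (α → V) → ℤ) (1 : (α → W) → ℤ) :=
  ⟨fun _ _ _ => rfl, fun _ _ _ => rfl, fun _ _ _ => rfl⟩

theorem IsFactor.mul {S : Set α} {f g : (α → V) → ℤ} {f' g' : (α → W) → ℤ}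
    (hf : IsFactor G H k r S f f') (hg : IsFactor G H k r S g g') :
    IsFactor G H k r S (f * g) (f' * g') where
  left := fun _ _ h => congrArg₂ (· * ·) (hf.left h) (hg.left h)
  right := fun _ _ h => congrArg₂ (· * ·) (hf.right h) (hg.right h)
  eq h h' hh := congrArg₂ (· * ·) (hf.eq h h' hh) (hg.eq h h' hh)

theorem IsFactorProduct.isFactor {f : (α → V) → ℤ} {f' : (α → W) → ℤ}
    (hf : IsFactorProduct G H k r β X f f') : IsFactor G H k r X f f' := by
  induction hf with
  | one => exact .one X
  | mul S t hX ht hf hg ih => exact (hf.mono le_rfl hX).mul ih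

theorem IsFactorProduct.mono {s : ℕ} (hrs : r ≤ s) {f : (α → V) → ℤ} {f' : (α → W) → ℤ}
    (hf : IsFactorProduct G H k r β X f f') : IsFactorProduct G H k s β X f f' := by
  induction hf with
  | one => exact .one
  | mul S t hX ht hf hg ih => exact .mul S t hX ht (hf.mono hrs subset_rfl) ih

/-- Separating the factors whose scope contains `x`. -/
theorem IsFactorProduct.exists_eq_mul {x : α} {S₀ : Set α}
    (hS₀ : ∀ t, x ∈ β t → β t ∩ X ⊆ S₀) {f : (α → V) → ℤ} {f' : (α → W) → ℤ}
    (hf : IsFactorProduct G H k r β X f f') :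
    ∃ a a' c c', IsFactor G H k r S₀ a a' ∧ IsFactorProduct G H k r β (X \ {x}) c c' ∧
      f = a * c ∧ f' = a' * c' := by
  induction hf with
  | one => exact ⟨1, 1, 1, 1, .one S₀, .one, by simp, by simp⟩
  | @mul S t f f' g g' hX ht hf hg ih =>
    obtain ⟨a, a', c, c', ha, hc, rfl, rfl⟩ := ih
    by_cases hx : x ∈ S
    · have hS : S ⊆ S₀ := fun y hy => hS₀ t (ht hx) ⟨ht hy, hX hy⟩
      exact ⟨f * a, f' * a', c, c', (hf.mono le_rfl hS).mul ha, hc, by ring, by ring⟩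
    · exact ⟨a, a', f * c, f' * c', ha,
        .mul S t (fun y hy => ⟨hX hy, fun hyx => hx (hyx ▸ hy)⟩) ht hf hc, by ring, by ring⟩

theorem sum_sum_update [DecidableEq α] [Fintype α] (f : (α → V) → ℤ) (x : α) :
    ∑ h, ∑ u, f (Function.update h x u) = Fintype.card V * ∑ h, f h := by
  let e : (α → V) × V ≃ (α → V) × V :=
    { toFun := fun p => (Function.update p.1 x p.2, p.1 x)
      invFun := fun p => (Function.update p.1 x p.2, p.1 x)
      left_inv := fun p => by simp
      right_inv := fun p => by simp }
  calc ∑ h, ∑ u, f (Function.update h x u) = ∑ p : (α → V) × V, f (e p).1 := by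
        rw [Fintype.sum_prod_type]
        rfl
    _ = ∑ p : (α → V) × V, f p.1 := Equiv.sum_comp e fun p => f p.1
    _ = _ := by simp [Fintype.sum_prod_type, Finset.mul_sum]

theorem sum_elim [DecidableEq α] [Fintype α] {x : α} {a c : (α → V) → ℤ}
    (hc : DependsOn c (X \ {x})) :
    ∑ h, (∑ u, a (Function.update h x u)) * c h = Fintype.card V * ∑ h, (a * c) h := by
  rw [← sum_sum_update _ x]
  refine Finset.sum_congr rfl fun h _ => ?_
  rw [Finset.sum_mul]
  refine Finset.sum_congr rfl fun u _ => ?_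
  rw [Pi.mul_apply]
  congr 1
  exact hc fun i hi => by rw [Function.update_of_ne hi.2]

/-- Variable elimination: bags are ordered so that an element of maximal rank in any set shares
bags only with elements of a single bag. -/
theorem IsFactorProduct.sum_eq [DecidableEq α] [Fintype α] [Nonempty V] [NeZero k]
    (hconst : ∀ r, ∃ σ : V ≃ W, ∀ u, wlColoring G k r (fun _ => u) =
      wlColoring H k r (fun _ => σ u))
    (d : α → ℕ) (hcard : ∀ t, (β t).ncard ≤ k + 1)
    (hβ : ∀ x, ∃ t₀, x ∈ β t₀ ∧ ∀ t, x ∈ β t → ∀ y ∈ β t, d y ≤ d x → y ∈ β t₀)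
    {f : (α → V) → ℤ} {f' : (α → W) → ℤ} (hf : IsFactorProduct G H k r β X f f') :
    ∑ h, f h = ∑ h', f' h' := by
  obtain ⟨σ₀, -⟩ := hconst 0
  induction hn : X.ncard generalizing X r f f' with
  | zero =>
    obtain rfl : X = ∅ := (Set.ncard_eq_zero (Set.toFinite X)).mp hn
    have hk : ∀ h h', f h = f' h' := fun h h' =>
      hf.isFactor.eq h h' ⟨fun a ha => ha.elim, fun e he => (he 0).elim⟩
    rw [← Equiv.sum_comp (Equiv.arrowCongr (Equiv.refl α) σ₀)]
    exact Finset.sum_congr rfl fun h _ => hk _ _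
  | succ n ih =>
    have hne : X.Nonempty := by
      rw [← Set.ncard_pos]
      omega
    obtain ⟨x, hxX, hmax⟩ := Set.exists_max_image X d (Set.toFinite X) hne
    obtain ⟨t₀, hxt₀, ht₀⟩ := hβ x
    obtain ⟨a, a', c, c', ha, hc, rfl, rfl⟩ := hf.exists_eq_mul (x := x) (S₀ := β t₀ ∩ X)
      fun t hxt y hy => ⟨ht₀ t hxt y hy.1 (hmax y hy.2), hy.2⟩
    have hS : (β t₀ ∩ X).ncard ≤ k + 1 :=
      (Set.ncard_le_ncard Set.inter_subset_left).trans (hcard t₀)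
    have helim : IsFactor G H k (r + 1) ((β t₀ ∩ X) \ {x})
        (fun h => ∑ u, a (Function.update h x u)) (fun h => ∑ u, a' (Function.update h x u)) := by
      refine ⟨fun h g hg => ?_, fun h g hg => ?_, fun h h' hh => ?_⟩
      · refine Finset.sum_congr rfl fun u _ => ha.left fun i hi => ?_
        rcases eq_or_ne i x with rfl | hix
        · simp
        · simpa [hix] using hg i ⟨hi, hix⟩
      · refine Finset.sum_congr rfl fun u _ => ha.right fun i hi => ?_
        rcases eq_or_ne i x with rfl | hix
        · simp
        · simpa [hix] using hg i ⟨hi, hix⟩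
      · obtain ⟨σ, hσ⟩ := hh.exists_equiv hconst hS ⟨hxt₀, hxX⟩
        rw [← Equiv.sum_comp σ]
        exact Finset.sum_congr rfl fun u _ => ha.eq _ _ (hσ u)
    have hprod := IsFactorProduct.mul (β := β) (X := X \ {x}) _ t₀
      (Set.sdiff_subset_sdiff_left Set.inter_subset_right)
      (Set.sdiff_subset.trans Set.inter_subset_left) helim (hc.mono r.le_succ)
    have hsum := ih hprod (by rw [Set.ncard_sdiff_singleton_of_mem hxX]; omega)
    simp only [Pi.mul_apply] at hsum
    rw [sum_elim hc.isFactor.left, sum_elim hc.isFactor.right, Fintype.card_congr σ₀] at hsum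
    have : Nonempty W := σ₀.nonempty_congr.mp inferInstance
    exact mul_left_cancel₀ (by simp) hsum

end Elimination

section TreeDecomposition

variable {ι : Type} {T : SimpleGraph ι}

theorem exists_parent (hT : T.IsTree) (ρ : ι) :
    ∃ p : ι → ι, ∀ a b, T.Adj a b → T.dist ρ b = T.dist ρ a + 1 → p b = a := by
  classical
  have huniq : ∀ {a a' b}, T.Adj a b → T.Adj a' b → T.dist ρ b = T.dist ρ a + 1 →
      T.dist ρ b = T.dist ρ a' + 1 → a = a' := by
    intro a a' b ha ha' hd hd'
    obtain ⟨q, hq⟩ := hT.1.exists_walk_length_eq_dist ρ a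
    obtain ⟨q', hq'⟩ := hT.1.exists_walk_length_eq_dist ρ a'
    have h₁ : (q.concat ha).IsPath := (q.concat ha).isPath_of_length_eq_dist (by simp [hq, hd])
    have h₂ : (q'.concat ha').IsPath :=
      (q'.concat ha').isPath_of_length_eq_dist (by simp [hq', hd'])
    have := congrArg SimpleGraph.Walk.penultimate
      ((hT.existsUnique_path ρ b).unique h₁ h₂)
    simpa using this
  refine ⟨fun b => if h : ∃ a, T.Adj a b ∧ T.dist ρ b = T.dist ρ a + 1 then h.choose else b,
    fun a b hab hd => ?_⟩
  have h : ∃ a, T.Adj a b ∧ T.dist ρ b = T.dist ρ a + 1 := ⟨a, hab, hd⟩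
  simp only [dif_pos h]
  exact huniq h.choose_spec.1 hab h.choose_spec.2 hd

/-- In a rooted tree, a connected set has a top node, which is an ancestor of all its nodes. -/
theorem exists_top (hT : T.IsTree) (ρ : ι) {p : ι → ι}
    (hp : ∀ a b, T.Adj a b → T.dist ρ b = T.dist ρ a + 1 → p b = a) {C : Set ι}
    (hC : (T.induce C).Connected) :
    ∃ t ∈ C, ∀ s ∈ C, T.dist ρ t ≤ T.dist ρ s ∧ p^[T.dist ρ s - T.dist ρ t] s = t ∧
      ∀ n ≤ T.dist ρ s - T.dist ρ t, p^[n] s ∈ C := by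
  obtain ⟨c⟩ := hC.nonempty
  obtain ⟨t, htC, hmin⟩ := (measure fun s => T.dist ρ s).wf.has_min C ⟨c.1, c.2⟩
  replace hmin : ∀ s ∈ C, T.dist ρ t ≤ T.dist ρ s := fun s hs => not_lt.mp (hmin s hs)
  refine ⟨t, htC, fun s hs => ⟨hmin s hs, ?_⟩⟩
  have hreach := (SimpleGraph.reachable_iff_reflTransGen _ _).mp (hC ⟨t, htC⟩ ⟨s, hs⟩)
  have key : ∀ s : C, Relation.ReflTransGen (T.induce C).Adj ⟨t, htC⟩ s →
      p^[T.dist ρ s - T.dist ρ t] s = t ∧ ∀ n ≤ T.dist ρ s - T.dist ρ t, p^[n] s ∈ C := by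
    intro s hs
    induction hs with
    | refl => simpa using htC
    | @tail s s' _ hadj ih =>
      have hts := hmin s s.2
      have hts' := hmin s' s'.2
      rcases hT.dist_eq_dist_add_one_of_adj ρ (v := s) (w := s') hadj with hd | hd
      · have hps : p s = s' := hp _ _ hadj.symm hd
        have hsub : T.dist ρ s - T.dist ρ t = T.dist ρ s' - T.dist ρ t + 1 := by omega
        rw [hsub] at ih
        rw [Function.iterate_succ_apply, hps] at ih
        refine ⟨ih.1, fun n hn => ?_⟩
        simpa [hps] using ih.2 (n + 1) (by omega)
      · have hps : p s' = s := hp _ _ hadj hd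
        have hsub : T.dist ρ s' - T.dist ρ t = T.dist ρ s - T.dist ρ t + 1 := by omega
        rw [hsub, Function.iterate_succ_apply, hps]
        refine ⟨ih.1, fun n hn => ?_⟩
        cases n with
        | zero => exact s'.2
        | succ n => simpa [hps] using ih.2 n (by omega)
  exact key ⟨s, hs⟩ hreach

/-- The vertices of a graph with a tree decomposition can be ranked such that every vertex shares
bags with vertices of at most its rank only inside one bag. -/
theorem exists_rank {V : Type} {G : SimpleGraph V} {β : ι → Set V}
    (h : IsTreeDecomposition G T β) :
    ∃ d : V → ℕ, ∀ x, ∃ t₀, x ∈ β t₀ ∧ ∀ t, x ∈ β t → ∀ y ∈ β t, d y ≤ d x → y ∈ β t₀ := by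
  obtain ⟨hT, -, hconn⟩ := h
  obtain ⟨ρ⟩ := hT.1.nonempty
  obtain ⟨p, hp⟩ := exists_parent hT ρ
  choose top htop htop' using fun x => exists_top hT ρ hp (hconn x).2
  refine ⟨fun x => T.dist ρ (top x), fun x => ⟨top x, htop x, fun t hx y hy hle => ?_⟩⟩
  have hx' := htop' x t hx
  have hy' := (htop' y t hy).2.2 (T.dist ρ t - T.dist ρ (top x)) (Nat.sub_le_sub_left hle _)
  rw [hx'.2.1] at hy'
  exact hy'

end TreeDecomposition

section Homomorphisms

variable {k : ℕ} {V W α ι : Type} {G : SimpleGraph V} {H : SimpleGraph W}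

open Classical in
theorem card_hom_eq_sum [Fintype α] [Fintype V] (F : SimpleGraph α) (G : SimpleGraph V) :
    (Nat.card (F →g G) : ℤ) =
      ∑ h : α → V, if ∀ a b, F.Adj a b → G.Adj (h a) (h b) then 1 else 0 := by
  let e : (F →g G) ≃ {h : α → V // ∀ a b, F.Adj a b → G.Adj (h a) (h b)} :=
    { toFun := fun f => ⟨f, fun _ _ hab => f.map_adj hab⟩
      invFun := fun h => ⟨h.1, fun hab => h.2 _ _ hab⟩
      left_inv := fun _ => rfl
      right_inv := fun _ => rfl }
  rw [Finset.sum_boole, Nat.card_congr e, Nat.card_eq_fintype_card, Fintype.card_subtype]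

variable [Fintype V] [Fintype W]

open Classical in
theorem isFactorProduct_edges {F : SimpleGraph α} {β : ι → Set α}
    (hβ : ∀ v w, F.Adj v w → ∃ t, v ∈ β t ∧ w ∈ β t) (s : Finset (α × α))
    (hs : ∀ e ∈ s, F.Adj e.1 e.2) :
    IsFactorProduct G H k 0 β Set.univ
      (fun h => ∏ e ∈ s, if G.Adj (h e.1) (h e.2) then 1 else 0)
      (fun h => ∏ e ∈ s, if H.Adj (h e.1) (h e.2) then 1 else 0) := by
  induction s using Finset.induction_on with
  | empty =>
    simp only [Finset.prod_empty]
    exact .one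
  | insert e s he ih =>
    simp only [Finset.prod_insert he]
    obtain ⟨t, ht₁, ht₂⟩ := hβ _ _ (hs e (Finset.mem_insert_self e s))
    refine IsFactorProduct.mul {e.1, e.2} t (Set.subset_univ _)
      (Set.insert_subset ht₁ (Set.singleton_subset_iff.mpr ht₂)) ⟨?_, ?_, ?_⟩
      (ih fun e' he' => hs e' (Finset.mem_insert_of_mem he'))
    · intro h g hg
      simp only [hg e.1 (by simp), hg e.2 (by simp)]
    · intro h g hg
      simp only [hg e.1 (by simp), hg e.2 (by simp)]
    · intro h h' hh
      simp only [(hh.1 e.1 (by simp) e.2 (by simp)).2]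

theorem card_hom_eq_of_exists_equiv_const [NeZero k] [Fintype α]
    (hconst : ∀ r, ∃ σ : V ≃ W, ∀ u, wlColoring G k r (fun _ => u) =
      wlColoring H k r (fun _ => σ u))
    {F : SimpleGraph α} (hF : TreewidthAtMost F k) :
    Nat.card (F →g G) = Nat.card (F →g H) := by
  classical
  obtain ⟨σ₀, -⟩ := hconst 0
  rcases isEmpty_or_nonempty V with hV | hV
  · have hW : IsEmpty W := σ₀.isEmpty_congr.mp hV
    rcases isEmpty_or_nonempty α with hα | ⟨⟨a⟩⟩
    · have e : ∀ {U : Type} (K : SimpleGraph U), Nat.card (F →g K) = 1 := fun K =>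
        Nat.card_eq_one_iff_unique.mpr
          ⟨⟨fun f g => DFunLike.ext _ _ fun a => hα.elim a⟩, ⟨⟨hα.elim, fun {a} => hα.elim a⟩⟩⟩
      rw [e, e]
    · have : IsEmpty (F →g G) := ⟨fun f => hV.elim (f a)⟩
      have : IsEmpty (F →g H) := ⟨fun f => hW.elim (f a)⟩
      simp
  obtain ⟨ι, T, β, hdec, hcard⟩ := hF
  obtain ⟨d, hd⟩ := exists_rank hdec
  have key := (isFactorProduct_edges (k := k) (G := G) (H := H) hdec.2.1
    (Finset.univ.filter fun e : α × α => F.Adj e.1 e.2) (by simp)).sum_eq hconst d hcard hd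
  have hprod : ∀ {U : Type} (K : SimpleGraph U) (h : α → U),
      (∏ e ∈ Finset.univ.filter fun e : α × α => F.Adj e.1 e.2,
        if K.Adj (h e.1) (h e.2) then (1 : ℤ) else 0) =
      if ∀ a b, F.Adj a b → K.Adj (h a) (h b) then 1 else 0 := by
    intro U K h
    rw [Finset.prod_ite_zero]
    simp
  simp only [hprod, ← card_hom_eq_sum] at key
  exact_mod_cast key

theorem indistinguishable_of_exists_equiv_const [NeZero k]
    (hconst : ∀ r, ∃ σ : V ≃ W, ∀ u, wlColoring G k r (fun _ => u) =
      wlColoring H k r (fun _ => σ u)) : WLIndistinguishable k G H := by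
  classical
  intro r c
  obtain ⟨σ₀, -⟩ := hconst 0
  rcases isEmpty_or_nonempty V with hV | hV
  · have hW : IsEmpty W := σ₀.isEmpty_congr.mp hV
    simp
  have hfac : IsFactor G H k r Set.univ
      (fun v : Fin k → V => if wlColoring G k r v = c then 1 else 0)
      (fun w : Fin k → W => if wlColoring H k r w = c then 1 else 0) := by
    refine ⟨fun v v' hv => ?_, fun v v' hv => ?_, fun v w hvw => ?_⟩
    · rw [show v = v' from funext fun i => hv i (Set.mem_univ i)]
    · rw [show v = v' from funext fun i => hv i (Set.mem_univ i)]
    · have := hvw.2 id fun i => Set.mem_univ _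
      simp only [Function.comp_id] at this
      rw [this]
  have key := (IsFactorProduct.mul (β := fun _ : Unit => Set.univ) Set.univ () subset_rfl
    subset_rfl hfac .one).sum_eq hconst (fun _ => 0) (by simp) (by simp)
  simp only [mul_one, Finset.sum_boole] at key
  rw [Nat.card_eq_fintype_card, Nat.card_eq_fintype_card, Fintype.card_subtype,
    Fintype.card_subtype]
  exact_mod_cast key

end Homomorphisms

section Terms

/-- Terms denoting integer-valued functions of `k`-tuples of vertices. -/
inductive Term (k : ℕ) : Type
  | one : Term k
  | mul (a b : Term k) : Term k
  | reindex (ρ : Fin k → Fin k) (a : Term k) : Term k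
  | sum (N : Set (Fin k)) (τ : Fin k → Term k) : Term k

namespace Term

variable {k : ℕ}

open Classical in
/-- The value of a term at a tuple: a sum term ranges over all vertices adjacent to the entries
with index in `N`, and substitutes them for each entry. -/
noncomputable def eval {V : Type} [Fintype V] (G : SimpleGraph V) : Term k → (Fin k → V) → ℤ
  | one, _ => 1
  | mul a b, v => a.eval G v * b.eval G v
  | reindex ρ a, v => a.eval G (v ∘ ρ)
  | sum N τ, v => ∑ u, if ∀ i ∈ N, G.Adj (v i) u then
      ∏ j, (τ j).eval G (Function.update v j u) else 0

/-- The size of a term. -/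
def size : Term k → ℕ
  | one => 1
  | mul a b => a.size + b.size + 1
  | reindex _ a => a.size + 1
  | sum _ τ => ∑ j, (τ j).size + 1

theorem size_pos (τ : Term k) : 0 < τ.size := by
  cases τ <;> simp [size]

/-- The functions of a tuple and a further vertex used to tell vertices apart: adjacency to an
entry, equality to an entry, and a term after substituting the vertex for an entry. -/
abbrev Probe (k : ℕ) : Type := Fin k ⊕ Fin k ⊕ (Fin k × Term k)

open Classical in
/-- The value of a probe. -/
noncomputable def Probe.eval {V : Type} [Fintype V] (G : SimpleGraph V) (v : Fin k → V) (u : V) :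
    Probe k → ℤ
  | .inl i => if G.Adj (v i) u then 1 else 0
  | .inr (.inl i) => if v i = u then 1 else 0
  | .inr (.inr (j, τ)) => τ.eval G (Function.update v j u)

open Classical in
theorem Probe.exists_lift_eq (l : FreeMonoid (Probe k)) :
    ∃ (E N : Set (Fin k)) (τ : Fin k → Term k), ∀ {V : Type} [Fintype V] (G : SimpleGraph V)
      (v : Fin k → V) (u : V), FreeMonoid.lift (Probe.eval G v u) l =
        if ∀ i ∈ E, v i = u then
          if ∀ i ∈ N, G.Adj (v i) u then ∏ j, (τ j).eval G (Function.update v j u) else 0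
        else 0 := by
  induction l using FreeMonoid.inductionOn' with
  | one => exact ⟨∅, ∅, fun _ => one, by simp [Term.eval]⟩
  | of_mul q l ih =>
    obtain ⟨E, N, τ, ih⟩ := ih
    simp only [map_mul, FreeMonoid.lift_eval_of, ih]
    rcases q with i | i | ⟨j, σ⟩
    · refine ⟨E, insert i N, τ, fun G v u => ?_⟩
      by_cases h₁ : G.Adj (v i) u <;> simp [Probe.eval, h₁]
    · refine ⟨insert i E, N, τ, fun G v u => ?_⟩
      by_cases h₁ : v i = u <;> simp [Probe.eval, h₁]
    · refine ⟨E, N, Function.update τ j (mul σ (τ j)), fun G v u => ?_⟩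
      have : ∏ j', (Function.update τ j (mul σ (τ j)) j').eval G (Function.update v j' u) =
          σ.eval G (Function.update v j u) * ∏ j', (τ j').eval G (Function.update v j' u) := by
        rw [← Finset.mul_prod_erase _ _ (Finset.mem_univ j),
          ← Finset.mul_prod_erase _ (fun j' => (τ j').eval G _) (Finset.mem_univ j)]
        simp only [Function.update_self, Term.eval, mul_assoc]
        congr 2
        refine Finset.prod_congr rfl fun j' hj' => ?_
        rw [Function.update_of_ne (Finset.ne_of_mem_erase hj')]
      simp only [this, Probe.eval, mul_ite, mul_zero]

variable {V W : Type} [Fintype V] [Fintype W] {G : SimpleGraph V} {H : SimpleGraph W}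

theorem Probe.sum_lift_eq {v : Fin k → V} {w : Fin k → W}
    (h : ∀ τ : Term k, τ.eval G v = τ.eval H w) (hat : atp G v = atp H w)
    (l : FreeMonoid (Probe k)) :
    ∑ u, FreeMonoid.lift (Probe.eval G v u) l = ∑ u, FreeMonoid.lift (Probe.eval H w u) l := by
  classical
  obtain ⟨E, N, τ, hl⟩ := Probe.exists_lift_eq l
  simp only [hl]
  rcases E.eq_empty_or_nonempty with rfl | ⟨i, hi⟩
  · simpa [Term.eval] using h (sum N τ)
  · have collapse : ∀ {U : Type} [Fintype U] (x : Fin k → U) (f : U → ℤ),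
        (∑ u, if ∀ i' ∈ E, x i' = u then f u else 0) =
          if ∀ i' ∈ E, x i' = x i then f (x i) else 0 := by
      intro U _ x f
      rw [Finset.sum_eq_single (x i)]
      · intro u _ hu
        exact if_neg fun hE => hu (hE i hi).symm
      · simp
    have hupd : ∀ {U : Type} (x : Fin k → U) (j : Fin k),
        Function.update x j (x i) = x ∘ Function.update id j i := by
      intro U x j
      funext i'
      rcases eq_or_ne i' j with rfl | hne <;> simp [*]
    simp only [atp, Prod.mk.injEq, funext_iff, eq_iff_iff] at hat
    simp only [collapse, hat.1, hat.2, hupd]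
    have := fun j => h (reindex (Function.update id j i) (τ j))
    simp only [Term.eval] at this
    simp only [this]

theorem wlColoring_eq {v : Fin k → V} {w : Fin k → W}
    (h : ∀ τ : Term k, τ.eval G v = τ.eval H w) (hat : atp G v = atp H w) (r : ℕ) :
    wlColoring G k r v = wlColoring H k r w := by
  classical
  induction r generalizing v w with
  | zero => exact hat
  | succ r ih =>
    obtain ⟨σ, hσ⟩ := exists_equiv_of_sum_monoidHom_eq _ _ (Probe.sum_lift_eq h hat)
    have hprobe : ∀ u q, Probe.eval G v u q = Probe.eval H w (σ u) q := fun u q => by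
      simpa using DFunLike.congr_fun (hσ u) (FreeMonoid.of q)
    have hiff : ∀ {P Q : Prop} [Decidable P] [Decidable Q],
        (if P then (1 : ℤ) else 0) = (if Q then 1 else 0) → (P ↔ Q) := by
      intro P Q _ _ hPQ
      by_cases hP : P <;> by_cases hQ : Q <;> simp_all
    have hadj : ∀ u i, (v i = u ↔ w i = σ u) ∧ (G.Adj (v i) u ↔ H.Adj (w i) (σ u)) :=
      fun u i => ⟨hiff (hprobe u (.inr (.inl i))), hiff (hprobe u (.inl i))⟩
    refine Prod.ext (ih h hat) (map_univ_eq_of_equiv σ fun u => ?_)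
    have hsnoc : atp G (Fin.snoc v u : Fin (k + 1) → V) =
        atp H (Fin.snoc w (σ u) : Fin (k + 1) → W) := atp_snoc_eq_iff.mpr ⟨hat, hadj u⟩
    refine Prod.ext hsnoc (funext fun j => ih (fun τ => hprobe u (.inr (.inr (j, τ)))) ?_)
    have hupd : ∀ {U : Type} (x : Fin k → U) (z : U), Function.update x j z =
        (Fin.snoc x z : Fin (k + 1) → U) ∘
          Function.update Fin.castSucc j (Fin.last k) := by
      intro U x z
      funext i
      rcases eq_or_ne i j with rfl | hne <;> simp [*]
    rw [hupd v u, hupd w (σ u)]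
    exact atp_comp hsnoc _

theorem exists_equiv_const
    (h : ∀ τ : Term k, ∑ u, τ.eval G (fun _ => u) = ∑ u, τ.eval H (fun _ => u)) :
    ∃ σ : V ≃ W, ∀ r u, wlColoring G k r (fun _ => u) = wlColoring H k r (fun _ => σ u) := by
  have hlist : ∀ l : FreeMonoid (Term k), ∃ τ : Term k, ∀ {U : Type} [Fintype U]
      (K : SimpleGraph U) (u : U),
      FreeMonoid.lift (fun τ : Term k => τ.eval K fun _ => u) l = τ.eval K fun _ => u := by
    intro l
    induction l using FreeMonoid.inductionOn' with
    | one => exact ⟨one, by simp [Term.eval]⟩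
    | of_mul a l ih =>
      obtain ⟨τ, hτ⟩ := ih
      exact ⟨mul a τ, by simp [Term.eval, hτ]⟩
  obtain ⟨σ, hσ⟩ := exists_equiv_of_sum_monoidHom_eq
    (fun u => FreeMonoid.lift fun τ : Term k => τ.eval G fun _ => u)
    (fun u => FreeMonoid.lift fun τ : Term k => τ.eval H fun _ => u) fun l => by
      obtain ⟨τ, hτ⟩ := hlist l
      simp only [hτ, h]
  refine ⟨σ, fun r u => wlColoring_eq (fun τ => ?_) (by simp [atp]) r⟩
  simpa using DFunLike.congr_fun (hσ u) (FreeMonoid.of τ)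

end Term

end Terms

section Realization

variable {k m : ℕ}

/-- A graph on `{0, …, m}` built by successively adding vertices, where `p` is the parent function
of a tree on the vertices, the bag `β i` consists of `i` and elements of the bag of its parent,
and the neighbors of `i` below `i` belong to `β i`. -/
structure IsBuild (k : ℕ) (F : SimpleGraph (Fin (m + 1))) (β : Fin (m + 1) → Set (Fin (m + 1)))
    (p : Fin (m + 1) → Fin (m + 1)) : Prop where
  self_mem : ∀ i, i ∈ β i
  le_of_mem : ∀ i, ∀ j ∈ β i, j ≤ i
  parent_lt : ∀ i ≠ 0, p i < i
  mem_parent : ∀ i, ∀ j ∈ β i, j ≠ i → j ∈ β (p i)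
  mem_of_adj : ∀ i j, F.Adj j i → j < i → j ∈ β i
  card_le : ∀ i, (β i).ncard ≤ k + 1

/-- The graph joining each nonzero element to its parent. -/
def parentGraph (p : Fin (m + 1) → Fin (m + 1)) : SimpleGraph (Fin (m + 1)) :=
  SimpleGraph.fromRel fun i j => i ≠ 0 ∧ j = p i

theorem connected_induce_parentGraph {p : Fin (m + 1) → Fin (m + 1)} (hp : ∀ i ≠ 0, p i < i)
    {C : Set (Fin (m + 1))} {t : Fin (m + 1)} (ht : t ∈ C)
    (hC : ∀ i ∈ C, i ≠ t → i ≠ 0 ∧ p i ∈ C) : ((parentGraph p).induce C).Connected := by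
  have key : ∀ i (hi : i ∈ C), ((parentGraph p).induce C).Reachable ⟨i, hi⟩ ⟨t, ht⟩ := by
    intro i
    induction i using WellFoundedLT.induction with
    | ind i ih =>
      intro hi
      rcases eq_or_ne i t with rfl | hne
      · exact .refl _
      · obtain ⟨h0, hpC⟩ := hC i hi hne
        have hadj : ((parentGraph p).induce C).Adj ⟨i, hi⟩ ⟨p i, hpC⟩ := by
          simp [parentGraph, h0, (hp i h0).ne']
        exact hadj.reachable.trans (ih _ (hp i h0) hpC)
  have : Nonempty C := ⟨⟨t, ht⟩⟩
  exact { preconnected := fun a b => (key a a.2).trans (key b b.2).symm }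

theorem isTree_parentGraph {p : Fin (m + 1) → Fin (m + 1)} (hp : ∀ i ≠ 0, p i < i) :
    (parentGraph p).IsTree := by
  have hconn : (parentGraph p).Connected :=
    (SimpleGraph.induceUnivIso _).connected_iff.mp
      (connected_induce_parentGraph hp (Set.mem_univ 0) fun i _ hi => ⟨hi, Set.mem_univ _⟩)
  refine SimpleGraph.isTree_iff_connected_and_card.mpr
    ⟨hconn, le_antisymm ?_ hconn.card_vert_le_card_edgeSet_add_one⟩
  have hsub : (parentGraph p).edgeSet ⊆ (fun i => s(i, p i)) '' {0}ᶜ := by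
    intro e
    induction e with
    | h a b =>
      intro hab
      rw [SimpleGraph.mem_edgeSet, parentGraph, SimpleGraph.fromRel_adj] at hab
      obtain ⟨-, ⟨h0, rfl⟩ | ⟨h0, rfl⟩⟩ := hab
      · exact ⟨a, h0, rfl⟩
      · exact ⟨b, h0, Sym2.eq_swap⟩
  have h₁ := (Set.ncard_le_ncard hsub).trans (Set.ncard_image_le (Set.toFinite _))
  rw [Set.ncard_compl, Set.ncard_singleton, Nat.card_fin] at h₁
  rw [Nat.card_coe_set_eq, Nat.card_fin]
  omega

theorem IsBuild.treewidthAtMost {F : SimpleGraph (Fin (m + 1))}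
    {β : Fin (m + 1) → Set (Fin (m + 1))} {p : Fin (m + 1) → Fin (m + 1)}
    (h : IsBuild k F β p) : TreewidthAtMost F k := by
  refine ⟨Fin (m + 1), parentGraph p, β, ⟨isTree_parentGraph h.parent_lt, fun v w hvw => ?_,
    fun v => ⟨⟨v, h.self_mem v⟩, ?_⟩⟩, h.card_le⟩
  · rcases lt_or_gt_of_ne hvw.ne with hlt | hlt
    · exact ⟨w, h.mem_of_adj w v hvw hlt, h.self_mem w⟩
    · exact ⟨v, h.self_mem v, h.mem_of_adj v w hvw.symm hlt⟩
  · refine connected_induce_parentGraph h.parent_lt (t := v) (h.self_mem v) fun i hi hne => ?_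
    exact ⟨Fin.ne_zero_of_lt (lt_of_le_of_ne (h.le_of_mem i v hi) hne.symm),
      h.mem_parent i v hi hne.symm⟩

/-- Adding a new last vertex adjacent to the vertices in `A`. -/
def snocVertex {n : ℕ} (F : SimpleGraph (Fin n)) (A : Set (Fin n)) : SimpleGraph (Fin (n + 1)) :=
  SimpleGraph.fromRel fun a b => (∃ x y, F.Adj x y ∧ a = x.castSucc ∧ b = y.castSucc) ∨
    ∃ x ∈ A, a = x.castSucc ∧ b = Fin.last n

theorem snocVertex_adj_castSucc {n : ℕ} {F : SimpleGraph (Fin n)} {A : Set (Fin n)} {x y : Fin n} :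
    (snocVertex F A).Adj x.castSucc y.castSucc ↔ F.Adj x y := by
  simp only [snocVertex, SimpleGraph.fromRel_adj, Fin.castSucc_inj, Fin.castSucc_ne_last, and_false,
    exists_false, or_false, ne_eq]
  constructor
  · rintro ⟨-, ⟨x, y, h, rfl, rfl⟩ | ⟨x, y, h, rfl, rfl⟩⟩
    exacts [h, h.symm]
  · exact fun h => ⟨h.ne, .inl ⟨x, y, h, rfl, rfl⟩⟩

theorem snocVertex_adj_last {n : ℕ} {F : SimpleGraph (Fin n)} {A : Set (Fin n)} {x : Fin n} :
    (snocVertex F A).Adj x.castSucc (Fin.last n) ↔ x ∈ A := by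
  simp [snocVertex, SimpleGraph.fromRel_adj, (Fin.castSucc_ne_last _).symm, Fin.castSucc_ne_last]

theorem forall_snocVertex_adj {n : ℕ} {F : SimpleGraph (Fin n)} {A : Set (Fin n)} {V : Type}
    {G : SimpleGraph V} {h : Fin n → V} {u : V} :
    (∀ a b, (snocVertex F A).Adj a b → G.Adj ((Fin.snoc h u : Fin (n + 1) → V) a)
        ((Fin.snoc h u : Fin (n + 1) → V) b)) ↔
      (∀ a b, F.Adj a b → G.Adj (h a) (h b)) ∧ ∀ a ∈ A, G.Adj (h a) u := by
  constructor
  · intro hh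
    refine ⟨fun a b hab => ?_, fun a ha => ?_⟩
    · simpa using hh _ _ (snocVertex_adj_castSucc.mpr hab)
    · simpa using hh _ _ (snocVertex_adj_last.mpr ha)
  · rintro ⟨h₁, h₂⟩ a b hab
    induction a using Fin.lastCases with
    | last =>
      induction b using Fin.lastCases with
      | last => exact (hab.ne rfl).elim
      | cast b => simpa using (h₂ b (snocVertex_adj_last.mp hab.symm)).symm
    | cast a =>
      induction b using Fin.lastCases with
      | last => simpa using h₂ a (snocVertex_adj_last.mp hab)
      | cast b => simpa using h₁ a b (snocVertex_adj_castSucc.mp hab)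

theorem IsBuild.snocVertex {F : SimpleGraph (Fin (m + 1))}
    {β : Fin (m + 1) → Set (Fin (m + 1))} {p : Fin (m + 1) → Fin (m + 1)}
    (h : IsBuild k F β p) {e : Fin k → Fin (m + 1)} {t : Fin (m + 1)} (he : ∀ i, e i ∈ β t)
    {A : Set (Fin (m + 1))} (hA : A ⊆ Set.range e) :
    IsBuild k (snocVertex F A)
      (Fin.snoc (fun i => Fin.castSucc '' β i)
        (insert (Fin.last (m + 1)) (Set.range (Fin.castSucc ∘ e))) :
          Fin (m + 2) → Set (Fin (m + 2)))
      (Fin.snoc (Fin.castSucc ∘ p) t.castSucc : Fin (m + 2) → Fin (m + 2)) where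
  self_mem i := by
    induction i using Fin.lastCases <;> simp [h.self_mem]
  le_of_mem i j hj := by
    induction i using Fin.lastCases with
    | last => exact Fin.le_last j
    | cast i =>
      rw [Fin.snoc_castSucc] at hj
      obtain ⟨j, hj, rfl⟩ := hj
      exact Fin.castSucc_le_castSucc_iff.mpr (h.le_of_mem i j hj)
  parent_lt i hi := by
    induction i using Fin.lastCases with
    | last => simp
    | cast i => simpa using h.parent_lt i (by simpa using hi)
  mem_parent i j hj hne := by
    induction i using Fin.lastCases with
    | last =>
      rw [Fin.snoc_last] at hj ⊢
      obtain ⟨i, rfl⟩ := hj.resolve_left hne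
      rw [Fin.snoc_castSucc]
      exact Set.mem_image_of_mem _ (he i)
    | cast i =>
      rw [Fin.snoc_castSucc] at hj ⊢
      obtain ⟨j, hj, rfl⟩ := hj
      rw [Function.comp_apply, Fin.snoc_castSucc]
      exact Set.mem_image_of_mem _ (h.mem_parent i j hj fun hji => hne (congrArg _ hji))
  mem_of_adj i j hadj hlt := by
    induction j using Fin.lastCases with
    | last => exact (hlt.not_ge (Fin.le_last i)).elim
    | cast j =>
      induction i using Fin.lastCases with
      | last =>
        obtain ⟨i, rfl⟩ := hA (snocVertex_adj_last.mp hadj)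
        simp
      | cast i =>
        rw [Fin.snoc_castSucc]
        exact Set.mem_image_of_mem _
          (h.mem_of_adj i j (snocVertex_adj_castSucc.mp hadj) (by simpa using hlt))
  card_le i := by
    induction i using Fin.lastCases with
    | last =>
      rw [Fin.snoc_last]
      refine (Set.ncard_insert_le _ _).trans (Nat.succ_le_succ ?_)
      rw [← Set.image_univ]
      refine (Set.ncard_image_le (Set.toFinite _)).trans ?_
      simp
    | cast i =>
      rw [Fin.snoc_castSucc]
      exact (Set.ncard_image_le (Set.toFinite _)).trans (h.card_le i)

theorem sum_snoc {n : ℕ} {V : Type} [Fintype V] (f : (Fin (n + 1) → V) → ℤ) :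
    ∑ h, f h = ∑ h : Fin n → V, ∑ u, f (Fin.snoc h u) := by
  rw [← Equiv.sum_comp (Fin.snocEquiv fun _ => V), Fintype.sum_prod_type, Finset.sum_comm]
  rfl

open Classical in
/-- Sums of products of terms placed inside bags count homomorphisms from graphs of bounded tree
width. -/
theorem IsBuild.exists_card_hom_eq (n : ℕ) {F : SimpleGraph (Fin (m + 1))}
    {β : Fin (m + 1) → Set (Fin (m + 1))} {p : Fin (m + 1) → Fin (m + 1)} (hF : IsBuild k F β p)
    (L : List (Term k × (Fin k → Fin (m + 1)))) (hn : (L.map fun q => q.1.size).sum ≤ n)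
    (hL : ∀ q ∈ L, ∃ t, ∀ i, q.2 i ∈ β t) :
    ∃ (m' : ℕ) (F' : SimpleGraph (Fin m')), TreewidthAtMost F' k ∧
      ∀ (V : Type) [Fintype V] (G : SimpleGraph V),
        (∑ h : Fin (m + 1) → V, if ∀ a b, F.Adj a b → G.Adj (h a) (h b) then
          (L.map fun q => q.1.eval G (h ∘ q.2)).prod else 0) = Nat.card (F' →g G) := by
  induction n generalizing m with
  | zero =>
    cases L with
    | nil => exact ⟨m + 1, F, hF.treewidthAtMost, fun V _ G => by
      simp only [List.map_nil, List.prod_nil, card_hom_eq_sum]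
      congr!⟩
    | cons q L =>
      have := q.1.size_pos
      simp at hn
      omega
  | succ n ih =>
    rcases L with _ | ⟨⟨τ, e⟩, L⟩
    · exact ⟨m + 1, F, hF.treewidthAtMost, fun V _ G => by
      simp only [List.map_nil, List.prod_nil, card_hom_eq_sum]
      congr!⟩
    obtain ⟨⟨t, ht⟩, hL'⟩ := List.forall_mem_cons.mp hL
    rw [List.map_cons, List.sum_cons] at hn
    cases τ with
    | one =>
      simp only [Term.size] at hn
      obtain ⟨m', F', hF', h⟩ := ih hF L (by omega) hL'
      exact ⟨m', F', hF', fun V _ G => by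
        rw [← h V G]; simp only [List.map_cons, List.prod_cons, Term.eval, one_mul]⟩
    | mul a b =>
      simp only [Term.size] at hn
      obtain ⟨m', F', hF', h⟩ := ih hF ((a, e) :: (b, e) :: L) (by simp; omega)
        (List.forall_mem_cons.mpr ⟨⟨t, ht⟩, List.forall_mem_cons.mpr ⟨⟨t, ht⟩, hL'⟩⟩)
      exact ⟨m', F', hF', fun V _ G => by
        rw [← h V G]; simp only [List.map_cons, List.prod_cons, Term.eval, mul_assoc]⟩
    | reindex ρ a =>
      simp only [Term.size] at hn
      obtain ⟨m', F', hF', h⟩ := ih hF ((a, e ∘ ρ) :: L) (by simp; omega)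
        (List.forall_mem_cons.mpr ⟨⟨t, fun i => ht (ρ i)⟩, hL'⟩)
      exact ⟨m', F', hF', fun V _ G => by
        rw [← h V G]; simp only [List.map_cons, List.prod_cons, Term.eval, Function.comp_assoc]⟩
    | sum N τ =>
      simp only [Term.size] at hn
      obtain ⟨m', F', hF', h⟩ := ih (hF.snocVertex ht (Set.image_subset_range e N))
        ((List.ofFn fun j => (τ j, Function.update (Fin.castSucc ∘ e) j (Fin.last (m + 1)))) ++
          L.map fun q => (q.1, Fin.castSucc ∘ q.2))
        (by
          simp only [List.map_append, List.map_ofFn, List.sum_append, List.sum_ofFn, List.map_map,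
            Function.comp_def]
          omega)
        (by
          intro q hq
          rcases List.mem_append.mp hq with hq | hq
          · obtain ⟨j, rfl⟩ := List.mem_ofFn.mp hq
            refine ⟨Fin.last (m + 1), fun i => ?_⟩
            rw [Fin.snoc_last]
            rcases eq_or_ne i j with rfl | hne
            · simp
            · simp [hne]
          · obtain ⟨q', hq', rfl⟩ := List.mem_map.mp hq
            obtain ⟨s, hs⟩ := hL' q' hq'
            refine ⟨s.castSucc, fun i => ?_⟩
            rw [Fin.snoc_castSucc]
            exact Set.mem_image_of_mem _ (hs i))
      refine ⟨m', F', hF', fun V _ G => ?_⟩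
      rw [← h V G]
      refine Eq.trans (Finset.sum_congr rfl fun g _ => ?_) (sum_snoc _).symm
      have hcomp : ∀ (u : V) (q : Fin k → Fin (m + 1)),
          (Fin.snoc g u : Fin (m + 2) → V) ∘ Fin.castSucc ∘ q = g ∘ q := by
        intro u q
        funext i
        simp
      have hupd : ∀ (u : V) (j : Fin k), (Fin.snoc g u : Fin (m + 2) → V) ∘
          Function.update (Fin.castSucc ∘ e) j (Fin.last (m + 1)) =
            Function.update (g ∘ e) j u := by
        intro u j
        rw [Function.comp_update, hcomp, Fin.snoc_last]
      have hrest : ∀ u : V, (L.map fun q => (q.1, Fin.castSucc ∘ q.2)).map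
          (fun q => q.1.eval G ((Fin.snoc g u : Fin (m + 2) → V) ∘ q.2)) =
            L.map fun q => q.1.eval G (g ∘ q.2) := fun u => by
        rw [List.map_map]
        exact List.map_congr_left fun q _ => congrArg (q.1.eval G) (hcomp u q.2)
      have hnew : ∀ u : V, ((List.ofFn fun j =>
          (τ j, Function.update (Fin.castSucc ∘ e) j (Fin.last (m + 1)))).map
            (fun q => q.1.eval G ((Fin.snoc g u : Fin (m + 2) → V) ∘ q.2))).prod =
              ∏ j, (τ j).eval G (Function.update (g ∘ e) j u) := fun u => by
        rw [List.map_ofFn, List.prod_ofFn]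
        exact Finset.prod_congr rfl fun j _ => congrArg ((τ j).eval G) (hupd u j)
      simp only [forall_snocVertex_adj, Set.forall_mem_image, List.map_append, hrest, hnew,
        List.prod_append, List.map_cons, List.prod_cons, Term.eval]
      by_cases hg : ∀ a b, F.Adj a b → G.Adj (g a) (g b)
      · simp only [if_pos hg, and_iff_right hg, Finset.sum_mul, ite_mul, zero_mul,
          Function.comp_apply]
      · simp [hg]

theorem Term.sum_eval_const_eq [NeZero k] {V W : Type} [Fintype V] [Fintype W] {G : SimpleGraph V}
    {H : SimpleGraph W} (h : ∀ (m : ℕ) (F : SimpleGraph (Fin m)), TreewidthAtMost F k →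
      Nat.card (F →g G) = Nat.card (F →g H)) (τ : Term k) :
    ∑ u, τ.eval G (fun _ => u) = ∑ u, τ.eval H (fun _ => u) := by
  have : Subsingleton (Fin (0 + 1)) := inferInstanceAs (Subsingleton (Fin 1))
  have hF : IsBuild (m := 0) k ⊥ (fun _ => Set.univ) id :=
    { self_mem := fun i => Set.mem_univ i
      le_of_mem := fun i j _ => (Subsingleton.elim j i).le
      parent_lt := fun i hi => (hi (Subsingleton.elim i 0)).elim
      mem_parent := fun _ _ _ _ => Set.mem_univ _
      mem_of_adj := fun _ _ _ _ => Set.mem_univ _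
      card_le := fun i => by simp [Set.ncard_univ] }
  obtain ⟨m', F', hF', hcard⟩ := hF.exists_card_hom_eq _ [(τ, fun _ => 0)] le_rfl (by simp)
  have key : ∀ (U : Type) [Fintype U] (K : SimpleGraph U),
      ∑ u, τ.eval K (fun _ => u) = Nat.card (F' →g K) := by
    intro U _ K
    rw [← hcard U K, ← Equiv.sum_comp (Equiv.funUnique (Fin 1) U)]
    simp [Function.comp_def]
  rw [key, key, h m' F' hF']

end Realization

end WLHom

/-- **Dvořák.** For `k ≥ 1`, two finite graphs `G` and `H` are
`k`-indistinguishable if and only if `hom(F, G) = hom(F, H)` for every finite graph `F` of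
tree width at most `k`. -/
theorem wl_indistinguishable_iff_homomorphism_counts
    (k : ℕ) (hk : 1 ≤ k) (V W : Type) [Fintype V] [Fintype W]
    (G : SimpleGraph V) (H : SimpleGraph W) :
    WLIndistinguishable k G H ↔
      ∀ (m : ℕ) (F : SimpleGraph (Fin m)), TreewidthAtMost F k →
        Nat.card (F →g G) = Nat.card (F →g H) := by
  have : NeZero k := ⟨by omega⟩
  constructor
  · exact fun h m F hF =>
      WLHom.card_hom_eq_of_exists_equiv_const (WLHom.exists_equiv_const_of_indistinguishable h) hF
  · intro h
    obtain ⟨σ, hσ⟩ := WLHom.Term.exists_equiv_const (WLHom.Term.sum_eval_const_eq h)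
    exact WLHom.indistinguishable_of_exists_equiv_const fun r => ⟨σ, hσ r⟩
end

section
/- Let G and H be finite graphs with adjacency matrices A and B respectively. Then G and H are not distinguished by the Color Refinement algorithm (1-WL) if and only if G and H are fractionally isomorphic, that is, there exists a doubly stochastic real matrix X, with rows indexed by V(G) and columns indexed by V(H), such that AX = XB. -/
/-- The space of colors produced by round `i` of the Color Refinement algorithm. -/
def CRColor : ℕ → Type
  | 0 => Unit
  | i + 1 => CRColor i × Multiset (CRColor i)

/-- The vertex coloring computed by the Color Refinement algorithm after `i` rounds:
the initial coloring is uniform, and in each round the color of a vertex is refined by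
the multiset of the previous colors of its neighbors. -/
noncomputable def crColoring {V : Type*} [Fintype V] (G : SimpleGraph V) :
    (i : ℕ) → V → CRColor i
  | 0, _ => ()
  | i + 1, v =>
    (crColoring G i v, ((G.neighborSet v).toFinite.toFinset.val.map (crColoring G i)))

/-- Two finite graphs are not distinguished by the Color Refinement algorithm: in every
refinement round, every color is attained by the same number of vertices in both graphs
(in particular this holds for the stable colorings). -/
def CRIndistinguishable {V W : Type*} [Fintype V] [Fintype W]
    (G : SimpleGraph V) (H : SimpleGraph W) : Prop :=
  ∀ (i : ℕ) (c : CRColor i),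
    Nat.card {v : V // crColoring G i v = c} = Nat.card {w : W // crColoring H i w = c}

open Classical in
/-- The number of neighbors of `v` that have color `c` under the coloring `f`. -/
noncomputable def colorDegree {V κ : Type*} [Fintype V] (G : SimpleGraph V) (f : V → κ)
    (v : V) (c : κ) : ℕ :=
  ((G.neighborSet v).toFinite.toFinset.val.map f).count c

open Classical in
theorem colorDegree_eq_sum {V κ : Type*} [Fintype V] (G : SimpleGraph V) [DecidableRel G.Adj]
    (f : V → κ) (v : V) (c : κ) :
    (colorDegree G f v c : ℝ) = ∑ u, G.adjMatrix ℝ v u * if f u = c then 1 else 0 := by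
  have h : colorDegree G f v c = (Finset.univ.filter fun u => G.Adj v u ∧ f u = c).card := by
    rw [colorDegree, Multiset.count_map, ← Finset.filter_val, Finset.card_val]
    congr 1
    ext u
    simp [eq_comm]
  rw [h, Finset.card_filter]
  push_cast
  refine Finset.sum_congr rfl fun u _ => ?_
  by_cases h₁ : G.Adj v u <;> by_cases h₂ : f u = c <;> simp [SimpleGraph.adjMatrix_apply, h₁, h₂]

theorem crColoring_succ_eq_iff {V W : Type*} [Fintype V] [Fintype W] (G : SimpleGraph V)
    (H : SimpleGraph W) (i : ℕ) (v : V) (w : W) :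
    crColoring G (i + 1) v = crColoring H (i + 1) w ↔
      crColoring G i v = crColoring H i w ∧
        ∀ c, colorDegree G (crColoring G i) v c = colorDegree H (crColoring H i) w c := by
  classical
  simp only [crColoring, colorDegree]
  refine Prod.mk_inj.trans (and_congr_right fun _ => ?_)
  exact Multiset.ext

/-- If `a = X b` and `b = Xᵀ a` for a doubly stochastic matrix `X`, then `a` and `b` agree on the
support of `X`. -/
theorem eq_of_doublyStochastic {V W : Type*} [Fintype V] [Fintype W] {X : Matrix V W ℝ}
    (hX : ∀ v w, 0 ≤ X v w) (hrow : ∀ v, ∑ w, X v w = 1) (hcol : ∀ w, ∑ v, X v w = 1)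
    {a : V → ℝ} {b : W → ℝ} (ha : ∀ v, a v = ∑ w, X v w * b w)
    (hb : ∀ w, b w = ∑ v, X v w * a v) {v : V} {w : W} (hvw : X v w ≠ 0) : a v = b w := by
  have haa : ∑ v, ∑ w, X v w * a v ^ 2 = ∑ v, a v ^ 2 := by
    simp [← Finset.sum_mul, hrow]
  have hbb : ∑ v, ∑ w, X v w * b w ^ 2 = ∑ w, b w ^ 2 := by
    rw [Finset.sum_comm]
    simp [← Finset.sum_mul, hcol]
  have hab : ∑ v, ∑ w, X v w * (a v * b w) = ∑ v, a v ^ 2 := by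
    refine Finset.sum_congr rfl fun v _ => ?_
    rw [sq]
    nth_rw 3 [ha v]
    rw [Finset.mul_sum]
    exact Finset.sum_congr rfl fun w _ => by ring
  have hba : ∑ v, ∑ w, X v w * (a v * b w) = ∑ w, b w ^ 2 := by
    rw [Finset.sum_comm]
    refine Finset.sum_congr rfl fun w _ => ?_
    rw [sq]
    nth_rw 3 [hb w]
    rw [Finset.mul_sum]
    exact Finset.sum_congr rfl fun v _ => by ring
  have hsum : ∑ v, ∑ w, X v w * (a v - b w) ^ 2 = 0 := by
    have : ∑ v, ∑ w, X v w * (a v - b w) ^ 2 = ∑ v, ∑ w, X v w * a v ^ 2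
        + ∑ v, ∑ w, X v w * b w ^ 2 - 2 * ∑ v, ∑ w, X v w * (a v * b w) := by
      simp only [Finset.mul_sum, ← Finset.sum_add_distrib, ← Finset.sum_sub_distrib]
      exact Finset.sum_congr rfl fun v _ => Finset.sum_congr rfl fun w _ => by ring
    rw [this]
    linarith
  have hnn : ∀ v w, 0 ≤ X v w * (a v - b w) ^ 2 := fun v w => mul_nonneg (hX v w) (sq_nonneg _)
  have h₁ := (Finset.sum_eq_zero_iff_of_nonneg fun v _ =>
    Finset.sum_nonneg fun w _ => hnn v w).1 hsum v (Finset.mem_univ v)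
  have h₂ := (Finset.sum_eq_zero_iff_of_nonneg fun w _ => hnn v w).1 h₁ w (Finset.mem_univ w)
  have h₃ := (mul_eq_zero.1 h₂).resolve_left hvw
  exact sub_eq_zero.1 (pow_eq_zero_iff two_ne_zero |>.1 h₃)

section SupportedOnColors

variable {V W κ : Type*} [DecidableEq κ] {X : Matrix V W ℝ} {f : V → κ} {g : W → κ}

theorem mul_indicator_comm (hfg : ∀ v w, X v w ≠ 0 → f v = g w) (c : κ) (v : V) (w : W) :
    X v w * (if g w = c then 1 else 0) = X v w * if f v = c then 1 else 0 := by
  by_cases h : X v w = 0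
  · simp [h]
  · rw [hfg v w h]

theorem sum_mul_indicator_right [Fintype W] (hfg : ∀ v w, X v w ≠ 0 → f v = g w)
    (hrow : ∀ v, ∑ w, X v w = 1) (c : κ) (v : V) :
    ∑ w, X v w * (if g w = c then 1 else 0) = if f v = c then 1 else 0 := by
  simp_rw [mul_indicator_comm hfg c, ← Finset.sum_mul, hrow, one_mul]

theorem sum_mul_indicator_left [Fintype V] (hfg : ∀ v w, X v w ≠ 0 → f v = g w)
    (hcol : ∀ w, ∑ v, X v w = 1) (c : κ) (w : W) :
    ∑ v, X v w * (if f v = c then 1 else 0) = if g w = c then 1 else 0 := by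
  simp_rw [← mul_indicator_comm hfg c, ← Finset.sum_mul, hcol, one_mul]

end SupportedOnColors

theorem colorDegree_eq_of_fractionallyIsomorphic {V W κ : Type*} [Fintype V] [Fintype W]
    {G : SimpleGraph V} {H : SimpleGraph W} [DecidableRel G.Adj] [DecidableRel H.Adj]
    {X : Matrix V W ℝ} (hX : ∀ v w, 0 ≤ X v w) (hrow : ∀ v, ∑ w, X v w = 1)
    (hcol : ∀ w, ∑ v, X v w = 1) (hAX : G.adjMatrix ℝ * X = X * H.adjMatrix ℝ)
    {f : V → κ} {g : W → κ} (hfg : ∀ v w, X v w ≠ 0 → f v = g w) {v : V} {w : W}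
    (hvw : X v w ≠ 0) (c : κ) : colorDegree G f v c = colorDegree H g w c := by
  classical
  have hentry : ∀ v w, ∑ u, G.adjMatrix ℝ v u * X u w = ∑ u, X v u * H.adjMatrix ℝ u w :=
    fun v w => by simpa only [Matrix.mul_apply] using congrFun (congrFun hAX v) w
  refine Nat.cast_injective (R := ℝ) <| eq_of_doublyStochastic hX hrow hcol
    (a := fun v => (colorDegree G f v c : ℝ)) (b := fun w => (colorDegree H g w c : ℝ))
    (fun v => ?_) (fun w => ?_) hvw
  · simp_rw [colorDegree_eq_sum, ← sum_mul_indicator_right hfg hrow c, Finset.mul_sum,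
      ← mul_assoc]
    conv_lhs => rw [Finset.sum_comm]
    conv_rhs => rw [Finset.sum_comm]
    refine Finset.sum_congr rfl fun w _ => ?_
    rw [← Finset.sum_mul, ← Finset.sum_mul, hentry]
  · have hsymm : ∀ v u, G.adjMatrix ℝ v u = G.adjMatrix ℝ u v := fun v u => by
      simp [SimpleGraph.adjMatrix_apply, G.adj_comm]
    have hsymm' : ∀ v u, H.adjMatrix ℝ v u = H.adjMatrix ℝ u v := fun v u => by
      simp [SimpleGraph.adjMatrix_apply, H.adj_comm]
    simp_rw [colorDegree_eq_sum, ← sum_mul_indicator_left hfg hcol c, Finset.mul_sum,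
      ← mul_assoc]
    conv_lhs => rw [Finset.sum_comm]
    conv_rhs => rw [Finset.sum_comm]
    refine Finset.sum_congr rfl fun v _ => ?_
    rw [← Finset.sum_mul, ← Finset.sum_mul]
    refine congrArg (· * _) ?_
    simpa only [mul_comm, hsymm' w, hsymm v] using (hentry v w).symm

theorem crIndistinguishable_of_fractionallyIsomorphic {V W : Type*} [Fintype V] [Fintype W]
    {G : SimpleGraph V} {H : SimpleGraph W} [DecidableRel G.Adj] [DecidableRel H.Adj]
    {X : Matrix V W ℝ} (hX : ∀ v w, 0 ≤ X v w) (hrow : ∀ v, ∑ w, X v w = 1)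
    (hcol : ∀ w, ∑ v, X v w = 1) (hAX : G.adjMatrix ℝ * X = X * H.adjMatrix ℝ) :
    CRIndistinguishable G H := by
  classical
  have hcolor : ∀ i v w, X v w ≠ 0 → crColoring G i v = crColoring H i w := by
    intro i
    induction i with
    | zero => intro v w _; rfl
    | succ i ih =>
      exact fun v w h => (crColoring_succ_eq_iff G H i v w).2 ⟨ih v w h,
        colorDegree_eq_of_fractionallyIsomorphic hX hrow hcol hAX ih h⟩
  intro i c
  simp only [Nat.card_eq_fintype_card, Fintype.card_subtype, Finset.card_filter]
  refine Nat.cast_injective (R := ℝ) ?_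
  push_cast
  simp_rw [← sum_mul_indicator_right (hcolor i) hrow c]
  rw [Finset.sum_comm]
  simp_rw [← Finset.sum_mul, hcol, one_mul]

theorem exists_crColoring_stable {V W : Type*} [Fintype V] [Fintype W] (G : SimpleGraph V)
    (H : SimpleGraph W) : ∃ i, ∀ v w, crColoring G i v = crColoring H i w →
      crColoring G (i + 1) v = crColoring H (i + 1) w := by
  let S : ℕ → Set (V × W) := fun i => {p | crColoring G i p.1 = crColoring H i p.2}
  have hS : Antitone S := antitone_nat_of_succ_le fun i p hp =>
    ((crColoring_succ_eq_iff G H i p.1 p.2).1 hp).1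
  obtain ⟨i, hi⟩ := WellFoundedGT.monotone_chain_condition
    (⟨fun i => OrderDual.toDual (S i), hS⟩ : ℕ →o (Set (V × W))ᵒᵈ)
  refine ⟨i, fun v w h => ?_⟩
  have hmem : (v, w) ∈ S i := h
  have heq : S i = S (i + 1) := hi (i + 1) i.le_succ
  rw [heq] at hmem
  exact hmem

/-- Colorings with equal class sizes that are equitable across `G` and `H` yield a fractional
isomorphism, given by averaging over the color classes. -/
theorem exists_fractionalIsomorphism_of_equitable {V W κ : Type*} [Fintype V] [Fintype W]
    {G : SimpleGraph V} {H : SimpleGraph W} [DecidableRel G.Adj] [DecidableRel H.Adj]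
    {f : V → κ} {g : W → κ}
    (hcard : ∀ c, Nat.card {v // f v = c} = Nat.card {w // g w = c})
    (hdeg : ∀ v w, f v = g w → ∀ c, colorDegree G f v c = colorDegree H g w c) :
    ∃ X : Matrix V W ℝ, (∀ v w, 0 ≤ X v w) ∧ (∀ v, ∑ w, X v w = 1) ∧
      (∀ w, ∑ v, X v w = 1) ∧ G.adjMatrix ℝ * X = X * H.adjMatrix ℝ := by
  classical
  let n : κ → ℝ := fun c => Nat.card {w // g w = c}
  have hnH : ∀ c, n c = ∑ w, if g w = c then 1 else 0 := fun c => by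
    simp [n, Nat.card_eq_fintype_card, Fintype.card_subtype]
  have hnG : ∀ c, n c = ∑ v, if f v = c then 1 else 0 := fun c => by
    simp only [n, ← hcard]
    simp [Nat.card_eq_fintype_card, Fintype.card_subtype]
  have hn_right : ∀ w, n (g w) ≠ 0 := fun w => by
    have : Nonempty {u // g u = g w} := ⟨⟨w, rfl⟩⟩
    exact Nat.cast_ne_zero.2 Nat.card_pos.ne'
  have hn_left : ∀ v, n (f v) ≠ 0 := fun v => by
    have : Nonempty {u // f u = f v} := ⟨⟨v, rfl⟩⟩
    simp only [n, ← hcard]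
    exact Nat.cast_ne_zero.2 Nat.card_pos.ne'
  have hdegH : ∀ w w', g w = g w' → ∀ c, colorDegree H g w c = colorDegree H g w' c := by
    intro w w' h c
    have hpos : 0 < Nat.card {v // f v = g w} := by
      have : Nonempty {u // g u = g w} := ⟨⟨w, rfl⟩⟩
      rw [hcard]
      exact Nat.card_pos
    obtain ⟨⟨v, hv⟩⟩ := (Nat.card_pos_iff.1 hpos).1
    rw [← hdeg v w hv, hdeg v w' (hv.trans h)]
  have hedges : ∀ v w, n (f v) * colorDegree G f v (g w) = n (g w) * colorDegree H g w (f v) := by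
    intro v w
    have hleft : n (f v) * colorDegree G f v (g w) =
        ∑ u, (if g u = f v then 1 else 0) * (colorDegree H g u (g w) : ℝ) := by
      rw [hnH, Finset.sum_mul]
      refine Finset.sum_congr rfl fun u _ => ?_
      split_ifs with h
      · rw [hdeg v u h.symm]
      · simp
    have hright : n (g w) * colorDegree H g w (f v) =
        ∑ u, (if g u = g w then 1 else 0) * (colorDegree H g u (f v) : ℝ) := by
      rw [hnH, Finset.sum_mul]
      refine Finset.sum_congr rfl fun u _ => ?_
      split_ifs with h
      · rw [hdegH u w h]
      · simp
    rw [hleft, hright]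
    simp_rw [colorDegree_eq_sum, Finset.mul_sum]
    rw [Finset.sum_comm]
    refine Finset.sum_congr rfl fun u _ => Finset.sum_congr rfl fun u' _ => ?_
    simp only [SimpleGraph.adjMatrix_apply, H.adj_comm u u']
    ring
  refine ⟨Matrix.of fun v w => (n (g w))⁻¹ * if f v = g w then 1 else 0, fun v w => ?_, fun v => ?_,
    fun w => ?_, ?_⟩
  · exact mul_nonneg (inv_nonneg.2 (Nat.cast_nonneg _)) (by split_ifs <;> simp)
  · calc ∑ w, (n (g w))⁻¹ * (if f v = g w then (1 : ℝ) else 0)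
        = ∑ w, (n (f v))⁻¹ * (if g w = f v then (1 : ℝ) else 0) := by
          refine Finset.sum_congr rfl fun w _ => ?_
          by_cases h : f v = g w
          · simp [h]
          · simp [h, Ne.symm h]
      _ = 1 := by rw [← Finset.mul_sum, ← hnH, inv_mul_cancel₀ (hn_left v)]
  · simp only [Matrix.of_apply]
    rw [← Finset.mul_sum, ← hnG, inv_mul_cancel₀ (hn_right w)]
  · ext v w
    rw [Matrix.mul_apply, Matrix.mul_apply]
    simp only [Matrix.of_apply]
    calc ∑ u, G.adjMatrix ℝ v u * ((n (g w))⁻¹ * if f u = g w then 1 else 0)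
        = (n (g w))⁻¹ * colorDegree G f v (g w) := by
          rw [colorDegree_eq_sum, Finset.mul_sum]
          exact Finset.sum_congr rfl fun u _ => by ring
      _ = (n (f v))⁻¹ * colorDegree H g w (f v) := by
          have h₁ := hn_left v
          have h₂ := hn_right w
          field_simp
          linarith [hedges v w]
      _ = ∑ u, (n (g u))⁻¹ * (if f v = g u then 1 else 0) * H.adjMatrix ℝ u w := by
          rw [colorDegree_eq_sum, Finset.mul_sum]
          refine Finset.sum_congr rfl fun u _ => ?_
          by_cases h : f v = g u
          · simp [h, SimpleGraph.adjMatrix_apply, H.adj_comm]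
          · simp [h, Ne.symm h]

/-- **Tinhofer.** Two finite graphs `G`, `H` with adjacency matrices `A`, `B`
are not distinguished by Color Refinement if and only if they are fractionally isomorphic,
i.e., there is a doubly stochastic matrix `X` with `A * X = X * B`. -/
theorem cr_indistinguishable_iff_fractionally_isomorphic
    (V W : Type) [Fintype V] [Fintype W]
    (G : SimpleGraph V) (H : SimpleGraph W)
    [DecidableRel G.Adj] [DecidableRel H.Adj] :
    CRIndistinguishable G H ↔
      ∃ X : Matrix V W ℝ,
        (∀ v w, 0 ≤ X v w) ∧
        (∀ v, ∑ w, X v w = 1) ∧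
        (∀ w, ∑ v, X v w = 1) ∧
        SimpleGraph.adjMatrix ℝ G * X = X * SimpleGraph.adjMatrix ℝ H := by
  constructor
  · intro h
    obtain ⟨i, hi⟩ := exists_crColoring_stable G H
    exact exists_fractionalIsomorphism_of_equitable (h i) fun v w hvw =>
      ((crColoring_succ_eq_iff G H i v w).1 (hi v w hvw)).2
  · rintro ⟨X, hX, hrow, hcol, hAX⟩
    exact crIndistinguishable_of_fractionallyIsomorphic hX hrow hcol hAX
end

section
/- Let (G, χ_V, χ_E) be a 3-connected vertex- and arc-colored finite graph that excludes the complete bipartite graph K_{3,h} as a minor, and let v₁, v₂, v₃ ∈ V(G) be distinct vertices. Then the (h−1)-closure of {v₁, v₂, v₃} with respect to G is all of V(G), i.e., cl_{h−1}^G(v₁, v₂, v₃) = V(G). -/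
/-- An equivalence relation `r` on the vertices of a vertex- and arc-colored graph is stable
with respect to the Color Refinement algorithm: equivalent vertices have, for every class
(represented by `u₀`) and every pair of arc colors `(a, b)`, equally many neighbors in that
class joined by arcs of colors `a` (outgoing) and `b` (incoming). -/
def ArcCRStable {V C₂ : Type*} (G : SimpleGraph V) (χE : V → V → C₂)
    (r : V → V → Prop) : Prop :=
  ∀ v w, r v w → ∀ (u₀ : V) (a b : C₂),
    {u | G.Adj v u ∧ r u u₀ ∧ χE v u = a ∧ χE u v = b}.ncard =
      {u | G.Adj w u ∧ r u u₀ ∧ χE w u = a ∧ χE u w = b}.ncard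

/-- All classes of `r` of size at most `t` are singletons. -/
def TDiscrete {V : Type*} (t : ℕ) (r : V → V → Prop) : Prop :=
  ∀ v, {w | r v w}.ncard ≤ t → ∀ w, r v w → w = v

/-- The partition corresponding to the initial coloring for computing the `t`-closure of
`X`: it refines the vertex coloring `χV` and additionally gives every vertex of `X` its own
singleton color. -/
def InitPartition {V C₁ : Type*} (χV : V → C₁) (X : Set V) (v w : V) : Prop :=
  χV v = χV w ∧ (v ∈ X → v = w) ∧ (w ∈ X → v = w)

/-- `r` is (the partition of) the `t`-CR-stable coloring of the vertex- and arc-colored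
graph `(G, χV, χE)` obtained from the initial coloring that refines `χV` by individualizing
all vertices of `X`: it is the coarsest equivalence relation refining the initial one that is
stable under Color Refinement and all of whose classes of size at most `t` are singletons.
(This characterizes the result of the iterated refine-and-split process.) -/
def IsTCRStablePartition {V C₁ C₂ : Type*} (G : SimpleGraph V) (χV : V → C₁)
    (χE : V → V → C₂) (t : ℕ) (X : Set V) (r : V → V → Prop) : Prop :=
  Equivalence r ∧ ArcCRStable G χE r ∧ TDiscrete t r ∧
    (∀ v w, r v w → InitPartition χV X v w) ∧
    ∀ s : V → V → Prop, Equivalence s → ArcCRStable G χE s → TDiscrete t s →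
      (∀ v w, s v w → InitPartition χV X v w) → ∀ v w, s v w → r v w

/-- The `t`-closure `cl_t^G(X)` of a set `X` of vertices of the vertex- and arc-colored graph
`(G, χV, χE)`: the set of vertices whose class in the `t`-CR-stable coloring (computed after
individualizing all vertices of `X`) is a singleton. -/
def tClosure {V C₁ C₂ : Type*} (G : SimpleGraph V) (χV : V → C₁) (χE : V → V → C₂)
    (t : ℕ) (X : Set V) : Set V :=
  {v | ∃ r, IsTCRStablePartition G χV χE t X r ∧ ∀ w, r v w → w = v}


/-- `G` is 3-connected: deleting any set of at most two vertices leaves a connected graph. -/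
def ThreeConnected {V : Type*} (G : SimpleGraph V) : Prop :=
  ∀ X : Set V, X.ncard ≤ 2 → (G.induce Xᶜ).Connected

/-- `H` is a minor of `G`: there is a family of nonempty, pairwise disjoint, connected
branch sets in `G`, one for each vertex of `H`, such that for every edge of `H` there is an
edge of `G` between the corresponding branch sets. -/
def HasMinor {V W : Type*} (G : SimpleGraph V) (H : SimpleGraph W) : Prop :=
  ∃ B : W → Set V,
    (∀ w, (B w).Nonempty) ∧
    (∀ w, (G.induce (B w)).Connected) ∧
    (Pairwise fun w w' => Disjoint (B w) (B w')) ∧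
    (∀ w w', H.Adj w w' → ∃ v ∈ B w, ∃ v' ∈ B w', G.Adj v v')

namespace SimpleGraph

variable {α : Type*} {Q : SimpleGraph α}

lemma induce_singleton_connected (a : α) : (Q.induce {a}).Connected :=
  ⟨Preconnected.of_subsingleton⟩

lemma Connected.exists_adj_of_induce {S A : Set α} (hS : (Q.induce S).Connected)
    {a b : α} (ha : a ∈ A) (haS : a ∈ S) (hb : b ∉ A) (hbS : b ∈ S) :
    ∃ x ∈ S, x ∈ A ∧ ∃ y ∈ S, y ∉ A ∧ Q.Adj x y := by
  obtain ⟨p⟩ := hS.preconnected ⟨a, haS⟩ ⟨b, hbS⟩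
  obtain ⟨d, -, hd, hd'⟩ := p.exists_boundary_dart (Subtype.val ⁻¹' A) ha hb
  exact ⟨d.fst, d.fst.2, hd, d.snd, d.snd.2, hd', d.adj⟩

/-- A finite connected induced subgraph with at least two vertices has a non-cut vertex. -/
lemma Connected.exists_connected_induce_diff_singleton [Finite α] {K : Set α}
    (hK : (Q.induce K).Connected) (hK' : K.Nontrivial) :
    ∃ y ∈ K, (Q.induce (K \ {y})).Connected := by
  have : Nontrivial K := hK'.coe_sort
  obtain ⟨⟨y, hy⟩, hc⟩ := hK.exists_connected_induce_compl_singleton_of_finite_nontrivial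
  refine ⟨y, hy, ?_⟩
  let f : (Q.induce K).induce {(⟨y, hy⟩ : K)}ᶜ →g Q.induce (K \ {y}) :=
    { toFun := fun z => ⟨z.1.1, z.1.2, fun h => z.2 (Subtype.ext h)⟩
      map_rel' := fun h => h }
  refine hc.map f fun z => ⟨⟨⟨z.1, z.2.1⟩, fun h => z.2.2 (congrArg Subtype.val h)⟩, rfl⟩

/-- A connected set `K` adjacent to three disjoint connected sets contains a vertex `x` from which
the three sets are reached disjointly: they can be enlarged within the graph, avoiding `x`, such
that `x` is adjacent to each of them. -/
lemma exists_disjoint_connected_adj [Finite α] (K : Set α) (A : Fin 3 → Set α)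
    (hK : (Q.induce K).Connected) (hA : ∀ i, (Q.induce (A i)).Connected)
    (hd : Pairwise fun i j => Disjoint (A i) (A j)) (hKA : ∀ i, Disjoint K (A i))
    (hadj : ∀ i, ∃ k ∈ K, ∃ a ∈ A i, Q.Adj k a) :
    ∃ x ∈ K, ∃ B : Fin 3 → Set α, (∀ i, A i ⊆ B i) ∧ (∀ i, (Q.induce (B i)).Connected) ∧
      (Pairwise fun i j => Disjoint (B i) (B j)) ∧ (∀ i, x ∉ B i) ∧
      ∀ i, ∃ b ∈ B i, Q.Adj x b := by
  classical
  induction hn : K.ncard using Nat.strong_induction_on generalizing K A with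
  | _ n ih =>
  obtain ⟨⟨x₀, hx₀⟩⟩ := hK.nonempty
  by_cases hKn : K.Nontrivial
  swap
  · rw [Set.not_nontrivial_iff] at hKn
    refine ⟨x₀, hx₀, A, fun _ => subset_rfl, hA, hd,
      fun i => Set.disjoint_left.1 (hKA i) hx₀, fun i => ?_⟩
    obtain ⟨k, hk, a, ha, h⟩ := hadj i
    exact ⟨a, ha, hKn hk hx₀ ▸ h⟩
  obtain ⟨y, hy, hKy⟩ := hK.exists_connected_induce_diff_singleton hKn
  have hcard : (K \ {y}).ncard < n := by
    rw [← hn]; exact Set.ncard_sdiff_singleton_lt_of_mem hy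
  obtain ⟨y', hy'⟩ := hKy.nonempty
  obtain ⟨y₁, -, hy₁, z, hz, hzy, hyz⟩ := hK.exists_adj_of_induce (A := {y})
    (Set.mem_singleton y) hy hy'.2 hy'.1
  rw [Set.mem_singleton_iff.1 hy₁] at hyz
  -- indices whose only neighbor in `K` is `y`
  let S : Fin 3 → Prop := fun i => ¬ ∃ k ∈ K \ {y}, ∃ a ∈ A i, Q.Adj k a
  have hS : ∀ i, S i → ∃ a ∈ A i, Q.Adj y a := fun i hi => by
    obtain ⟨k, hk, a, ha, h⟩ := hadj i
    by_cases hky : k = y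
    · exact ⟨a, ha, hky ▸ h⟩
    · exact absurd ⟨k, ⟨hk, hky⟩, a, ha, h⟩ hi
  have hyA : ∀ i, y ∉ A i := fun i => Set.disjoint_left.1 (hKA i) hy
  by_cases h0 : ∀ i, ¬ S i
  · obtain ⟨x, hx, h⟩ := ih _ hcard (K \ {y}) A hKy hA hd
      (fun i => (hKA i).mono_left Set.sdiff_subset) (fun i => not_not.1 (h0 i)) rfl
    exact ⟨x, hx.1, h⟩
  push Not at h0
  obtain ⟨i, hi⟩ := h0
  by_cases h1 : ∀ j, S j → j = i
  · obtain ⟨a, ha, hya⟩ := hS i hi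
    obtain ⟨x, hx, B, hAB, h⟩ := ih _ hcard (K \ {y})
      (Function.update A i (A i ∪ {y})) hKy
      (fun j => by
        by_cases hj : j = i
        · subst hj
          rw [Function.update_self]
          exact connected_induce_union (hA j).preconnected
            (induce_singleton_connected y).preconnected ha rfl hya.symm
        · rw [Function.update_of_ne hj]
          exact hA j)
      (fun j k hjk => by
        have := hd hjk
        by_cases hj : j = i
        · subst hj
          simp [Function.update_of_ne hjk.symm, this, hyA]
        · by_cases hk : k = i
          · subst hk
            simp [Function.update_of_ne hj, this, hyA]
          · simpa [Function.update_of_ne hj, Function.update_of_ne hk] using this)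
      (fun j => by
        have := (hKA j).mono_left (Set.sdiff_subset (t := {y}))
        by_cases hj : j = i
        · subst hj
          simp [this]
        · simpa [Function.update_of_ne hj] using this)
      (fun j => by
        by_cases hj : j = i
        · subst hj
          exact ⟨z, ⟨hz, hzy⟩, y, by simp, hyz.symm⟩
        · rw [Function.update_of_ne hj]
          exact not_not.1 fun h => hj (h1 j h)) rfl
    refine ⟨x, hx.1, B, fun j => ?_, h⟩
    refine subset_trans ?_ (hAB j)
    by_cases hj : j = i
    · subst hj
      simp
    · rw [Function.update_of_ne hj]
  · push Not at h1
    obtain ⟨j, hj, hji⟩ := h1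
    have hone : ∀ k l, ¬ S k → ¬ S l → k = l := by
      intro k l hk hl
      have : k ≠ i := fun h => hk (h ▸ hi)
      have : l ≠ i := fun h => hl (h ▸ hi)
      have : k ≠ j := fun h => hk (h ▸ hj)
      have : l ≠ j := fun h => hl (h ▸ hj)
      omega
    refine ⟨y, hy, fun k => if S k then A k else A k ∪ (K \ {y}), fun k => ?_, fun k => ?_,
      fun k l hkl => ?_, fun k => ?_, fun k => ?_⟩
    · dsimp only
      split_ifs
      exacts [subset_rfl, Set.subset_union_left]
    · dsimp only
      by_cases hk : S k
      · rw [if_pos hk]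
        exact hA k
      · rw [if_neg hk]
        obtain ⟨u, hu, a, ha, h⟩ := not_not.1 hk
        exact connected_induce_union (hA k).preconnected hKy.preconnected ha hu h.symm
    · have hKA' := fun i => (hKA i).mono_left (Set.sdiff_subset (t := {y}))
      dsimp only
      split_ifs with hk hl hl
      · exact hd hkl
      · exact Set.disjoint_union_right.2 ⟨hd hkl, (hKA' k).symm⟩
      · exact Set.disjoint_union_left.2 ⟨hd hkl, hKA' l⟩
      · exact absurd (hone k l hk hl) hkl
    · dsimp only
      split_ifs <;> simp [hyA]
    · dsimp only
      split_ifs with hk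
      · exact hS k hk
      · exact ⟨z, Or.inr ⟨hz, hzy⟩, hyz⟩

/-- The graph on the classes of `s`: distinct classes are adjacent if they are joined by an edge. -/
def classGraph {V : Type*} (G : SimpleGraph V) (s : Setoid V) : SimpleGraph (Quotient s) where
  Adj p q := p ≠ q ∧ ∃ u v : V, G.Adj u v ∧ (⟦u⟧ : Quotient s) = p ∧ (⟦v⟧ : Quotient s) = q
  symm := ⟨fun _ _ ⟨hne, u, v, h, hu, hv⟩ => ⟨hne.symm, v, u, h.symm, hv, hu⟩⟩
  loopless := ⟨fun _ h => h.1 rfl⟩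

/-- If every vertex has a neighbor in each class adjacent to its own, then a connected set of
classes containing a singleton class is the image of a connected set of vertices. -/
lemma connected_induce_preimage_mk {V : Type*} {G : SimpleGraph V} {s : Setoid V}
    (hs : ∀ (u : V) (q : Quotient s), (G.classGraph s).Adj ⟦u⟧ q → ∃ v, G.Adj u v ∧ ⟦v⟧ = q)
    {A : Set (Quotient s)} (hA : ((G.classGraph s).induce A).Connected) {n : V}
    (hn : ∀ w, s n w → w = n) (hnA : ⟦n⟧ ∈ A) :
    (G.induce {v | ⟦v⟧ ∈ A}).Connected := by
  have key : ∀ (p q : A), ((G.classGraph s).induce A).Walk p q → ∀ (v : V) (hv : ⟦v⟧ = p.1),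
      q.1 = ⟦n⟧ → (G.induce {v | ⟦v⟧ ∈ A}).Reachable ⟨n, hnA⟩
        ⟨v, show ⟦v⟧ ∈ A from hv ▸ p.2⟩ := by
    intro p q w
    induction w with
    | nil =>
      intro v hv hq
      obtain rfl := hn v (Quotient.exact (hv.trans hq).symm)
      rfl
    | @cons p p' q hadj w ih =>
      intro v hv hq
      obtain ⟨v', hvv', hv'⟩ := hs v p'.1 (hv ▸ hadj)
      refine (ih v' hv' hq).trans (Adj.reachable ?_)
      exact hvv'.symm
  rw [connected_iff_exists_forall_reachable]
  refine ⟨⟨n, hnA⟩, fun v => ?_⟩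
  obtain ⟨w⟩ := hA.preconnected ⟨⟦v.1⟧, v.2⟩ ⟨⟦n⟧, hnA⟩
  exact key _ _ w v.1 rfl rfl

end SimpleGraph

/-- In a stable partition, every vertex has a neighbor in each class adjacent to its own. -/
lemma ArcCRStable.exists_adj {V C₂ : Type*} [Finite V] {G : SimpleGraph V} {χE : V → V → C₂}
    {r : V → V → Prop} (hr : Equivalence r) (h : ArcCRStable G χE r) {u u' v : V}
    (huu' : r u u') (hadj : G.Adj u v) : ∃ v', G.Adj u' v' ∧ r v' v := by
  have hpos : 0 < {x | G.Adj u' x ∧ r x v ∧ χE u' x = χE u v ∧ χE x u' = χE v u}.ncard := by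
    rw [← h u u' huu', Set.ncard_pos]
    exact ⟨v, hadj, hr.refl v, rfl, rfl⟩
  obtain ⟨x, hx⟩ := (Set.ncard_pos).1 hpos
  exact ⟨x, hx.1, hx.2.1⟩

/-- In a 3-connected graph, a set `U` of vertices missing three vertices has three distinct
outer neighbors. -/
lemma ThreeConnected.exists_three_outer_neighbors {V : Type*} [Finite V] {G : SimpleGraph V}
    (hG : ThreeConnected G) {U X : Set V} (hU : U.Nonempty) (hX : 2 < X.ncard)
    (hXU : Disjoint X U) :
    ∃ f : Fin 3 → V, Function.Injective f ∧ ∀ i, f i ∉ U ∧ ∃ u ∈ U, G.Adj u (f i) := by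
  let N : Set V := {v | v ∉ U ∧ ∃ u ∈ U, G.Adj u v}
  have hN : 2 < N.ncard := by
    by_contra! hN
    obtain ⟨u, hu⟩ := hU
    obtain ⟨v, hvX, hvN⟩ := Set.exists_mem_notMem_of_ncard_lt_ncard (hN.trans_lt hX)
    obtain ⟨x, hxN, hxU, y, hyN, hyU, hxy⟩ := (hG N hN).exists_adj_of_induce (A := U)
      hu (fun h => h.1 hu) (Set.disjoint_left.1 hXU hvX) hvN
    exact hyN ⟨hyU, x, hxU, hxy⟩
  obtain ⟨a, b, c, ha, hb, hc, hab, hac, hbc⟩ := (Set.two_lt_ncard_iff).1 hN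
  refine ⟨![a, b, c], ?_, ?_⟩
  · intro i j
    fin_cases i <;> fin_cases j <;> simp [hab, hac, hbc, hab.symm, hac.symm, hbc.symm]
  · intro i
    fin_cases i
    exacts [ha, hb, hc]

/-- In a 3-connected graph without `K_{3,h}` minor, a stable partition with at least three
singleton classes all of whose nonsingleton classes have at least `h` elements is discrete. -/
lemma eq_of_stable_of_not_hasMinor {V C₂ : Type*} [Finite V] {G : SimpleGraph V}
    {χE : V → V → C₂} {h : ℕ} (h3conn : ThreeConnected G)
    (hminor : ¬ HasMinor G (completeBipartiteGraph (Fin 3) (Fin h)))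
    {r : V → V → Prop} (hr : Equivalence r) (hst : ArcCRStable G χE r)
    (hdisc : TDiscrete (h - 1) r) {X : Set V} (hX : 2 < X.ncard)
    (hXr : ∀ v ∈ X, ∀ w, r v w → w = v) (v w : V) (hvw : r v w) : w = v := by
  by_contra hne
  apply hminor
  let s : Setoid V := ⟨r, hr⟩
  let Q := G.classGraph s
  have hs : ∀ (u : V) (q : Quotient s), Q.Adj ⟦u⟧ q → ∃ v, G.Adj u v ∧ ⟦v⟧ = q := by
    rintro u q ⟨-, u₁, v₁, hadj, hu, rfl⟩
    obtain ⟨v', hv', hrv⟩ := hst.exists_adj hr (Quotient.exact hu) hadj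
    exact ⟨v', hv', Quotient.sound hrv⟩
  -- a maximal connected set of nonsingleton classes
  let T : Set (Quotient s) := {q | ∀ u, ⟦u⟧ = q → ∃ u', r u u' ∧ u' ≠ u}
  have hT : ∀ u, ⟦u⟧ ∉ T → ∀ w, r u w → w = u := by
    intro u hu w hw
    by_contra hwu
    refine hu fun u' hu' => ?_
    have hu'u : r u' u := Quotient.exact hu'
    by_cases h' : u = u'
    · exact ⟨w, h' ▸ hw, fun h'' => hwu (h''.trans h'.symm)⟩
    · exact ⟨u, hu'u, h'⟩
  have hvT : ⟦v⟧ ∈ T := by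
    by_contra hvT
    exact hne (hT v hvT w hvw)
  obtain ⟨K, -, hK⟩ := (Set.toFinite {K : Set (Quotient s) | K ⊆ T ∧ (Q.induce K).Connected}
    ).exists_le_maximal (a := {⟦v⟧})
      ⟨Set.singleton_subset_iff.2 hvT, Q.induce_singleton_connected _⟩
  obtain ⟨hKT, hKc⟩ := hK.prop
  have hKN : ∀ k ∈ K, ∀ q, q ∉ K → Q.Adj k q → q ∉ T := by
    intro k hk q hq hkq hqT
    refine hq (hK.le_of_ge (y := K ∪ {q}) ⟨Set.union_subset hKT (Set.singleton_subset_iff.2 hqT),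
      ?_⟩ Set.subset_union_left (Or.inr rfl))
    exact SimpleGraph.connected_induce_union hKc.preconnected
      (Q.induce_singleton_connected q).preconnected hk rfl hkq
  obtain ⟨⟨k₀, hk₀⟩⟩ := hKc.nonempty
  obtain ⟨u₀, rfl⟩ := Quotient.exists_rep k₀
  obtain ⟨n, hninj, hn⟩ := h3conn.exists_three_outer_neighbors (U := {u | ⟦u⟧ ∈ K}) ⟨u₀, hk₀⟩ hX
    (Set.disjoint_left.2 fun x hx hxK => by
      obtain ⟨x', hx', hxx'⟩ := hKT hxK x rfl
      exact hxx' (hXr x hx x' hx'))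
  have hnadj : ∀ i, ∃ k ∈ K, Q.Adj k ⟦n i⟧ := fun i => by
    obtain ⟨hiK, u, hu, hadj⟩ := hn i
    exact ⟨⟦u⟧, hu, fun h => hiK (show ⟦n i⟧ ∈ K from h ▸ hu), u, n i, hadj, rfl, rfl⟩
  have hnr : ∀ i w, r (n i) w → w = n i := fun i => by
    obtain ⟨k, hk, hadj⟩ := hnadj i
    exact hT _ (hKN k hk _ (hn i).1 hadj)
  obtain ⟨x, hx, B, hAB, hBc, hBd, hxB, hxadj⟩ := Q.exists_disjoint_connected_adj K
    (fun i => {⟦n i⟧}) hKc (fun i => Q.induce_singleton_connected _)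
    (fun i j hij => Set.disjoint_singleton.2 fun h =>
      hij (hninj (hnr j _ (Quotient.exact h.symm))))
    (fun i => Set.disjoint_singleton_right.2 (hn i).1)
    (fun i => by
      obtain ⟨k, hk, hadj⟩ := hnadj i
      exact ⟨k, hk, _, rfl, hadj⟩)
  -- the class `x` has at least `h` elements
  obtain ⟨y, rfl⟩ := Quotient.exists_rep x
  have hcard : h ≤ {w | r y w}.ncard := by
    by_contra! hlt
    obtain ⟨y', hy', hne'⟩ := hKT hx y rfl
    exact hne' (hdisc y (by omega) y' hy')
  obtain ⟨f⟩ : Nonempty (Fin h ↪ {w | r y w}) := by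
    have := Fintype.ofFinite {w | r y w}
    refine Function.Embedding.nonempty_of_card_le ?_
    rwa [Fintype.card_fin, ← Nat.card_eq_fintype_card, Nat.card_coe_set_eq]
  have hf : ∀ j, (⟦(f j).1⟧ : Quotient s) = ⟦y⟧ := fun j => (Quotient.sound (f j).2).symm
  have hside : ∀ i j, ∃ b ∈ {u | ⟦u⟧ ∈ B i}, ∃ c ∈ ({(f j).1} : Set V), G.Adj b c := by
    intro i j
    obtain ⟨b, hb, hadj⟩ := hxadj i
    obtain ⟨b', hb', rfl⟩ := hs (f j).1 b (hf j ▸ hadj)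
    exact ⟨b', hb, _, rfl, hb'.symm⟩
  refine ⟨Sum.elim (fun i => {u | ⟦u⟧ ∈ B i}) (fun j => {(f j).1}), ?_, ?_, ?_, ?_⟩
  · rintro (i | j)
    · exact ⟨n i, hAB i rfl⟩
    · exact ⟨_, rfl⟩
  · rintro (i | j)
    · exact SimpleGraph.connected_induce_preimage_mk hs (hBc i) (hnr i) (hAB i rfl)
    · exact G.induce_singleton_connected _
  · have hBf : ∀ i j, (f j).1 ∉ {u | ⟦u⟧ ∈ B i} := fun i j hj => hxB i (hf j ▸ hj)
    rintro (i | j) (i' | j') hij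
    · exact (hBd fun h => hij (congrArg Sum.inl h)).preimage _
    · exact Set.disjoint_singleton_right.2 (hBf i j')
    · exact Set.disjoint_singleton_left.2 (hBf i' j)
    · exact Set.disjoint_singleton.2 fun h => hij (congrArg Sum.inr (f.injective (Subtype.ext h)))
  · rintro (i | j) (i' | j') hij
    · simp at hij
    · exact hside i j'
    · obtain ⟨b, hb, c, hc, h⟩ := hside i' j
      exact ⟨c, hc, b, hb, h.symm⟩
    · simp at hij

/-- Let `(G, χV, χE)` be a 3-connected vertex- and arc-colored finite
graph that excludes `K_{3,h}` as a minor, and let `v₁, v₂, v₃` be distinct vertices. Then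
`cl_{h-1}^G(v₁, v₂, v₃) = V(G)`. -/
theorem closure_of_three_vertices_eq_univ
    (V C₁ C₂ : Type) [Fintype V] (G : SimpleGraph V)
    (χV : V → C₁) (χE : V → V → C₂) (h : ℕ)
    (h3conn : ThreeConnected G)
    (hminor : ¬ HasMinor G (completeBipartiteGraph (Fin 3) (Fin h)))
    (v₁ v₂ v₃ : V) (h12 : v₁ ≠ v₂) (h13 : v₁ ≠ v₃) (h23 : v₂ ≠ v₃) :
    tClosure G χV χE (h - 1) {v₁, v₂, v₃} = Set.univ := by
  have hX : 2 < ({v₁, v₂, v₃} : Set V).ncard := by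
    rw [Set.ncard_eq_three.2 ⟨v₁, v₂, v₃, h12, h13, h23, rfl⟩]
    norm_num
  refine Set.eq_univ_of_forall fun v => ⟨Eq, ⟨⟨fun _ => rfl, Eq.symm, Eq.trans⟩, ?_, ?_, ?_, ?_⟩,
    fun w hw => hw.symm⟩
  · rintro v _ rfl _ _ _
    rfl
  · rintro v - w rfl
    rfl
  · rintro v _ rfl
    exact ⟨rfl, fun _ => rfl, fun _ => rfl⟩
  · intro s hs hst hdisc hinit v w hvw
    exact (eq_of_stable_of_not_hasMinor h3conn hminor hs hst hdisc hX
      (fun v hv w hvw => ((hinit v w hvw).2.1 hv).symm) v w hvw).symm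
end

section
/- Let G be a connected finite graph of maximum degree at most d and let v ∈ V(G). Then the d-closure of {v} with respect to G is all of V(G), i.e., cl_d^G(v) = V(G). -/
/-- In an uncolored graph, a neighbor of a vertex whose class is a singleton is only equivalent
to neighbors of that vertex. -/
lemma ArcCRStable.adj_of_adj {V : Type*} [Finite V] {G : SimpleGraph V} {s : V → V → Prop}
    (hs : Equivalence s) (hstable : ArcCRStable G (fun _ _ => ()) s) {u w w' : V}
    (hu : ∀ x, s u x → x = u) (huw : G.Adj u w) (hww' : s w w') : G.Adj u w' := by
  have hcard := hstable w w' hww' u () ()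
  have hpos : 0 < {x | G.Adj w x ∧ s x u ∧ () = () ∧ () = ()}.ncard :=
    (Set.ncard_pos (Set.toFinite _)).2 ⟨u, huw.symm, hs.refl u, rfl, rfl⟩
  rw [hcard] at hpos
  obtain ⟨x, hx, hxu, -⟩ := (Set.ncard_pos (Set.toFinite _)).1 hpos
  obtain rfl := hu x (hs.symm hxu)
  exact hx.symm

/-- In an uncolored connected graph of maximum degree at most `d`, a stable `d`-discrete
partition with a singleton class is discrete. -/
lemma ArcCRStable.eq_of_tDiscrete {V : Type*} [Finite V] {G : SimpleGraph V} {d : ℕ}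
    {s : V → V → Prop} (hconn : G.Connected) (hdeg : ∀ v : V, (G.neighborSet v).ncard ≤ d)
    (hs : Equivalence s) (hstable : ArcCRStable G (fun _ _ => ()) s) (hd : TDiscrete d s) {v : V}
    (hv : ∀ x, s v x → x = v) (u : V) : ∀ x, s u x → x = u := by
  have hreach := (SimpleGraph.reachable_iff_reflTransGen v u).1 (hconn.preconnected v u)
  induction hreach with
  | refl => exact hv
  | @tail b c _ hbc ih =>
    refine hd c (le_trans (Set.ncard_le_ncard (fun x hx => ?_) (Set.toFinite _)) (hdeg b))
    exact hstable.adj_of_adj hs ih hbc hx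

/-- Let `G` be a connected finite graph of maximum degree at most `d` and
let `v` be a vertex. Then `cl_d^G(v) = V(G)`. Here the closure is computed in the uncolored
graph, i.e., with trivial vertex and arc colorings, so that the initial coloring gives `v`
its own singleton color and all other vertices a common color. -/
theorem closure_of_vertex_eq_univ_of_maxDegree
    (V : Type) [Fintype V] (G : SimpleGraph V) (d : ℕ)
    (hconn : G.Connected)
    (hdeg : ∀ v : V, (G.neighborSet v).ncard ≤ d)
    (v : V) :
    tClosure G (fun _ => ()) (fun _ _ => ()) d {v} = Set.univ := by
  refine Set.eq_univ_of_forall fun u => ⟨Eq, ⟨eq_equivalence, ?_, ?_, ?_, ?_⟩, fun w h => h.symm⟩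
  · rintro x _ rfl u₀ a b
    rfl
  · exact fun _ _ _ h => h.symm
  · exact fun x y h => ⟨rfl, fun _ => h, fun _ => h⟩
  · intro s hs hstable hd hinit x y hxy
    refine (hstable.eq_of_tDiscrete hconn hdeg hs hd (v := v) ?_ x y hxy).symm
    exact fun z hz => ((hinit v z hz).2.1 rfl).symm
end

section
/- Let G be a finite graph and let χ be a vertex coloring of G that is stable with respect to the Color Refinement algorithm. Let X₁, …, X_m be distinct color classes of χ such that for every i ∈ [m−1] there is at least one edge of G between X_i and X_{i+1}. Then there are at least min_{i∈[m]} |X_i| pairwise vertex-disjoint paths in G, each starting at a vertex of X₁ and ending at a vertex of X_m. -/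
/-- A vertex coloring `χ` of `G` is stable with respect to the Color Refinement algorithm:
vertices of equal color have, for each color `c`, equally many neighbors of color `c`. -/
def IsCRStableColoring {V C : Type*} (G : SimpleGraph V) (χ : V → C) : Prop :=
  ∀ v w, χ v = χ w → ∀ c : C,
    {u | G.Adj v u ∧ χ u = c}.ncard = {u | G.Adj w u ∧ χ u = c}.ncard

open Finset in
/-- A bipartite relation between `A` and `B` which has at least one edge and is regular on both
sides carries a weighting of total weight `k` that is equidistributed on `A` and on `B`. -/
theorem exists_equidistributed_weight {V : Type*} [Fintype V] [DecidableEq V]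
    (A B : Finset V) (r : V → V → Prop) [DecidableRel r] (k : ℕ)
    (hA : ∀ v ∈ A, ∀ v' ∈ A, #{w ∈ B | r v w} = #{w ∈ B | r v' w})
    (hB : ∀ w ∈ B, ∀ w' ∈ B, #{v ∈ A | r v w} = #{v ∈ A | r v w'})
    (hedge : ∃ v ∈ A, ∃ w ∈ B, r v w) :
    ∃ f : V → V → ℝ, (∀ v w, 0 ≤ f v w) ∧
      (∀ v w, f v w ≠ 0 → v ∈ A ∧ w ∈ B ∧ r v w) ∧
      (∀ v, ∑ w, f v w = if v ∈ A then (k : ℝ) / #A else 0) ∧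
      (∀ w, ∑ v, f v w = if w ∈ B then (k : ℝ) / #B else 0) := by
  obtain ⟨a, ha, b, hb, hab⟩ := hedge
  have hcount : #A * #{w ∈ B | r a w} = #B * #{v ∈ A | r v b} := by
    have h := sum_card_bipartiteAbove_eq_sum_card_bipartiteBelow (s := A) (t := B) r
    simp only [bipartiteAbove, bipartiteBelow] at h
    rwa [sum_congr rfl fun v hv => hA v hv a ha, sum_congr rfl fun w hw => hB w hw b hb,
      sum_const, sum_const, smul_eq_mul, smul_eq_mul] at h
  have hApos : (0 : ℝ) < #A := by exact_mod_cast card_pos.2 ⟨a, ha⟩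
  have hBpos : (0 : ℝ) < #B := by exact_mod_cast card_pos.2 ⟨b, hb⟩
  have hdpos : (0 : ℝ) < #{w ∈ B | r a w} := by
    exact_mod_cast card_pos.2 ⟨b, by simp [hb, hab]⟩
  have hepos : (0 : ℝ) < #{v ∈ A | r v b} := by
    exact_mod_cast card_pos.2 ⟨a, by simp [ha, hab]⟩
  have hcount' : (#A : ℝ) * #{w ∈ B | r a w} = #B * #{v ∈ A | r v b} := by
    exact_mod_cast hcount
  refine ⟨fun v w => if v ∈ A ∧ w ∈ B ∧ r v w then (k : ℝ) / (#A * #{w ∈ B | r a w}) else 0,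
    fun v w => ?_, fun v w h => ?_, fun v => ?_, fun w => ?_⟩
  · dsimp only
    split_ifs <;> positivity
  · by_contra h'
    simp [h'] at h
  · split_ifs with hv
    · have h : ({w | v ∈ A ∧ w ∈ B ∧ r v w} : Finset V) = {w ∈ B | r v w} := by
        ext; simp [hv]
      rw [← sum_filter, h, sum_const, hA v hv a ha, nsmul_eq_mul]
      field_simp
    · simp [hv]
  · split_ifs with hw
    · have h : ({v | v ∈ A ∧ w ∈ B ∧ r v w} : Finset V) = {v ∈ A | r v w} := by
        ext; simp [hw]
      rw [← sum_filter, h, sum_const, hB w hw b hb, nsmul_eq_mul, hcount']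
      field_simp
    · simp [hw]

open Finset in
/-- A fractional circulation of value `k` through cyclically arranged disjoint layers with at least
`k` vertices each, equidistributed on every layer, yields a permutation that moves vertices only
along the support of the circulation and moves at least `k` vertices from the last layer to the
first. -/
theorem exists_perm_of_equidistributed_circulation {V : Type*} [Fintype V] [DecidableEq V]
    {n : ℕ} (A : Fin (n + 1) → Finset V) (hdisj : ∀ i j v, v ∈ A i → v ∈ A j → i = j)
    (k : ℕ) (hk : ∀ i, k ≤ #(A i)) (hlast : (A (Fin.last n)).Nonempty)
    (f : Fin (n + 1) → V → V → ℝ) (hf : ∀ i v w, 0 ≤ f i v w)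
    (hsupp : ∀ i v w, f i v w ≠ 0 → w ∈ A (i + 1))
    (hrow : ∀ i v, ∑ w, f i v w = if v ∈ A i then (k : ℝ) / #(A i) else 0)
    (hcol : ∀ i w, ∑ v, f i v w = if w ∈ A (i + 1) then (k : ℝ) / #(A (i + 1)) else 0) :
    ∃ σ : Equiv.Perm V, (∀ v, σ v = v ∨ ∃ i, f i v (σ v) ≠ 0) ∧
      k ≤ #{v ∈ A (Fin.last n) | σ v ∈ A 0} := by
  set load : V → ℝ := fun v => ∑ i, if v ∈ A i then (k : ℝ) / #(A i) else 0 with hload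
  have hload1 : ∀ v, load v ≤ 1 := by
    intro v
    by_cases hv : ∃ i, v ∈ A i
    · obtain ⟨i, hi⟩ := hv
      rw [hload]
      dsimp only
      rw [sum_eq_single i (fun j _ hj => if_neg fun h => hj (hdisj j i v h hi)) (by simp),
        if_pos hi]
      exact div_le_one_of_le₀ (by exact_mod_cast hk i) (by positivity)
    · push Not at hv
      simp [hload, hv]
  set M : Matrix V V ℝ := fun v w => ∑ i, f i v w + if v = w then 1 - load v else 0 with hM
  have hdiag : ∀ v w, 0 ≤ if v = w then 1 - load v else 0 := by
    intro v w
    split_ifs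
    · linarith [hload1 v]
    · rfl
  have hmem : M ∈ doublyStochastic ℝ V := by
    rw [mem_doublyStochastic_iff_sum]
    refine ⟨fun v w => add_nonneg (sum_nonneg fun i _ => hf i v w) (hdiag v w),
      fun v => ?_, fun w => ?_⟩
    · simp only [hM, sum_add_distrib]
      rw [sum_comm]
      simp [hrow, hload]
    · simp only [hM, sum_add_distrib]
      rw [sum_comm]
      have hshift : (∑ i, if w ∈ A (i + 1) then (k : ℝ) / #(A (i + 1)) else 0) = load w :=
        Equiv.sum_comp (Equiv.addRight (1 : Fin (n + 1)))
          (fun i => if w ∈ A i then (k : ℝ) / #(A i) else 0)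
      simp [hcol, hshift]
  obtain ⟨c, hc, hc1, hcM⟩ := exists_eq_sum_perm_of_mem_doublyStochastic hmem
  have hentry : ∀ v w, M v w = ∑ σ : Equiv.Perm V, c σ * if σ v = w then 1 else 0 := by
    intro v w
    rw [← hcM]
    simp [Matrix.sum_apply, Equiv.Perm.permMatrix, PEquiv.toMatrix_apply, eq_comm]
  have htotal : (k : ℝ) ≤ ∑ σ, c σ * #{v ∈ A (Fin.last n) | σ v ∈ A 0} := by
    calc (k : ℝ) = ∑ v ∈ A (Fin.last n), ∑ w, f (Fin.last n) v w := by
          have : (#(A (Fin.last n)) : ℝ) ≠ 0 := by exact_mod_cast (card_pos.2 hlast).ne'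
          rw [sum_congr rfl fun v hv => (hrow _ v).trans (if_pos hv), sum_const, nsmul_eq_mul]
          field_simp
      _ = ∑ v ∈ A (Fin.last n), ∑ w ∈ A 0, f (Fin.last n) v w := by
          refine sum_congr rfl fun v _ => (sum_subset (subset_univ _) fun w _ hw => ?_).symm
          by_contra h
          exact hw (by simpa using hsupp _ _ _ h)
      _ ≤ ∑ v ∈ A (Fin.last n), ∑ w ∈ A 0, M v w := by
          refine sum_le_sum fun v _ => sum_le_sum fun w _ => ?_
          have h := single_le_sum (f := fun i => f i v w) (fun i _ => hf i v w)
            (mem_univ (Fin.last n))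
          have h' := hdiag v w
          simp only [hM]
          linarith
      _ = ∑ σ, c σ * #{v ∈ A (Fin.last n) | σ v ∈ A 0} := by
          simp only [hentry]
          rw [sum_congr rfl fun v _ => sum_comm, sum_comm]
          refine sum_congr rfl fun σ _ => ?_
          simp only [← mul_sum]
          simp only [sum_ite_eq, sum_boole]
  obtain ⟨σ, hσ, hkσ⟩ : ∃ σ, 0 < c σ ∧ k ≤ #{v ∈ A (Fin.last n) | σ v ∈ A 0} := by
    by_contra! hcon
    have hle : ∑ σ, c σ * (#{v ∈ A (Fin.last n) | σ v ∈ A 0} : ℝ) ≤ ∑ σ, c σ * ((k : ℝ) - 1) := by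
      refine sum_le_sum fun σ _ => ?_
      rcases (hc σ).eq_or_lt with h | h
      · simp [← h]
      · have : (#{v ∈ A (Fin.last n) | σ v ∈ A 0} : ℝ) + 1 ≤ k := by exact_mod_cast hcon σ h
        exact mul_le_mul_of_nonneg_left (by linarith) h.le
    rw [← sum_mul, hc1] at hle
    linarith
  refine ⟨σ, fun v => ?_, hkσ⟩
  by_contra! hv
  have hpos : 0 < M v (σ v) := by
    rw [hentry]
    refine sum_pos' (fun τ _ => mul_nonneg (hc τ) (by split_ifs <;> simp)) ⟨σ, mem_univ _, ?_⟩
    simpa using hσ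
  simp [hM, hv.2, hv.1.symm] at hpos

/-- A sequence of consecutively adjacent vertices is the support of a walk. -/
theorem SimpleGraph.exists_walk_support_eq_map_range {V : Type*} (G : SimpleGraph V) (p : ℕ → V)
    (n : ℕ) (h : ∀ t < n, G.Adj (p t) (p (t + 1))) :
    ∃ W : G.Walk (p 0) (p n), W.support = (List.range (n + 1)).map p := by
  induction n with
  | zero => exact ⟨.nil, by simp⟩
  | succ n ih =>
    obtain ⟨W, hW⟩ := ih fun t ht => h t (by omega)
    refine ⟨W.concat (h n (by omega)), ?_⟩
    rw [SimpleGraph.Walk.support_concat, hW, List.range_succ (n := n + 1)]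
    simp

open Finset in
/-- In a stable coloring, all vertices of a color class have equally many neighbors in any other
fixed color class. -/
theorem IsCRStableColoring.card_filter_adj_eq {V C : Type*} [Fintype V] {G : SimpleGraph V}
    [DecidableRel G.Adj] {χ : V → C} (hstable : IsCRStableColoring G χ) {A B : Finset V}
    (hA : ∃ c, (A : Set V) = χ ⁻¹' {c}) (hB : ∃ c, (B : Set V) = χ ⁻¹' {c})
    {v w : V} (hv : v ∈ A) (hw : w ∈ A) : #{u ∈ B | G.Adj v u} = #{u ∈ B | G.Adj w u} := by
  obtain ⟨a, ha⟩ := hA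
  obtain ⟨b, hb⟩ := hB
  have hmemA : ∀ x, x ∈ A ↔ χ x = a := fun x => by rw [← mem_coe, ha]; rfl
  have hmemB : ∀ x, x ∈ B ↔ χ x = b := fun x => by rw [← mem_coe, hb]; rfl
  have key : ∀ x, {u | G.Adj x u ∧ χ u = b}.ncard = #{u ∈ B | G.Adj x u} := by
    intro x
    rw [← Set.ncard_coe_finset]
    congr 1
    ext u
    simp [hmemB, and_comm]
  rw [← key, ← key]
  exact hstable v w (by rw [(hmemA v).1 hv, (hmemA w).1 hw]) b

open Finset in
/-- The color classes `X 0, …, X n` are traversed in order by a permutation fixing every vertex it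
does not move to an adjacent vertex of the next class, except that it also moves at least
`k ≤ min_i |X i|` vertices from the last class to the first. -/
theorem IsCRStableColoring.exists_perm {V C : Type*} [Fintype V] [DecidableEq V]
    {G : SimpleGraph V} [DecidableRel G.Adj] {χ : V → C} (hstable : IsCRStableColoring G χ)
    {n : ℕ} (A : Fin (n + 1) → Finset V) (hdisj : ∀ i j v, v ∈ A i → v ∈ A j → i = j)
    (hclass : ∀ i, ∃ c, (A i : Set V) = χ ⁻¹' {c}) (hne : ∀ i, (A i).Nonempty)
    (hedges : ∀ i, i ≠ Fin.last n → ∃ v ∈ A i, ∃ w ∈ A (i + 1), G.Adj v w)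
    (k : ℕ) (hk : ∀ i, k ≤ #(A i)) :
    ∃ σ : Equiv.Perm V,
      (∀ v, σ v = v ∨ ∃ i, v ∈ A i ∧ σ v ∈ A (i + 1) ∧ (i ≠ Fin.last n → G.Adj v (σ v))) ∧
      k ≤ #{v ∈ A (Fin.last n) | σ v ∈ A 0} := by
  have hweight : ∀ i, ∃ f : V → V → ℝ, (∀ v w, 0 ≤ f v w) ∧
      (∀ v w, f v w ≠ 0 → v ∈ A i ∧ w ∈ A (i + 1) ∧ (i ≠ Fin.last n → G.Adj v w)) ∧
      (∀ v, ∑ w, f v w = if v ∈ A i then (k : ℝ) / #(A i) else 0) ∧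
      (∀ w, ∑ v, f v w = if w ∈ A (i + 1) then (k : ℝ) / #(A (i + 1)) else 0) := by
    intro i
    refine exists_equidistributed_weight (A i) (A (i + 1)) (fun v w => i ≠ Fin.last n → G.Adj v w)
      k ?_ ?_ ?_
    · intro v hv v' hv'
      by_cases hi : i = Fin.last n
      · simp [hi]
      · simpa [hi] using hstable.card_filter_adj_eq (hclass i) (hclass (i + 1)) hv hv'
    · intro w hw w' hw'
      by_cases hi : i = Fin.last n
      · simp [hi]
      · simpa [hi, G.adj_comm] using
          hstable.card_filter_adj_eq (hclass (i + 1)) (hclass i) hw hw'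
    · by_cases hi : i = Fin.last n
      · obtain ⟨v, hv⟩ := hne i
        obtain ⟨w, hw⟩ := hne (i + 1)
        exact ⟨v, hv, w, hw, fun h => absurd hi h⟩
      · obtain ⟨v, hv, w, hw, h⟩ := hedges i hi
        exact ⟨v, hv, w, hw, fun _ => h⟩
  choose f hf hsupp hrow hcol using hweight
  obtain ⟨σ, hσ, hkσ⟩ := exists_perm_of_equidistributed_circulation A hdisj k hk (hne _) f hf
    (fun i v w h => (hsupp i v w h).2.1) hrow hcol
  exact ⟨σ, fun v => (hσ v).imp_right fun ⟨i, hi⟩ => ⟨i, hsupp i v _ hi⟩, hkσ⟩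

/-- Let `χ` be a CR-stable coloring of a finite graph `G` and let
`X 0, …, X (m-1)` be distinct (nonempty) color classes of `χ` such that consecutive classes
are joined by at least one edge. Then there are at least `min_i |X i|` pairwise
vertex-disjoint paths in `G` from `X 0` to `X (m-1)`. -/
theorem disjoint_paths_between_color_classes
    (V C : Type) [Fintype V] (G : SimpleGraph V) (χ : V → C)
    (hstable : IsCRStableColoring G χ)
    (m : ℕ) (hm : 0 < m) (X : Fin m → Set V)
    (hclass : ∀ i, ∃ c : C, X i = χ ⁻¹' {c})
    (hne : ∀ i, (X i).Nonempty)
    (hdistinct : Function.Injective X)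
    (hedges : ∀ (i : ℕ) (hi : i + 1 < m),
      ∃ v ∈ X ⟨i, by omega⟩, ∃ w ∈ X ⟨i + 1, hi⟩, G.Adj v w) :
    ∃ (a b : Fin (⨅ i, (X i).ncard) → V)
      (P : ∀ j, G.Walk (a j) (b j)),
      (∀ j, (P j).IsPath) ∧
      (∀ j, a j ∈ X ⟨0, hm⟩) ∧
      (∀ j, b j ∈ X ⟨m - 1, by omega⟩) ∧
      (∀ j j', j ≠ j' → ∀ x, x ∈ (P j).support → x ∉ (P j').support) := by
  classical
  obtain ⟨n, rfl⟩ : ∃ n, m = n + 1 := ⟨m - 1, by omega⟩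
  have hk : ∀ i, (⨅ i, (X i).ncard) ≤ (X i).ncard := fun i => ciInf_le (OrderBot.bddBelow _) i
  generalize (⨅ i, (X i).ncard) = k at hk ⊢
  have hdisj : ∀ i j v, v ∈ X i → v ∈ X j → i = j := by
    intro i j v hi hj
    apply hdistinct
    obtain ⟨c, hc⟩ := hclass i
    obtain ⟨d, hd⟩ := hclass j
    rw [hc] at hi
    rw [hd] at hj
    rw [hc, hd, ← show χ v = c from hi, ← show χ v = d from hj]
  rcases Nat.eq_zero_or_pos n with rfl | hn
  · obtain ⟨s, hs, hsk⟩ := Set.exists_subset_card_eq (hk 0)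
    have e : Fin k ≃ s := (Fintype.equivFinOfCardEq
      (by rw [← hsk, ← Nat.card_coe_set_eq, Nat.card_eq_fintype_card])).symm
    refine ⟨fun j => e j, fun j => e j, fun j => .nil, fun j => .nil, fun j => hs (e j).2,
      fun j => hs (e j).2, fun j j' hj x hx hx' => hj ?_⟩
    simp only [SimpleGraph.Walk.support_nil, List.mem_singleton] at hx hx'
    exact e.injective (Subtype.ext (hx.symm.trans hx'))
  obtain ⟨σ, hσ, hkσ⟩ := hstable.exists_perm (fun i => (X i).toFinset) (by simpa using hdisj)
    (by simpa using hclass) (by simpa using hne)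
    (by
      intro i hi
      have hi' : (i : ℕ) < n := Fin.val_lt_last hi
      obtain ⟨v, hv, w, hw, h⟩ := hedges i (by omega)
      have heq : (⟨(i : ℕ) + 1, by omega⟩ : Fin (n + 1)) = i + 1 :=
        Fin.ext (Fin.val_add_one_of_lt (Fin.lt_last_iff_ne_last.2 hi)).symm
      exact ⟨v, by simpa using hv, w, by simpa [← heq] using hw, h⟩)
    k (fun i => by simpa [Set.ncard_eq_toFinset_card'] using hk i)
  simp only [Set.mem_toFinset] at hσ hkσ
  obtain ⟨s, hs, hsk⟩ := Finset.exists_subset_card_eq hkσ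
  have e : Fin k ≃ s := (s.equivFinOfCardEq hsk).symm
  have hmem : ∀ j, (e j : V) ∈ X (Fin.last n) ∧ σ (e j) ∈ X 0 := fun j => by
    simpa using hs (e j).2
  have hmoves : ∀ j t, (σ ^ t) (σ (e j)) ≠ (σ ^ (t + 1)) (σ (e j)) := by
    intro j t h
    rw [pow_succ, Equiv.Perm.mul_apply] at h
    have h' := σ.injective ((σ ^ t).injective h)
    have := hdisj _ _ _ (hmem j).1 (Set.mem_of_eq_of_mem h' (hmem j).2)
    simp [Fin.ext_iff] at this
    omega
  have hstep : ∀ j t (ht : t < n), (σ ^ t) (σ (e j)) ∈ X ⟨t, by omega⟩ →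
      (σ ^ (t + 1)) (σ (e j)) ∈ X ⟨t + 1, by omega⟩ ∧
      G.Adj ((σ ^ t) (σ (e j))) ((σ ^ (t + 1)) (σ (e j))) := by
    intro j t ht hX
    have hm := hmoves j t
    rw [pow_succ', Equiv.Perm.mul_apply] at hm ⊢
    rcases hσ ((σ ^ t) (σ (e j))) with h | ⟨i, hi, hi', hadj⟩
    · exact absurd h.symm hm
    obtain rfl := hdisj _ _ _ hi hX
    have hlast : (⟨t, by omega⟩ : Fin (n + 1)) ≠ Fin.last n := by
      simp [Fin.ext_iff]
      omega
    have heq : (⟨t, by omega⟩ : Fin (n + 1)) + 1 = ⟨t + 1, by omega⟩ :=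
      Fin.ext (Fin.val_add_one_of_lt (Fin.lt_last_iff_ne_last.2 hlast))
    exact ⟨heq ▸ hi', hadj hlast⟩
  have hlayer : ∀ j t (ht : t < n + 1), (σ ^ t) (σ (e j)) ∈ X ⟨t, ht⟩ := by
    intro j t
    induction t with
    | zero => exact fun _ => (hmem j).2
    | succ t ih => exact fun ht => (hstep j t (by omega) (ih (by omega))).1
  choose P hP using fun j => G.exists_walk_support_eq_map_range (fun t => (σ ^ t) (σ (e j))) n
    fun t ht => (hstep j t ht (hlayer j t (by omega))).2
  refine ⟨_, _, P, fun j => ?_, fun j => hlayer j 0 (by omega), fun j => hlayer j n (by omega),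
    fun j j' hj x hx hx' => hj ?_⟩
  · rw [SimpleGraph.Walk.isPath_def, hP]
    refine List.Nodup.map_on (fun t ht t' ht' h => ?_) List.nodup_range
    have hl := hlayer j t (List.mem_range.1 ht)
    rw [h] at hl
    simpa using hdisj _ _ _ hl (hlayer j t' (List.mem_range.1 ht'))
  · rw [hP, List.mem_map] at hx hx'
    obtain ⟨t, ht, rfl⟩ := hx
    obtain ⟨t', ht', h⟩ := hx'
    have hl := hlayer j t (List.mem_range.1 ht)
    rw [← h] at hl
    obtain rfl : t = t' := by
      simpa using hdisj _ _ _ hl (hlayer j' t' (List.mem_range.1 ht'))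
    exact (e.injective (Subtype.ext (σ.injective ((σ ^ t).injective h)))).symm
end
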